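/- arXiv:math/9712251 — 7 statements merged into one kernel-verified Lean document; each statement's English description precedes it below -/
import Mathlib

section
/- Let H_1, …, H_n be a 2-arrangement in ℝ⁴ and X = ℝ⁴ ∖ (H_1 ∪ … ∪ H_n) its complement. Then X is aspherical: for every basepoint x ∈ X and every integer k ≥ 2, the k-th homotopy group π_k(X, x) is trivial. -/
/-- A 2-arrangement of `n` planes in `ℝ⁴`: a family of 2-dimensional real linear
subspaces of `ℝ⁴` that pairwise intersect only in `0`. -/
def IsTwoArrangement {n : ℕ} (H : Fin n → Submodule ℝ (EuclideanSpace ℝ (Fin 4))) : Prop :=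
  (∀ i, Module.finrank ℝ (H i) = 2) ∧ ∀ i j, i ≠ j → H i ⊓ H j = ⊥

open scoped unitInterval Topology

namespace TwoArr

/-- all values in `S` and constant on `D`. -/
def PP {K V : Type*} [TopologicalSpace K] [TopologicalSpace V] (S : Set V) (D : Set K) :
    C(K, V) → Prop :=
  fun h => (∀ x, h x ∈ S) ∧ ∀ x ∈ D, ∀ y ∈ D, h x = h y

def NullH {K V : Type*} [TopologicalSpace K] [TopologicalSpace V] (S : Set V) (D : Set K)
    (f : C(K, V)) : Prop :=
  ∃ c, ContinuousMap.HomotopicWith f (ContinuousMap.const K c) (PP S D)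

lemma mkHD {K V : Type*} [TopologicalSpace K] [TopologicalSpace V] {S : Set V} {D : Set K}
    {f g : C(K, V)} (F : ℝ × K → V) (hF : Continuous F) (h0 : ∀ x, F (0, x) = f x)
    (h1 : ∀ x, F (1, x) = g x)
    (hS : ∀ t, 0 ≤ t → t ≤ 1 → ∀ x, F (t, x) ∈ S)
    (hD : ∀ t, 0 ≤ t → t ≤ 1 → ∀ x ∈ D, ∀ y ∈ D, F (t, x) = F (t, y)) :
    ContinuousMap.HomotopicWith f g (PP S D) := by
  refine ⟨{ toFun := fun p => F (p.1, p.2), continuous_toFun := by fun_prop,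
            map_zero_left := by simpa using h0, map_one_left := by simpa using h1,
            prop' := fun t => ⟨fun x => ?_, fun x hx y hy => ?_⟩ }⟩
  · exact hS t t.2.1 t.2.2 x
  · exact hD t t.2.1 t.2.2 x hx y hy

lemma map_HD {K V V' : Type*} [TopologicalSpace K] [TopologicalSpace V] [TopologicalSpace V']
    {S : Set V} {S' : Set V'} {D : Set K} {f g : C(K, V)} (φ : C(V, V'))
    (hφ : ∀ v ∈ S, φ v ∈ S')
    (h : ContinuousMap.HomotopicWith f g (PP S D)) :
    ContinuousMap.HomotopicWith (φ.comp f) (φ.comp g) (PP S' D) := by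
  obtain ⟨F⟩ := h
  refine ⟨{ toFun := fun p => φ (F p), continuous_toFun := by fun_prop,
            map_zero_left := by simp, map_one_left := by simp,
            prop' := fun t => ⟨fun x => hφ _ ((F.prop t).1 x), fun x hx y hy => ?_⟩ }⟩
  exact congrArg φ ((F.prop t).2 x hx y hy)

/-! ### words -/
section words
variable {α : Type*} [DecidableEq α]

def sw (a : α) : List α → List α
  | [] => [a]
  | b :: l => if a = b then l else a :: b :: l

lemma sw_chain (a : α) (l : List α) (h : l.IsChain (· ≠ ·)) : (sw a l).IsChain (· ≠ ·) := by
  cases l with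
  | nil => simp [sw]
  | cons b l =>
    simp only [sw]
    split_ifs with hab
    · exact h.tail
    · exact List.isChain_cons_cons.2 ⟨hab, h⟩

lemma sw_sw (a : α) (l : List α) (h : l.IsChain (· ≠ ·)) : sw a (sw a l) = l := by
  cases l with
  | nil => simp [sw]
  | cons b l =>
    by_cases hab : a = b
    · subst hab
      cases l with
      | nil => simp [sw]
      | cons c l =>
        have := (List.isChain_cons_cons.1 h).1
        simp [sw, this]
    · simp [sw, hab]

lemma sw_len (a : α) (v : List α) (h : (sw a v).length ≤ v.length) : v = a :: sw a v := by
  cases v with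
  | nil => simp [sw] at h
  | cons b l =>
    by_cases hab : a = b
    · subst hab; simp [sw]
    · simp [sw, hab] at h
end words

/-! ### slit planes -/
noncomputable def sg (e : Bool) : ℝ := if e then 1 else -1

def Ue (P : Finset (ℝ × ℝ)) (e : Bool) : Set (ℝ × ℝ) :=
  {z | ∀ p ∈ P, p.1 = z.1 → 0 < sg e * (z.2 - p.2)}

noncomputable def J (P : Finset (ℝ × ℝ)) (x : ℝ) : Finset (ℝ × ℝ) := P.filter (fun p => p.1 < x)

lemma Ue_compl {P e z} (h : z ∈ Ue P e) : z ∉ P := fun hz => by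
  have := h z hz rfl
  simp at this

lemma off {P e z} (h : z ∈ Ue P e) (h' : z ∈ Ue P (!e)) : ∀ p ∈ P, p.1 ≠ z.1 := by
  intro p hp hpz
  have h1 := h p hp hpz
  have h2 := h' p hp hpz
  cases e <;> simp [sg] at h1 h2 <;> linarith

lemma off_mem {P e} {z : ℝ × ℝ} (h : ∀ p ∈ P, p.1 ≠ z.1) : z ∈ Ue P e :=
  fun p hp hpz => absurd hpz (h p hp)

lemma J_seg {P : Finset (ℝ × ℝ)} {x c s : ℝ} (hx : ∀ p ∈ P, p.1 ≠ x) (hc : ∀ p ∈ P, p.1 ≠ c)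
    (hJ : J P x = J P c) (hs0 : 0 ≤ s) (hs1 : s ≤ 1) :
    (∀ p ∈ P, p.1 ≠ x + s * (c - x)) ∧ J P (x + s * (c - x)) = J P c := by
  have key : ∀ p ∈ P, (p.1 < x ↔ p.1 < c) := by
    intro p hp
    have : p ∈ J P x ↔ p ∈ J P c := by rw [hJ]
    simpa [J, hp] using this
  have key2 : ∀ p ∈ P, (p.1 < x ∧ p.1 < c ∧ p.1 < x + s * (c - x)) ∨
      (x < p.1 ∧ c < p.1 ∧ x + s * (c - x) < p.1) := by
    intro p hp
    rcases lt_or_gt_of_ne (hx p hp) with h | h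
    · left
      have h2 := (key p hp).1 h
      refine ⟨h, h2, ?_⟩
      by_contra hcon
      push Not at hcon
      rcases eq_or_lt_of_le hs0 with h0 | h0
      · subst h0; linarith
      · nlinarith
    · right
      have h2 : c < p.1 := by
        rcases lt_or_gt_of_ne (hc p hp) with h3 | h3
        · exact absurd ((key p hp).2 h3) (by linarith)
        · exact h3
      refine ⟨h, h2, ?_⟩
      by_contra hcon
      push Not at hcon
      rcases eq_or_lt_of_le hs0 with h0 | h0
      · subst h0; linarith
      · nlinarith
  constructor
  · intro p hp h
    rcases key2 p hp with h' | h' <;> linarith [h'.2.2]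
  · unfold J
    apply Finset.filter_congr
    intro p hp
    rcases key2 p hp with h' | h'
    · exact ⟨fun _ => h'.2.1, fun _ => h'.2.2⟩
    · exact ⟨fun h => absurd h (by linarith [h'.2.2]), fun h => absurd h (by linarith [h'.2.1])⟩

noncomputable def s1 (t : ℝ) : ℝ := min 1 (2 * t)
noncomputable def s2 (t : ℝ) : ℝ := max 0 (2 * t - 1)

noncomputable def Hm (e : Bool) (M c t : ℝ) (z : ℝ × ℝ) : ℝ × ℝ :=
  (z.1 + s2 t * (c - z.1), z.2 + sg e * (s1 t * (|z.2| + M + 1)))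

lemma Hm_zero (e M c z) : Hm e M c 0 z = z := by
  simp [Hm, s1, s2]

lemma Hm_one (e M c z) : Hm e M c 1 z = (c, z.2 + sg e * (|z.2| + M + 1)) := by
  simp [Hm, s1, s2]; norm_num

lemma Hm_cont (e M c) : Continuous (fun q : ℝ × (ℝ × ℝ) => Hm e M c q.1 q.2) := by
  unfold Hm s1 s2; fun_prop

lemma sg_sq (e) : sg e * sg e = 1 := by cases e <;> simp [sg]

lemma Hm_one_pos (e M c z) : M < sg e * (Hm e M c 1 z).2 := by
  rw [Hm_one]
  have h1 := neg_abs_le z.2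
  have h2 := le_abs_self z.2
  cases e <;> simp [sg] <;> linarith

lemma half_mem {P : Finset (ℝ × ℝ)} {e M z} (hM : ∀ p ∈ P, |p.2| ≤ M) (hz : M < sg e * z.2) :
    z ∈ Ue P e := by
  intro p hp _
  have := abs_le.1 (hM p hp)
  cases e <;> simp [sg] at hz ⊢ <;> linarith

lemma Hm_Ue {P : Finset (ℝ × ℝ)} {e M c t z} (hM : ∀ p ∈ P, |p.2| ≤ M) (hM0 : 0 ≤ M)
    (h0 : 0 ≤ t)
    (hz : z ∈ Ue P e) : Hm e M c t z ∈ Ue P e := by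
  rcases le_total t (1/2) with h | h
  · have e1 : s1 t = 2 * t := min_eq_right (by linarith)
    have e2 : s2 t = 0 := max_eq_left (by linarith)
    intro p hp hpz
    simp only [Hm, e2, e1, zero_mul, add_zero] at hpz ⊢
    have h3 := hz p hp hpz
    have : 0 ≤ 2 * t * (|z.2| + M + 1) := by positivity
    have h4 := sg_sq e
    nlinarith
  · have e1 : s1 t = 1 := min_eq_left (by linarith)
    apply half_mem hM
    have := Hm_one_pos e M c z
    rw [Hm_one] at this
    simpa [Hm, e1] using this

lemma s2_mem {t : ℝ} (h1 : t ≤ 1) : 0 ≤ s2 t ∧ s2 t ≤ 1 := by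
  constructor
  · exact le_max_left _ _
  · exact max_le (by norm_num) (by linarith)

theorem null_of_Ue {K : Type*} [TopologicalSpace K] {D : Set K} {P : Finset (ℝ × ℝ)} {e : Bool}
    (f : C(K, ℝ × ℝ)) (hf : ∀ x, f x ∈ Ue P e) (hD : ∀ x ∈ D, ∀ y ∈ D, f x = f y) :
    NullH ((P : Set (ℝ × ℝ))ᶜ) D f := by
  set M : ℝ := ∑ p ∈ P, |p.2| with hMdef
  have hM : ∀ p ∈ P, |p.2| ≤ M := fun p hp =>
    Finset.single_le_sum (f := fun p : ℝ × ℝ => |p.2|) (fun _ _ => abs_nonneg _) hp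
  have hM0 : 0 ≤ M := Finset.sum_nonneg fun _ _ => abs_nonneg _
  have hc := Hm_cont e M 0
  let g : C(K, ℝ × ℝ) := ⟨fun x => Hm e M 0 1 (f x), by
    exact hc.comp (continuous_const.prodMk f.continuous)⟩
  refine ⟨(0, sg e * (M + 1)), ContinuousMap.HomotopicWith.trans (g := g) ?_ ?_⟩
  · refine mkHD (fun q => Hm e M 0 q.1 (f q.2)) ?_ ?_ ?_ ?_ ?_
    · exact hc.comp (by fun_prop : Continuous fun q : ℝ × K => (q.1, f q.2))
    · intro x; exact Hm_zero _ _ _ _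
    · intro x; rfl
    · intro t h0 h1 x
      exact Ue_compl (Hm_Ue hM hM0 h0 (hf x))
    · intro t h0 h1 x hx y hy
      simp only [hD x hx y hy]
  · refine mkHD (fun q => (1 - q.1) • g q.2 + q.1 • ((0 : ℝ), sg e * (M + 1))) (by fun_prop)
      ?_ ?_ ?_ ?_
    · intro x; simp
    · intro x; simp
    · intro t h0 h1 x
      refine Ue_compl (half_mem hM (e := e) ?_)
      have h2 : M < sg e * (g x).2 := Hm_one_pos e M 0 (f x)
      have h3 := sg_sq e
      simp only [Prod.snd_add, Prod.smul_snd, smul_eq_mul]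
      have h5 : sg e * ((1 - t) * (g x).2 + t * (sg e * (M + 1))) =
        (1 - t) * (sg e * (g x).2) + t * (M + 1) := by linear_combination (t * (M+1)) * h3
      rw [h5]
      rcases eq_or_lt_of_le h0 with h | h
      · subst h; linarith
      · nlinarith
    · intro t h0 h1 x hx y hy
      have : g x = g y := by simp only [g, ContinuousMap.coe_mk, hD x hx y hy]
      simp only [this]

set_option maxHeartbeats 1000000 in
theorem leaf {K : Type*} [TopologicalSpace K] [NormalSpace K] [PreconnectedSpace K] [Nonempty K]
    {D : Set K} (hDc : IsClosed D) (P : Finset (ℝ × ℝ)) (n : ℕ) :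
    ∀ (N : Finset (Bool × List (Finset (ℝ × ℝ)))) (f : C(K, ℝ × ℝ))
    (O : Bool × List (Finset (ℝ × ℝ)) → Set K), N.card = n →
    (∀ a, IsOpen (O a)) → (∀ a, a ∉ N → O a = ∅) → (∀ x, ∃ a, x ∈ O a) →
    (∀ a, ∀ x ∈ O a, f x ∈ Ue P a.1) →
    (∀ a b x, x ∈ O a → x ∈ O b → a.1 = b.1 → a = b) →
    (∀ a b x, x ∈ O a → x ∈ O b → a.1 ≠ b.1 → b.2 = sw (J P (f x).1) a.2) →
    (∀ a, ∀ x ∈ D, ∀ y ∈ D, x ∈ O a → y ∈ O a) →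
    (∀ x ∈ D, ∀ y ∈ D, f x = f y) → NullH ((P : Set (ℝ × ℝ))ᶜ) D f := by
  induction n with
  | zero =>
    intro N f O hN _ hem hcov
    rw [Finset.card_eq_zero] at hN
    subst hN
    obtain ⟨x⟩ := ‹Nonempty K›
    obtain ⟨a, ha⟩ := hcov x
    simp [hem a (by simp)] at ha
  | succ n ih =>
    intro N f O hN hO hem hcov hU hsame hopp hsat hfD
    have hNne : N.Nonempty := by rw [← Finset.card_pos]; omega
    obtain ⟨a, haN, hmax⟩ := N.exists_max_image (fun a => a.2.length) hNne
    have hmemN : ∀ b x, x ∈ O b → b ∈ N := by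
      intro b x hx
      by_contra h
      simp [hem b h] at hx
    have hnb : ∀ b x, x ∈ O a → x ∈ O b → b ≠ a → b.1 = !a.1 ∧ a.2 = J P (f x).1 :: b.2 := by
      intro b x hxa hxb hba
      have h1 : a.1 ≠ b.1 := fun h => hba (hsame a b x hxa hxb h).symm
      have h2 := hopp a b x hxa hxb h1
      have h3 := hmax b (hmemN b x hxb)
      simp only [h2] at h3
      have h4 := sw_len _ _ h3
      rw [← h2] at h4
      refine ⟨?_, h4⟩
      clear * - h1
      revert h1
      cases a.1 <;> cases b.1 <;> simp
    by_cases hex : ∃ b x, x ∈ O a ∧ x ∈ O b ∧ b ≠ a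
    · obtain ⟨b, x0, hx0a, hx0b, hba⟩ := hex
      set j0 := J P (f x0).1 with hj0
      set c := (f x0).1 with hc
      obtain ⟨hb1, hb2⟩ := hnb b x0 hx0a hx0b hba
      have hnb' : ∀ b' x, x ∈ O a → x ∈ O b' → b' ≠ a → b' = b ∧ J P (f x).1 = j0 := by
        intro b' x hxa hxb hb'
        obtain ⟨h1, h2⟩ := hnb b' x hxa hxb hb'
        rw [hb2] at h2
        obtain ⟨h3, h4⟩ := List.cons.inj h2
        exact ⟨Prod.ext (h1.trans hb1.symm) h4.symm, h3.symm⟩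
      have hcoff : ∀ p ∈ P, p.1 ≠ c := by
        refine off (hU a x0 hx0a) ?_
        rw [← hb1]; exact hU b x0 hx0b
      set C : Set K := (⋃ b' ∈ {b' | b' ≠ a}, O b')ᶜ with hC
      have hCc : IsClosed C := by
        rw [hC, isClosed_compl_iff]
        exact isOpen_biUnion fun b' _ => hO b'
      have hCa : C ⊆ O a := by
        intro x hx
        obtain ⟨a', ha'⟩ := hcov x
        by_cases h : a' = a
        · rwa [← h]
        · exact absurd (Set.mem_biUnion (show a' ∈ {b' | b' ≠ a} from h) ha') hx
      obtain ⟨χ, hχ0, hχ1, hχ, hχD⟩ : ∃ χ : C(K, ℝ), (∀ x, x ∉ O a → χ x = 0) ∧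
          (∀ x ∈ C, χ x = 1) ∧ (∀ x, χ x ∈ Set.Icc (0:ℝ) 1) ∧
          (∀ x ∈ D, ∀ y ∈ D, χ x = χ y) := by
        by_cases hDa : ∃ x ∈ D, x ∈ O a
        · obtain ⟨x1, hx1, hx1a⟩ := hDa
          have hDO : D ⊆ O a := fun y hy => hsat a x1 hx1 y hy hx1a
          obtain ⟨χ, h0, h1, h2⟩ := exists_continuous_zero_one_of_isClosed
            (s := (O a)ᶜ) (t := C ∪ D) (hO a).isClosed_compl (hCc.union hDc)
            (by rw [Set.disjoint_compl_left_iff_subset]; exact Set.union_subset hCa hDO)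
          refine ⟨χ, fun x hx => h0 hx, fun x hx => h1 (Or.inl hx), h2, fun x hx y hy => ?_⟩
          rw [h1 (Or.inr hx), h1 (Or.inr hy)]; rfl
        · push Not at hDa
          obtain ⟨χ, h0, h1, h2⟩ := exists_continuous_zero_one_of_isClosed
            (s := (O a)ᶜ) (t := C) (hO a).isClosed_compl hCc
            (by rw [Set.disjoint_compl_left_iff_subset]; exact hCa)
          refine ⟨χ, fun x hx => h0 hx, fun x hx => h1 hx, h2, fun x hx y hy => ?_⟩
          rw [h0 (hDa x hx), h0 (hDa y hy)]; rfl
      set M : ℝ := ∑ p ∈ P, |p.2| with hMdef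
      have hM : ∀ p ∈ P, |p.2| ≤ M := fun p hp =>
        Finset.single_le_sum (f := fun p : ℝ × ℝ => |p.2|) (fun _ _ => abs_nonneg _) hp
      have hM0 : 0 ≤ M := Finset.sum_nonneg fun _ _ => abs_nonneg _
      have hHc := Hm_cont a.1 M c
      let f1 : C(K, ℝ × ℝ) := ⟨fun x => Hm a.1 M c (χ x) (f x), by
        exact hHc.comp (χ.continuous.prodMk f.continuous)⟩
      have hf1 : ∀ x, f1 x = Hm a.1 M c (χ x) (f x) := fun _ => rfl
      have hf1D : ∀ x ∈ D, ∀ y ∈ D, f1 x = f1 y := by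
        intro x hx y hy
        rw [hf1, hf1, hχD x hx y hy, hfD x hx y hy]
      have hf1n : ∀ x, x ∉ O a → f1 x = f x := by
        intro x hx
        rw [hf1, hχ0 x hx, Hm_zero]
      have hstrip : ∀ x ∈ O a, (∀ p ∈ P, p.1 ≠ (f1 x).1) ∧ J P (f1 x).1 = j0 := by
        intro x hx
        by_cases hxC : x ∈ C
        · have : (f1 x).1 = c := by rw [hf1, hχ1 x hxC, Hm_one]
          rw [this]
          exact ⟨hcoff, rfl⟩
        · have : ∃ b', b' ≠ a ∧ x ∈ O b' := by
            rw [hC, Set.mem_compl_iff, not_not] at hxC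
            obtain ⟨b', hb', hxb'⟩ := Set.mem_iUnion₂.1 hxC
            exact ⟨b', hb', hxb'⟩
          obtain ⟨b', hb'a, hb'⟩ := this
          obtain ⟨h1, h2⟩ := hnb' b' x hx hb' hb'a
          have h3 : ∀ p ∈ P, p.1 ≠ (f x).1 := by
            refine off (hU a x hx) ?_
            rw [← hb1, ← h1]; exact hU b' x hb'
          exact J_seg h3 hcoff h2 (s2_mem (hχ x).2).1 (s2_mem (hχ x).2).2
      suffices h : NullH ((P : Set (ℝ × ℝ))ᶜ) D f1 by
        obtain ⟨q, hq⟩ := h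
        refine ⟨q, ContinuousMap.HomotopicWith.trans (g := f1) ?_ hq⟩
        refine mkHD (fun q => Hm a.1 M c (q.1 * χ q.2) (f q.2)) ?_ ?_ ?_ ?_ ?_
        · exact hHc.comp (by fun_prop : Continuous fun q : ℝ × K => (q.1 * χ q.2, f q.2))
        · intro x; simp [Hm_zero]
        · intro x; simp [hf1]
        · intro t h0 h1 x
          by_cases hx : x ∈ O a
          · refine Ue_compl (Hm_Ue hM hM0 (mul_nonneg h0 (hχ x).1) (hU a x hx))
          · simp only [hχ0 x hx, mul_zero, Hm_zero]
            obtain ⟨a', ha'⟩ := hcov x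
            exact Ue_compl (hU a' x ha')
        · intro t h0 h1 x hx y hy
          simp only [hχD x hx y hy, hfD x hx y hy]
      let O' : Bool × List (Finset (ℝ × ℝ)) → Set K := fun a' =>
        if a' = a then ∅ else if a' = b then O b ∪ O a else O a'
      have hO'a : O' a = ∅ := by simp [O']
      have hO'b : O' b = O b ∪ O a := by simp [O', hba]
      have hO'n : ∀ a', a' ≠ a → a' ≠ b → O' a' = O a' := by
        intro a' h1 h2; simp [O', h1, h2]
      have hO'mem : ∀ a' x, x ∈ O' a' → a' ≠ a ∧ ((x ∈ O a ∧ a' = b) ∨ (x ∉ O a ∧ x ∈ O a')) := by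
        intro a' x hx
        have h1 : a' ≠ a := by rintro rfl; simp [hO'a] at hx
        refine ⟨h1, ?_⟩
        by_cases hxa : x ∈ O a
        · left
          refine ⟨hxa, ?_⟩
          by_contra h2
          rw [hO'n a' h1 h2] at hx
          exact h2 (hnb' a' x hxa hx h1).1
        · right
          refine ⟨hxa, ?_⟩
          by_cases h2 : a' = b
          · subst h2
            rw [hO'b] at hx
            exact hx.resolve_right hxa
          · rwa [hO'n a' h1 h2] at hx
      refine ih (N.erase a) f1 O' ?_ ?_ ?_ ?_ ?_ ?_ ?_ ?_ hf1D
      · rw [Finset.card_erase_of_mem haN, hN]; rfl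
      · intro a'
        simp only [O']
        split_ifs
        · exact isOpen_empty
        · exact (hO b).union (hO a)
        · exact hO a'
      · intro a' ha'
        by_cases h1 : a' = a
        · rw [h1, hO'a]
        · have h2 : a' ∉ N := fun h => ha' (Finset.mem_erase.2 ⟨h1, h⟩)
          have h3 : a' ≠ b := by rintro rfl; exact h2 (hmemN _ _ hx0b)
          rw [hO'n a' h1 h3, hem a' h2]
      · intro x
        obtain ⟨a', ha'⟩ := hcov x
        by_cases h1 : a' = a
        · exact ⟨b, by rw [hO'b]; right; rwa [← h1]⟩
        · by_cases h2 : a' = b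
          · exact ⟨b, by rw [hO'b]; left; rwa [← h2]⟩
          · exact ⟨a', by rwa [hO'n a' h1 h2]⟩
      · intro a' x hx
        obtain ⟨_, ⟨hxa, _⟩ | ⟨hxa, hxa'⟩⟩ := hO'mem a' x hx
        · exact off_mem (hstrip x hxa).1
        · rw [hf1n x hxa]; exact hU a' x hxa'
      · intro a1 a2 x h1 h2 h12
        obtain ⟨_, ⟨hxa, e1⟩ | ⟨hxa, hxa'⟩⟩ := hO'mem a1 x h1 <;>
        obtain ⟨_, ⟨hxb, e2⟩ | ⟨hxb, hxb'⟩⟩ := hO'mem a2 x h2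
        · rw [e1, e2]
        · exact absurd hxa hxb
        · exact absurd hxb hxa
        · exact hsame a1 a2 x hxa' hxb' h12
      · intro a1 a2 x h1 h2 h12
        obtain ⟨_, ⟨hxa, e1⟩ | ⟨hxa, hxa'⟩⟩ := hO'mem a1 x h1 <;>
        obtain ⟨_, ⟨hxb, e2⟩ | ⟨hxb, hxb'⟩⟩ := hO'mem a2 x h2
        · exact absurd (by rw [e1, e2]) h12
        · exact absurd hxa hxb
        · exact absurd hxb hxa
        · rw [hf1n x hxa]; exact hopp a1 a2 x hxa' hxb' h12
      · intro a' x hx y hy hxa'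
        simp only [O'] at hxa' ⊢
        split_ifs at hxa' ⊢
        · exact hxa'
        · exact hxa'.imp (hsat b x hx y hy) (hsat a x hx y hy)
        · exact hsat a' x hx y hy hxa'
    · push Not at hex
      have hclopen : IsClopen (O a) := by
        refine ⟨?_, hO a⟩
        have : O a = (⋃ b' ∈ {b' | b' ≠ a}, O b')ᶜ := by
          ext x
          constructor
          · intro hx hx'
            obtain ⟨b', hb', hxb'⟩ := Set.mem_iUnion₂.1 hx'
            exact hb' (hex b' x hx hxb')
          · intro hx
            obtain ⟨a', ha'⟩ := hcov x
            by_cases h : a' = a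
            · rwa [← h]
            · exact absurd (Set.mem_biUnion (show a' ∈ {b' | b' ≠ a} from h) ha') hx
        rw [this, isClosed_compl_iff]
        exact isOpen_biUnion fun b' _ => hO b'
      rcases isClopen_iff.1 hclopen with h | h
      · refine ih (N.erase a) f O ?_ hO ?_ hcov hU hsame hopp hsat hfD
        · rw [Finset.card_erase_of_mem haN, hN]; rfl
        · intro a' ha'
          by_cases h1 : a' = a
          · rw [h1, h]
          · exact hem a' (fun h => ha' (Finset.mem_erase.2 ⟨h1, h⟩))
      · exact null_of_Ue f (fun x => hU a x (by simp [h])) hfD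

end TwoArr

open scoped unitInterval Topology
namespace TwoArr

def W : Type := {l : List (Finset (ℝ × ℝ)) // l.IsChain (· ≠ ·)}

instance : TopologicalSpace W := ⊥
instance : DiscreteTopology W := ⟨rfl⟩

open Classical in
noncomputable def sW (a : Finset (ℝ × ℝ)) (w : W) : W := ⟨sw a w.1, sw_chain a w.1 w.2⟩

lemma sW_sW (a : Finset (ℝ × ℝ)) (w : W) : sW a (sW a w) = w := Subtype.ext (sw_sw a w.1 w.2)

lemma isOpen_Ue (P : Finset (ℝ × ℝ)) (e : Bool) : IsOpen (Ue P e) := by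
  have : Ue P e = ⋂ p ∈ P, ({z | p.1 ≠ z.1} ∪ {z | 0 < sg e * (z.2 - p.2)}) := by
    ext z
    simp only [Ue, Set.mem_ofPred_eq, Set.mem_iInter, Set.mem_union]
    refine forall₂_congr fun p hp => ?_
    rw [imp_iff_not_or]
  rw [this]
  refine isOpen_biInter_finset fun p _ => IsOpen.union ?_ ?_
  · exact isOpen_ne_fun continuous_const continuous_fst
  · exact isOpen_lt (by fun_prop) (by fun_prop)

lemma J_loc {P : Finset (ℝ × ℝ)} {x : ℝ} (hx : ∀ p ∈ P, p.1 ≠ x) :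
    ∀ᶠ x' in 𝓝 x, J P x' = J P x := by
  have : ∀ᶠ x' in 𝓝 x, ∀ p ∈ P, (p.1 < x' ↔ p.1 < x) := by
    rw [Filter.eventually_all_finset]
    intro p hp
    rcases lt_or_gt_of_ne (hx p hp) with h | h
    · filter_upwards [eventually_gt_nhds h] with y hy
      exact iff_of_true hy h
    · filter_upwards [eventually_lt_nhds h] with y hy
      exact iff_of_false (not_lt.2 (le_of_lt hy)) (not_lt.2 (le_of_lt h))
  filter_upwards [this] with y hy
  exact Finset.filter_congr hy

lemma Ue_cover {P : Finset (ℝ × ℝ)} (hP : Set.InjOn Prod.fst (P : Set (ℝ × ℝ))) {z : ℝ × ℝ}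
    (hz : z ∉ P) : ∃ e, z ∈ Ue P e := by
  by_contra! h
  have h1 := h true
  have h2 := h false
  simp only [Ue, Set.mem_ofPred_eq, not_forall, sg] at h1 h2
  obtain ⟨p, hp, hpz, h1⟩ := h1
  obtain ⟨q, hq, hqz, h2⟩ := h2
  have : p = q := hP hp hq (hpz.trans hqz.symm)
  subst this
  simp at h1 h2
  exact hz (by convert hp using 1; exact Prod.ext hpz.symm (le_antisymm h1 h2))

noncomputable def core (P : Finset (ℝ × ℝ)) (hP : Set.InjOn Prod.fst (P : Set (ℝ × ℝ))) :
    FiberBundleCore Bool (((P : Set (ℝ × ℝ))ᶜ : Set (ℝ × ℝ))) W where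
  baseSet e := {z | z.1 ∈ Ue P e}
  isOpen_baseSet e := (isOpen_Ue P e).preimage continuous_subtype_val
  indexAt z := (Ue_cover hP z.2).choose
  mem_baseSet_at z := (Ue_cover hP z.2).choose_spec
  coordChange i j z v := if i = j then v else sW (J P z.1.1) v
  coordChange_self i z _ v := by simp
  continuousOn_coordChange i j := by
    by_cases h : i = j
    · simp only [h, if_true]; fun_prop
    · simp only [h, if_false]
      rintro ⟨z, v⟩ ⟨⟨h1, h2⟩, -⟩
      apply ContinuousAt.continuousWithinAt
      have hj : j = !i := by cases i <;> cases j <;> simp_all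
      subst hj
      have hoff := off h1 h2
      have h3 : ∀ᶠ q : ((P : Set (ℝ × ℝ))ᶜ : Set (ℝ × ℝ)) × W in 𝓝 (z, v),
          J P q.1.1.1 = J P z.1.1 := by
        have hc : Continuous fun q : ((P : Set (ℝ × ℝ))ᶜ : Set (ℝ × ℝ)) × W => q.1.1.1 := by
          fun_prop
        exact (hc.tendsto (z, v)).eventually (J_loc hoff)
      have h4 : Continuous fun q : ((P : Set (ℝ × ℝ))ᶜ : Set (ℝ × ℝ)) × W =>
          sW (J P z.1.1) q.2 := 
        (continuous_of_discreteTopology (f := sW (J P z.1.1))).comp continuous_snd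
      refine h4.continuousAt.congr ?_
      filter_upwards [h3] with q hq
      rw [hq]
  coordChange_comp i j k z _ v := by
    cases i <;> cases j <;> cases k <;> simp [sW_sW]

lemma boundary_preconn (k : ℕ) (hk : 2 ≤ k) : IsPreconnected (Cube.boundary (Fin k)) := by
  have hface : ∀ (i : Fin k) (c : I), IsPreconnected {y : Fin k → I | y i = c} := by
    intro i c
    have : {y : Fin k → I | y i = c} = Set.range (fun y : Fin k → I => Function.update y i c) := by
      ext y
      constructor
      · intro h
        refine ⟨y, ?_⟩
        simp only [Set.mem_ofPred_eq] at h
        simp [← h]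
      · rintro ⟨y', rfl⟩
        simp
    rw [this]
    exact isPreconnected_range (continuous_id.update i continuous_const)
  let a : Fin k := ⟨0, by omega⟩
  let b : Fin k := ⟨1, by omega⟩
  have hab : a ≠ b := by simp [a, b, Fin.ext_iff]
  -- each face meets base faces
  refine isPreconnected_of_forall_pair ?_
  have hsub : ∀ (i : Fin k) (c : I), (c = 0 ∨ c = 1) →
      {y : Fin k → I | y i = c} ⊆ Cube.boundary (Fin k) := by
    intro i c hc y hy
    simp only [Set.mem_ofPred_eq] at hy
    exact ⟨i, by rw [hy]; exact hc⟩
  have key : ∀ (i j : Fin k) (c d : I), i ≠ j → (c = 0 ∨ c = 1) → (d = 0 ∨ d = 1) →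
      ∃ t ⊆ Cube.boundary (Fin k), {y : Fin k → I | y i = c} ⊆ t ∧ {y : Fin k → I | y j = d} ⊆ t ∧
        IsPreconnected t := by
    intro i j c d hij hc hd
    refine ⟨{y : Fin k → I | y i = c} ∪ {y : Fin k → I | y j = d},
      Set.union_subset (hsub i c hc) (hsub j d hd), Set.subset_union_left,
      Set.subset_union_right, ?_⟩
    refine IsPreconnected.union (Function.update (fun _ => d) i c) ?_ ?_ (hface i c) (hface j d)
    · simp
    · simp [Function.update_of_ne hij.symm]
  rintro x ⟨i, hi⟩ y ⟨j, hj⟩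
  by_cases hij : i = j
  · subst hij
    obtain ⟨l, hl⟩ : ∃ l, i ≠ l := by
      by_cases h : i = a
      · exact ⟨b, h ▸ hab⟩
      · exact ⟨a, h⟩
    obtain ⟨t1, ht1, h1, h2, h3⟩ := key i l (x i) 0 hl hi (Or.inl rfl)
    obtain ⟨t2, ht2, h4, h5, h6⟩ := key i l (y i) 0 hl hj (Or.inl rfl)
    refine ⟨t1 ∪ t2, Set.union_subset ht1 ht2, Or.inl (h1 rfl), Or.inr (h4 rfl), ?_⟩
    exact IsPreconnected.union (fun _ => 0) (h2 rfl) (h5 rfl) h3 h6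
  · obtain ⟨t, ht, h1, h2, h3⟩ := key i j (x i) (y j) hij hi hj
    exact ⟨t, ht, h1 rfl, h2 rfl, h3⟩

lemma isClosed_boundary (k : ℕ) : IsClosed (Cube.boundary (Fin k)) := by
  have : Cube.boundary (Fin k) = ⋃ i : Fin k, ({y | y i = 0} ∪ {y | y i = 1}) := by
    ext y; simp [Cube.boundary]
  rw [this]
  refine isClosed_iUnion_of_finite fun i => IsClosed.union ?_ ?_
  · exact isClosed_eq (continuous_apply i) continuous_const
  · exact isClosed_eq (continuous_apply i) continuous_const

theorem plane_inj (k : ℕ) (hk : 2 ≤ k) (P : Finset (ℝ × ℝ))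
    (hP : Set.InjOn Prod.fst (P : Set (ℝ × ℝ))) (f : C(Fin k → I, ℝ × ℝ))
    (hf : ∀ x, f x ∉ P) (hD : ∀ x ∈ Cube.boundary (Fin k), ∀ y ∈ Cube.boundary (Fin k), f x = f y) :
    NullH ((P : Set (ℝ × ℝ))ᶜ) (Cube.boundary (Fin k)) f := by
  classical
  let Z := core P hP
  let X := (((P : Set (ℝ × ℝ))ᶜ : Set (ℝ × ℝ)))
  have cov : IsCoveringMap (Bundle.TotalSpace.proj : Bundle.TotalSpace W Z.Fiber → X) :=
    FiberBundle.isCoveringMap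
  let f' : C(Fin k → I, X) := ⟨fun x => ⟨f x, hf x⟩, by fun_prop⟩
  let H : C(I × (Fin k → I), X) := ⟨fun q => f' (fun i => q.1 * q.2 i), by fun_prop⟩
  let e0 : Bundle.TotalSpace W Z.Fiber := ⟨f' (fun _ => 0), (⟨[], by simp⟩ : W)⟩
  have H0 : ∀ a, H (0, a) = Bundle.TotalSpace.proj ((ContinuousMap.const (Fin k → I) e0) a) := by
    intro a
    simp [H, e0]
  let L := cov.liftHomotopy H (ContinuousMap.const (Fin k → I) e0) H0
  have hL := cov.liftHomotopy_lifts H (ContinuousMap.const (Fin k → I) e0) H0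
  let g : C(Fin k → I, Bundle.TotalSpace W Z.Fiber) := L.comp ⟨fun x => (1, x), by fun_prop⟩
  have hg : ∀ x, (g x).proj = f' x := by
    intro x
    have h1 : (g x).proj = H (1, x) := congrFun hL (1, x)
    rw [h1]
    simp [H]
  have hgD : ∀ x ∈ Cube.boundary (Fin k), ∀ y ∈ Cube.boundary (Fin k), g x = g y := by
    intro x hx y hy
    refine cov.constOn_of_comp (boundary_preconn k hk) g.continuous.continuousOn ?_ hx hy
    intro a ha a' ha'
    rw [hg, hg]
    exact Subtype.ext (hD a ha a' ha')
  let crd : Bool → (Fin k → I) → W := fun e x => (Z.localTriv e (g x)).2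
  let O : Bool × List (Finset (ℝ × ℝ)) → Set (Fin k → I) := fun a =>
    {x | f x ∈ Ue P a.1 ∧ (crd a.1 x).1 = a.2}
  have hOo : ∀ a, IsOpen (O a) := by
    intro a
    have hopen : IsOpen {x | f x ∈ Ue P a.1} := (isOpen_Ue P a.1).preimage f.continuous
    have hc : ContinuousOn (crd a.1) {x | f x ∈ Ue P a.1} := by
      have h1 := (Z.localTriv a.1).continuousOn_toFun
      refine continuous_snd.comp_continuousOn (h1.comp g.continuous.continuousOn ?_)
      intro x hx
      change g x ∈ (Z.localTriv a.1).source
      rw [Z.mem_localTriv_source]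
      change (g x).proj ∈ Z.baseSet a.1
      rw [hg]
      exact hx
    exact hc.isOpen_inter_preimage hopen (isOpen_discrete {w : W | w.1 = a.2})
  have hOcov : ∀ x, ∃ a, x ∈ O a := by
    intro x
    obtain ⟨e, he⟩ := Ue_cover hP (hf x)
    exact ⟨(e, (crd e x).1), he, rfl⟩
  have hcc : ∀ e e' x, f x ∈ Ue P e → f x ∈ Ue P e' → e ≠ e' →
      crd e' x = sW (J P (f x).1) (crd e x) := by
    intro e e' x he he' hne
    have h1 := Z.coordChange_comp (Z.indexAt (g x).proj) e e' (g x).proj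
      ⟨⟨Z.mem_baseSet_at _, by rw [hg]; exact he⟩, by rw [hg]; exact he'⟩ (g x).2
    have h2 : Z.coordChange e e' (g x).proj (crd e x) = crd e' x := h1
    rw [← h2]
    change (if e = e' then _ else _) = _
    rw [if_neg hne, hg]
    rfl
  obtain ⟨N, hN⟩ := isCompact_univ.elim_finite_subcover O hOo
    (fun x _ => Set.mem_iUnion.2 (hOcov x))
  refine leaf (isClosed_boundary k) P N.card N f (fun a => if a ∈ N then O a else ∅) rfl
    ?_ ?_ ?_ ?_ ?_ ?_ ?_ hD
  · intro a
    split_ifs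
    · exact hOo a
    · exact isOpen_empty
  · intro a ha
    simp [ha]
  · intro x
    obtain ⟨a, ha, hx⟩ := Set.mem_iUnion₂.1 (hN (Set.mem_univ x))
    exact ⟨a, by simpa [ha] using hx⟩
  all_goals
    have hmem : ∀ a x, x ∈ (if a ∈ N then O a else ∅) → x ∈ O a := by
      intro a x hx
      split_ifs at hx
      · exact hx
      · exact absurd hx (Set.notMem_empty x)
  · intro a x hx
    exact (hmem a x hx).1
  · intro a b x ha hb hab
    have h1 := (hmem a x ha).2
    have h2 := (hmem b x hb).2
    rw [← hab] at h2
    exact Prod.ext hab (h1.symm.trans h2)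
  · intro a b x ha hb hab
    have h1 := hmem a x ha
    have h2 := hmem b x hb
    have h3 := hcc a.1 b.1 x h1.1 h2.1 hab
    rw [← h2.2, ← h1.2, h3]
    simp only [sW]
  · intro a x hx y hy hxa
    split_ifs at hxa ⊢
    · refine ⟨hD x hx y hy ▸ hxa.1, ?_⟩
      have : crd a.1 y = crd a.1 x := by simp only [crd, hgD x hx y hy]
      rw [this]; exact hxa.2
    · exact hxa

theorem plane (k : ℕ) (hk : 2 ≤ k) (P : Finset (ℝ × ℝ)) (f : C(Fin k → I, ℝ × ℝ))
    (hf : ∀ x, f x ∉ P) (hD : ∀ x ∈ Cube.boundary (Fin k), ∀ y ∈ Cube.boundary (Fin k), f x = f y) :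
    NullH ((P : Set (ℝ × ℝ))ᶜ) (Cube.boundary (Fin k)) f := by
  classical
  obtain ⟨t, ht⟩ := Infinite.exists_notMem_finset
    ((P ×ˢ P).image (fun q : (ℝ × ℝ) × (ℝ × ℝ) => -(q.1.1 - q.2.1) / (q.1.2 - q.2.2)))
  let φ : C(ℝ × ℝ, ℝ × ℝ) := ⟨fun z => (z.1 + t * z.2, z.2), by fun_prop⟩
  let ψ : C(ℝ × ℝ, ℝ × ℝ) := ⟨fun z => (z.1 - t * z.2, z.2), by fun_prop⟩
  have hψφ : ∀ z, ψ (φ z) = z := by intro z; simp [φ, ψ]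
  have hφψ : ∀ z, φ (ψ z) = z := by intro z; simp [φ, ψ]
  have hinj : Set.InjOn Prod.fst ((P.image φ : Finset (ℝ × ℝ)) : Set (ℝ × ℝ)) := by
    intro a ha b hb hab
    obtain ⟨p, hp, rfl⟩ := Finset.mem_image.1 (Finset.mem_coe.1 ha)
    obtain ⟨q, hq, rfl⟩ := Finset.mem_image.1 (Finset.mem_coe.1 hb)
    have hab' : p.1 + t * p.2 = q.1 + t * q.2 := hab
    have : p = q := by
      by_cases h : p.2 = q.2
      · rw [h] at hab'
        exact Prod.ext (by linarith) h
      · exfalso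
        apply ht
        refine Finset.mem_image.2 ⟨(p, q), Finset.mem_product.2 ⟨hp, hq⟩, ?_⟩
        have : p.2 - q.2 ≠ 0 := sub_ne_zero.2 h
        simp only
        rw [div_eq_iff this]
        linarith
    rw [this]
  obtain ⟨c, hc⟩ := plane_inj k hk (P.image φ) hinj (φ.comp f) (by
    intro x hx
    obtain ⟨p, hp, hpx⟩ := Finset.mem_image.1 hx
    have : p = f x := by
      have := congrArg ψ hpx
      rwa [hψφ, ContinuousMap.comp_apply, hψφ] at this
    exact hf x (this ▸ hp)) (by
    intro x hx y hy
    simp only [ContinuousMap.comp_apply, hD x hx y hy])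
  refine ⟨ψ c, ?_⟩
  have := map_HD (S' := (P : Set (ℝ × ℝ))ᶜ) ψ (by
    intro v hv hv'
    apply hv
    refine Finset.mem_coe.2 (Finset.mem_image.2 ⟨ψ v, hv', hφψ v⟩)) hc
  have h1 : ψ.comp (φ.comp f) = f := by
    ext x : 1
    exact hψφ (f x)
  rw [h1] at this
  exact this

end TwoArr

open scoped unitInterval Topology
namespace TwoArr

theorem based {X : Type*} [TopologicalSpace X] {x0 : X} (k : ℕ) (hk : 2 ≤ k)
    (f : GenLoop (Fin k) X x0) (c : X)
    (h : ContinuousMap.HomotopicWith f.1 (ContinuousMap.const _ c)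
      (PP Set.univ (Cube.boundary (Fin k)))) : GenLoop.Homotopic f GenLoop.const := by
  obtain ⟨F⟩ := h
  have F0 : ∀ x, F (0, x) = f x := fun x => F.apply_zero x
  have F1 : ∀ x, F (1, x) = c := fun x => F.apply_one x
  have FD : ∀ t, ∀ x ∈ Cube.boundary (Fin k), ∀ y ∈ Cube.boundary (Fin k), F (t, x) = F (t, y) :=
    fun t x hx y hy => (F.prop t).2 x hx y hy
  let y0 : Fin k → I := fun _ => 0
  have hy0 : y0 ∈ Cube.boundary (Fin k) := ⟨⟨0, by omega⟩, Or.inl rfl⟩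
  let pr : ℝ → I := Set.projIcc 0 1 zero_le_one
  have prc : Continuous pr := continuous_projIcc
  have pr0 : ∀ t, t ≤ 0 → pr t = 0 := fun t ht => Set.projIcc_of_le_left _ ht
  have pr1 : ∀ t, 1 ≤ t → pr t = 1 := fun t ht => Set.projIcc_of_right_le _ ht
  have prI : ∀ t : I, pr (t : ℝ) = t := fun t => Set.projIcc_val _ t
  let τ : (Fin k → I) → ℝ := fun x => 4 * Metric.infDist x (Cube.boundary (Fin k))
  have τc : Continuous τ := (Metric.continuous_infDist_pt _).const_smul (4 : ℝ)
  have τ0 : ∀ x ∈ Cube.boundary (Fin k), τ x = 0 := fun x hx => by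
    simp [τ, Metric.infDist_zero_of_mem hx]
  let cl : ℝ → (Fin k → I) → (Fin k → I) := fun s x i =>
    pr ((1 - s) * (x i : ℝ) + s * (2 * (x i : ℝ) - 1 / 2))
  have clc : Continuous fun q : ℝ × (Fin k → I) => cl q.1 q.2 := by
    refine continuous_pi fun i => prc.comp (by fun_prop)
  have clD : ∀ s, 0 ≤ s → s ≤ 1 → ∀ x ∈ Cube.boundary (Fin k),
      cl s x ∈ Cube.boundary (Fin k) := by
    rintro s h0 h1 x ⟨i, hi⟩
    refine ⟨i, hi.imp (fun h => ?_) (fun h => ?_)⟩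
    · apply pr0; rw [h]; simp; linarith
    · apply pr1; rw [h]; simp; linarith
  have cl0 : ∀ x, cl 0 x = x := by
    intro x; ext i; simp [cl, prI]
  have cl1 : ∀ x, τ x < 1 → cl 1 x ∈ Cube.boundary (Fin k) := by
    intro x hx
    have h2 : Metric.infDist x (Cube.boundary (Fin k)) < 1 / 4 := by
      simp only [τ] at hx; linarith
    obtain ⟨y, ⟨i, hi⟩, hxy⟩ := (Metric.infDist_lt_iff ⟨y0, hy0⟩).1 h2
    have h3 : dist (x i) (y i) < 1 / 4 := lt_of_le_of_lt (dist_le_pi_dist x y i) hxy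
    rw [Subtype.dist_eq, Real.dist_eq, abs_lt] at h3
    refine ⟨i, hi.imp (fun h => ?_) (fun h => ?_)⟩
    · rw [h] at h3; apply pr0; simp at h3 ⊢; linarith
    · rw [h] at h3; apply pr1; simp at h3 ⊢; linarith
  have g0 : ∀ x ∈ Cube.boundary (Fin k), f x = x0 := f.2
  let g : C(Fin k → I, X) := ⟨fun x => F (pr (τ x), y0), by fun_prop⟩
  have hA : ContinuousMap.HomotopicRel f.1 g (Cube.boundary (Fin k)) := by
    refine ⟨{ toFun := fun q => F (pr ((q.1 : ℝ) * τ q.2), cl q.1 q.2),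
              continuous_toFun := ?_, map_zero_left := ?_, map_one_left := ?_, prop' := ?_ }⟩
    · have : Continuous fun q : I × (Fin k → I) => cl q.1 q.2 :=
        clc.comp (by fun_prop : Continuous fun q : I × (Fin k → I) => ((q.1 : ℝ), q.2))
      fun_prop
    · intro x
      simp [cl0, pr0, F0]
    · intro x
      simp only [Set.Icc.coe_one, one_mul, g, ContinuousMap.coe_mk]
      by_cases h : τ x < 1
      · exact FD _ _ (cl1 x h) _ hy0
      · rw [pr1 _ (not_lt.1 h), F1, F1]
    · intro t x hx
      simp only [ContinuousMap.coe_mk, τ0 x hx, mul_zero, pr0 0 le_rfl, F0]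
      rw [g0 _ (clD t t.2.1 t.2.2 x hx)]
      exact (g0 x hx).symm
  have hB : ContinuousMap.HomotopicRel g (ContinuousMap.const _ x0) (Cube.boundary (Fin k)) := by
    refine ⟨{ toFun := fun q => F (pr ((1 - (q.1 : ℝ)) * τ q.2), y0),
              continuous_toFun := by fun_prop, map_zero_left := ?_, map_one_left := ?_,
              prop' := ?_ }⟩
    · intro x; simp [g]
    · intro x; simp [pr0, F0, g0 _ hy0]
    · intro t x hx
      simp [g, τ0 x hx]
  exact hA.trans hB

lemma push_lemma {E ι : Type*} [NormedAddCommGroup E] [NormedSpace ℝ E] [Fintype ι]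
    (b b' : ι → E) (w : E) (ε : ℝ) (hε : 0 < ε) (hsep : ∀ i j, i ≠ j → ε ≤ ‖b i - b j‖)
    (hcl : ∀ i, ‖b' i - b i‖ ≤ ε / 10) (hw : ∀ i, w ≠ b i) (i : ι) :
    w + ∑ j, (max 0 (1 - 3 * ‖w - b j‖ / ε)) • (b' j - b j) ≠ b' i := by
  have hz : ∀ j, ε / 3 ≤ ‖w - b j‖ → max 0 (1 - 3 * ‖w - b j‖ / ε) = 0 := by
    intro j hj
    apply max_eq_left
    rw [sub_nonpos, le_div_iff₀ hε]; linarith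
  by_cases h : ∃ i0, ‖w - b i0‖ < ε / 3
  · obtain ⟨i0, hi0⟩ := h
    have hoth : ∀ j, j ≠ i0 → 2 * ε / 3 ≤ ‖w - b j‖ := by
      intro j hj
      have h1 := hsep j i0 hj
      have h2 : ‖b j - b i0‖ ≤ ‖w - b i0‖ + ‖w - b j‖ := by
        have : b j - b i0 = (w - b i0) - (w - b j) := by abel
        rw [this]; exact norm_sub_le _ _
      linarith
    rw [Finset.sum_eq_single i0 (fun j _ hj => by
      rw [hz j (by linarith [hoth j hj]), zero_smul]) (by simp)]
    set r := ‖w - b i0‖ with hr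
    have hr0 : 0 < r := norm_pos_iff.2 (sub_ne_zero.2 (hw i0))
    have hm : max 0 (1 - 3 * r / ε) = 1 - 3 * r / ε := by
      apply max_eq_right
      rw [sub_nonneg, div_le_iff₀ hε]; linarith
    rw [hm]
    intro heq
    by_cases hi : i = i0
    · subst hi
      have h1 : w - b i = (3 * r / ε) • (b' i - b i) := by
        have : (1 - 3 * r / ε) • (b' i - b i) = (b' i - b i) - (3 * r / ε) • (b' i - b i) := by
          rw [sub_smul, one_smul]
        rw [this] at heq
        have h3 : w - b i - (3 * r / ε) • (b' i - b i) = 0 := by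
          have := sub_eq_zero.2 heq
          rw [← this]; abel
        exact sub_eq_zero.1 h3
      have h2 : r = (3 * r / ε) * ‖b' i - b i‖ := by
        rw [hr]
        conv_lhs => rw [h1]
        rw [norm_smul, Real.norm_of_nonneg (by positivity)]
      have h3 : (3 * r / ε) * ‖b' i - b i‖ ≤ (3 * r / ε) * (ε / 10) :=
        mul_le_mul_of_nonneg_left (hcl i) (by positivity)
      have h4 : (3 * r / ε) * (ε / 10) = 3 / 10 * r := by field_simp
      linarith
    · have h1 : w - b i = (b' i - b i) - (1 - 3 * r / ε) • (b' i0 - b i0) := by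
        rw [← heq]; abel
      have h2 := hoth i hi
      have h3 : ‖(1 - 3 * r / ε) • (b' i0 - b i0)‖ ≤ ε / 10 := by
        rw [norm_smul]
        have : ‖1 - 3 * r / ε‖ ≤ 1 := by
          rw [Real.norm_of_nonneg (by rw [← hm]; exact le_max_left _ _)]
          have : 0 ≤ 3 * r / ε := by positivity
          linarith
        calc _ ≤ 1 * ‖b' i0 - b i0‖ := by gcongr
          _ ≤ _ := by linarith [hcl i0]
      have h4 : ‖w - b i‖ ≤ ε / 10 + ε / 10 := by
        rw [h1]; exact (norm_sub_le _ _).trans (add_le_add (hcl i) h3)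
      linarith
  · push Not at h
    rw [Finset.sum_eq_zero (fun j _ => by rw [hz j (h j), zero_smul]), add_zero]
    intro heq
    have h1 := hcl i
    have h2 := h i
    rw [← heq] at h1
    linarith

/-- push along a homotopy of the base. -/
theorem push {E ι K : Type*} [NormedAddCommGroup E] [NormedSpace ℝ E] [Fintype ι]
    [MetricSpace K] [CompactSpace K] {D : Set K} (A : ι → E → E) (hA : ∀ i, Continuous (A i))
    (hne : ∀ i j, i ≠ j → ∀ z, z ≠ 0 → A i z ≠ A j z)
    (z z' w : C(K, E))
    (hz : ContinuousMap.HomotopicWith z z' (PP ({0}ᶜ) D))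
    (hw : ∀ i x, w x ≠ A i (z x)) (hwD : ∀ x ∈ D, ∀ y ∈ D, w x = w y) :
    ∃ w' : C(K, E), (∀ i x, w' x ≠ A i (z' x)) ∧ (∀ x ∈ D, ∀ y ∈ D, w' x = w' y) ∧
      ContinuousMap.HomotopicWith (z.prodMk w) (z'.prodMk w')
        (PP {q : E × E | q.1 ≠ 0 ∧ ∀ i, q.2 ≠ A i q.1} D) := by
  obtain ⟨F⟩ := hz
  have F0 : ∀ x, F (0, x) = z x := fun x => F.apply_zero x
  have F1 : ∀ x, F (1, x) = z' x := fun x => F.apply_one x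
  have FD : ∀ t, ∀ x ∈ D, ∀ y ∈ D, F (t, x) = F (t, y) := fun t x hx y hy => (F.prop t).2 x hx y hy
  have Fn : ∀ q, F q ≠ 0 := fun q => (F.prop q.1).1 q.2
  have hbc : Continuous fun (q : I × K) (i : ι) => A i (F q) :=
    continuous_pi fun i => (hA i).comp F.continuous
  -- separation
  obtain ⟨ε, hε, hsep⟩ : ∃ ε > 0, ∀ q i j, i ≠ j → ε ≤ ‖A i (F q) - A j (F q)‖ := by
    have h1 : ∀ p : ι × ι, ∃ ε > 0, ∀ q, p.1 ≠ p.2 → ε ≤ ‖A p.1 (F q) - A p.2 (F q)‖ := by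
      intro p
      by_cases hp : p.1 = p.2
      · exact ⟨1, one_pos, fun q h => absurd hp h⟩
      · rcases isEmpty_or_nonempty (I × K) with he | hne'
        · exact ⟨1, one_pos, fun q => (he.false q).elim⟩
        · have hc : Continuous fun q => ‖A p.1 (F q) - A p.2 (F q)‖ :=
            (((hA p.1).comp F.continuous).sub ((hA p.2).comp F.continuous)).norm
          obtain ⟨q0, -, hq0⟩ := isCompact_univ.exists_isMinOn Set.univ_nonempty hc.continuousOn
          refine ⟨_, norm_pos_iff.2 (sub_ne_zero.2 (hne p.1 p.2 hp (F q0) (Fn q0))),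
            fun q _ => hq0 (Set.mem_univ q)⟩
    choose e he he' using h1
    rcases isEmpty_or_nonempty (ι × ι) with hem | hnem
    · exact ⟨1, one_pos, fun q i j => (hem.false (i, j)).elim⟩
    · refine ⟨Finset.univ.inf' Finset.univ_nonempty e, ?_, fun q i j hij => ?_⟩
      · exact (Finset.lt_inf'_iff _).2 fun p _ => he p
      · exact (Finset.inf'_le e (Finset.mem_univ (i, j))).trans (he' (i, j) q hij)
  have huc := CompactSpace.uniformContinuous_of_continuous hbc
  obtain ⟨δ, hδ, hcl⟩ := Metric.uniformContinuous_iff.1 huc (ε / 10) (by positivity)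
  have hcl' : ∀ (t t' : I) (x : K), |(t : ℝ) - t'| < δ → ∀ i,
      ‖A i (F (t, x)) - A i (F (t', x))‖ ≤ ε / 10 := by
    intro t t' x htt i
    have h1 : dist (t, x) (t', x) < δ := by
      simpa [Prod.dist_eq, Subtype.dist_eq, Real.dist_eq, hδ] using htt
    have h2 := (dist_le_pi_dist _ _ i).trans (hcl h1).le
    rwa [dist_eq_norm] at h2
  obtain ⟨N, hN⟩ := exists_nat_gt (1 / δ)
  have hNpos : (0 : ℝ) < N := lt_trans (by positivity) hN
  have hNδ : 1 / (N : ℝ) < δ := by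
    rw [div_lt_iff₀ hδ] at hN
    rw [div_lt_iff₀ hNpos]; linarith
  let pr : ℝ → I := Set.projIcc 0 1 zero_le_one
  have prc : Continuous pr := continuous_projIcc
  have pr0 : pr 0 = 0 := Set.projIcc_of_le_left _ le_rfl
  have pr1 : pr 1 = 1 := Set.projIcc_of_right_le _ le_rfl
  have prl : ∀ s t, |((pr s : I) : ℝ) - pr t| ≤ |s - t| := by
    intro s t
    exact Set.abs_projIcc_sub_projIcc zero_le_one
  have main : ∀ m : ℕ, ∃ w' : C(K, E), (∀ i x, w' x ≠ A i (F (pr (m / N), x))) ∧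
      (∀ x ∈ D, ∀ y ∈ D, w' x = w' y) ∧
      ContinuousMap.HomotopicWith (z.prodMk w)
        ((⟨fun x => F (pr (m / N), x), by fun_prop⟩ : C(K, E)).prodMk w')
        (PP {q : E × E | q.1 ≠ 0 ∧ ∀ i, q.2 ≠ A i q.1} D) := by
    intro m
    induction m with
    | zero =>
      refine ⟨w, ?_, hwD, ?_⟩
      · simpa [pr0, F0] using hw
      · have : (⟨fun x => F (pr ((0 : ℕ) / N), x), by fun_prop⟩ : C(K, E)) = z := by
          ext x; simp [pr0, F0]
        rw [this]
        refine ContinuousMap.HomotopicWith.refl _ ⟨fun x => ⟨?_, fun i => hw i x⟩, ?_⟩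
        · have := Fn (0, x); rwa [F0] at this
        · intro x hx y hy
          have := FD 0 x hx y hy
          rw [F0, F0] at this
          simp [this, hwD x hx y hy]
    | succ m ih =>
      obtain ⟨w1, h1, h1D, h1h⟩ := ih
      let G : ℝ × K → E := fun q => w1 q.2 + ∑ j, (max 0 (1 - 3 * ‖w1 q.2 -
        A j (F (pr (m / N), q.2))‖ / ε)) • (A j (F (pr ((m + q.1) / N), q.2))
          - A j (F (pr (m / N), q.2)))
      have hG : Continuous G := by
        have hA1 : ∀ j, Continuous fun q : ℝ × K => A j (F (pr (m / N), q.2)) := fun j =>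
          (hA j).comp (by fun_prop)
        have hA2 : ∀ j, Continuous fun q : ℝ × K => A j (F (pr ((m + q.1) / N), q.2)) := fun j =>
          (hA j).comp (by fun_prop)
        fun_prop
      have hGA : ∀ t, 0 ≤ t → t ≤ 1 → ∀ i x, G (t, x) ≠ A i (F (pr ((m + t) / N), x)) := by
        intro t h0 h2 i x
        refine push_lemma (fun j => A j (F (pr (m / N), x)))
          (fun j => A j (F (pr ((m + t) / N), x))) (w1 x) ε hε (fun i j hij => hsep _ i j hij)
          (hcl' _ _ x ?_) (fun i => h1 i x) i
        refine (prl _ _).trans_lt ?_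
        have : ((m : ℝ) + t) / N - m / N = t / N := by ring
        rw [this, abs_of_nonneg (by positivity)]
        exact lt_of_le_of_lt (by gcongr) hNδ
      have hGD : ∀ t, ∀ x ∈ D, ∀ y ∈ D, G (t, x) = G (t, y) := by
        intro t x hx y hy
        simp only [G, FD _ x hx y hy, h1D x hx y hy]
      refine ⟨⟨fun x => G (1, x), by fun_prop⟩, ?_, hGD 1, h1h.trans ?_⟩
      · intro i x
        have := hGA 1 zero_le_one le_rfl i x
        simpa using this
      · refine mkHD (fun q => (F (pr ((m + q.1) / N), q.2), G q)) (by fun_prop) ?_ ?_ ?_ ?_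
        · intro x; simp [G]
        · intro x; simp
        · intro t h0 h2 x
          exact ⟨Fn _, fun i => hGA t h0 h2 i x⟩
        · intro t _ _ x hx y hy
          simp only [FD _ x hx y hy, hGD t x hx y hy]
  obtain ⟨w', h1, h2, h3⟩ := main N
  have hNN : pr ((N : ℝ) / N) = 1 := by rw [div_self hNpos.ne', pr1]
  have : (⟨fun x => F (pr ((N : ℕ) / N), x), by fun_prop⟩ : C(K, E)) = z' := by
    ext x; simp [hNN, F1]
  rw [this] at h3
  refine ⟨w', ?_, h2, h3⟩
  intro i x
  have := h1 i x
  rwa [hNN, F1] at this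

theorem total {n : ℕ} (A : Fin n → (ℝ × ℝ) → (ℝ × ℝ)) (hA : ∀ i, Continuous (A i))
    (hne : ∀ i j, i ≠ j → ∀ z, z ≠ 0 → A i z ≠ A j z) (k : ℕ) (hk : 2 ≤ k)
    (f : C(Fin k → I, (ℝ × ℝ) × (ℝ × ℝ)))
    (hf : PP {q : (ℝ × ℝ) × (ℝ × ℝ) | q.1 ≠ 0 ∧ ∀ i, q.2 ≠ A i q.1} (Cube.boundary (Fin k)) f) :
    NullH {q : (ℝ × ℝ) × (ℝ × ℝ) | q.1 ≠ 0 ∧ ∀ i, q.2 ≠ A i q.1} (Cube.boundary (Fin k)) f := by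
  classical
  let z : C(Fin k → I, ℝ × ℝ) := ⟨fun x => (f x).1, by fun_prop⟩
  let w : C(Fin k → I, ℝ × ℝ) := ⟨fun x => (f x).2, by fun_prop⟩
  obtain ⟨c, hc⟩ := plane k hk {0} z (fun x h => (hf.1 x).1 (Finset.mem_singleton.1 h))
    (fun x hx y hy => congrArg Prod.fst (hf.2 x hx y hy))
  rw [Finset.coe_singleton] at hc
  obtain ⟨w', h1, h2, h3⟩ := push A hA hne z (ContinuousMap.const _ c) w hc
    (fun i x => (hf.1 x).2 i) (fun x hx y hy => congrArg Prod.snd (hf.2 x hx y hy))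
  have hc0 : c ≠ 0 := by
    obtain ⟨F⟩ := hc
    have := (F.prop 1).1 (fun _ => 0)
    simpa using this
  obtain ⟨d, hd⟩ := plane k hk (Finset.univ.image fun i => A i c) w' (fun x hx => by
    obtain ⟨i, -, hi⟩ := Finset.mem_image.1 hx
    exact h1 i x hi.symm) h2
  refine ⟨(c, d), h3.trans ?_⟩
  exact map_HD (S' := {q : (ℝ × ℝ) × (ℝ × ℝ) | q.1 ≠ 0 ∧ ∀ i, q.2 ≠ A i q.1})
    (⟨fun v => (c, v), by fun_prop⟩ : C(ℝ × ℝ, (ℝ × ℝ) × (ℝ × ℝ))) (by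
      intro v hv
      refine ⟨hc0, fun i hi => hv ?_⟩
      exact Finset.mem_coe.2 (Finset.mem_image.2 ⟨i, Finset.mem_univ i, hi.symm⟩)) hd

end TwoArr

namespace TwoArr
open scoped unitInterval Topology

theorem transport {V W : Type*} [TopologicalSpace V] [TopologicalSpace W] (φ : V ≃ₜ W)
    (Y : Set V) (S : Set W) (hYS : ∀ v, v ∈ Y ↔ φ v ∈ S) (k : ℕ) (hk : 2 ≤ k)
    (hS : ∀ f : C(Fin k → I, W), PP S (Cube.boundary (Fin k)) f →
      NullH S (Cube.boundary (Fin k)) f) (x : Y) :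
    Subsingleton (HomotopyGroup (Fin k) Y x) := by
  have key : ∀ f : GenLoop (Fin k) Y x, GenLoop.Homotopic f GenLoop.const := by
    intro f
    let g : C(Fin k → I, W) := ⟨fun y => φ (f y : V), by
      have : Continuous (fun y => f y) := f.1.continuous
      fun_prop⟩
    obtain ⟨c, ⟨F⟩⟩ := hS g ⟨fun y => (hYS _).1 (f y).2, fun y hy z hz => by
      change φ (f y : V) = φ (f z : V)
      rw [show f y = x from f.2 y hy, show f z = x from f.2 z hz]⟩
    have hF : ∀ p, φ.symm (F p) ∈ Y := by
      rintro ⟨t, y⟩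
      rw [hYS, φ.apply_symm_apply]
      exact (F.prop t).1 y
    have hcY : φ.symm c ∈ Y := by
      have := hF (1, fun _ => 0)
      rwa [F.apply_one] at this
    refine based k hk f ⟨φ.symm c, hcY⟩ ⟨{
      toFun := fun p => ⟨φ.symm (F p), hF p⟩
      continuous_toFun := by fun_prop
      map_zero_left := fun y => Subtype.ext ?_
      map_one_left := fun y => Subtype.ext ?_
      prop' := fun t => ⟨fun _ => trivial, fun y hy z hz => Subtype.ext ?_⟩ }⟩
    · change φ.symm (F (0, y)) = _
      rw [F.apply_zero]
      exact φ.symm_apply_apply _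
    · change φ.symm (F (1, y)) = _
      rw [F.apply_one]
      rfl
    · exact congrArg φ.symm ((F.prop t).2 y hy z hz)
  refine ⟨fun a b => ?_⟩
  induction a using Quotient.inductionOn
  induction b using Quotient.inductionOn
  exact Quotient.sound ((key _).trans (key _).symm)

theorem zero_case (k : ℕ) (f : C(Fin k → I, EuclideanSpace ℝ (Fin 4)))
    (hf : PP Set.univ (Cube.boundary (Fin k)) f) :
    NullH Set.univ (Cube.boundary (Fin k)) f := by
  refine ⟨0, mkHD (fun q => (1 - q.1) • f q.2) (by fun_prop) (by simp) (by simp)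
    (fun _ _ _ _ => trivial) ?_⟩
  intro t _ _ y hy z hz
  simp only [hf.2 y hy z hz]

theorem lin {n : ℕ} (H : Fin (n + 1) → Submodule ℝ (EuclideanSpace ℝ (Fin 4)))
    (hH : IsTwoArrangement H) :
    ∃ (L : EuclideanSpace ℝ (Fin 4) ≃ₗ[ℝ] (ℝ × ℝ) × (ℝ × ℝ))
      (A : Fin n → (ℝ × ℝ) →ₗ[ℝ] (ℝ × ℝ)),
      (∀ v, v ∈ H 0 ↔ (L v).1 = 0) ∧
      (∀ i v, v ∈ H i.succ ↔ (L v).2 = A i (L v).1) := by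
  obtain ⟨C, hC⟩ := Submodule.exists_isCompl (H 0)
  have hCr : Module.finrank ℝ C = 2 := by
    have := Submodule.finrank_add_eq_of_isCompl hC
    rw [hH.1, finrank_euclideanSpace_fin] at this
    omega
  have h2 : Module.finrank ℝ (ℝ × ℝ) = 2 := by simp
  let e1 : C ≃ₗ[ℝ] ℝ × ℝ := LinearEquiv.ofFinrankEq _ _ (hCr.trans h2.symm)
  let e2 : H 0 ≃ₗ[ℝ] ℝ × ℝ := LinearEquiv.ofFinrankEq _ _ ((hH.1 0).trans h2.symm)
  let L : EuclideanSpace ℝ (Fin 4) ≃ₗ[ℝ] (ℝ × ℝ) × (ℝ × ℝ) :=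
    (Submodule.prodEquivOfIsCompl C (H 0) hC.symm).symm.trans (e1.prodCongr e2)
  have hL : ∀ v, v ∈ H 0 ↔ (L v).1 = 0 := by
    intro v
    have : (L v).1 = e1 ((Submodule.prodEquivOfIsCompl C (H 0) hC.symm).symm v).1 := rfl
    rw [this, LinearEquiv.map_eq_zero_iff,
      Submodule.prodEquivOfIsCompl_symm_apply_fst_eq_zero]
  have hA : ∀ i : Fin n, ∃ B : (ℝ × ℝ) →ₗ[ℝ] (ℝ × ℝ),
      ∀ v, v ∈ H i.succ ↔ (L v).2 = B (L v).1 := by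
    intro i
    let g : H i.succ →ₗ[ℝ] ℝ × ℝ := (LinearMap.fst ℝ _ _ ∘ₗ L.toLinearMap) ∘ₗ (H i.succ).subtype
    have hg : ∀ u, g u = (L u).1 := fun u => rfl
    have gi : Function.Injective g := by
      rw [← LinearMap.ker_eq_bot, LinearMap.ker_eq_bot']
      intro u hu
      have h0 : (u : EuclideanSpace ℝ (Fin 4)) ∈ H i.succ ⊓ H 0 := ⟨u.2, (hL _).2 hu⟩
      rw [hH.2 _ _ (Fin.succ_ne_zero i), Submodule.mem_bot] at h0
      exact Subtype.ext h0
    let G := LinearEquiv.ofInjectiveOfFinrankEq g gi ((hH.1 _).trans h2.symm)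
    have hG : ∀ u, G u = (L u).1 := fun u => rfl
    refine ⟨(LinearMap.snd ℝ _ _ ∘ₗ L.toLinearMap) ∘ₗ (H i.succ).subtype ∘ₗ G.symm.toLinearMap,
      fun v => ⟨fun hv => ?_, fun hv => ?_⟩⟩
    · change _ = (L (G.symm (L v).1)).2
      rw [← hG ⟨v, hv⟩, G.symm_apply_apply]
    · change _ = (L (G.symm (L v).1)).2 at hv
      have h1 : (L v).1 = (L (G.symm (L v).1)).1 := by rw [← hG, G.apply_symm_apply]
      have h3 : v = G.symm (L v).1 := L.injective (Prod.ext h1 hv)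
      rw [h3]; exact (G.symm (L v).1).2
  choose A hA using hA
  exact ⟨L, A, hL, hA⟩

theorem final {n : ℕ}
    (H : Fin n → Submodule ℝ (EuclideanSpace ℝ (Fin 4)))
    (hH : IsTwoArrangement H)
    (x : ((⋃ i, (H i : Set (EuclideanSpace ℝ (Fin 4))))ᶜ : Set (EuclideanSpace ℝ (Fin 4))))
    (k : ℕ) (hk : 2 ≤ k) :
    Subsingleton (HomotopyGroup (Fin k)
      ((⋃ i, (H i : Set (EuclideanSpace ℝ (Fin 4))))ᶜ : Set (EuclideanSpace ℝ (Fin 4))) x) := by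
  rcases n with _ | n
  · exact transport (Homeomorph.refl _) _ Set.univ (by simp) k hk (zero_case k) x
  · obtain ⟨L, A, h0, hA⟩ := lin H hH
    have hne : ∀ i j, i ≠ j → ∀ z, z ≠ 0 → A i z ≠ A j z := by
      intro i j hij z hz hAz
      apply hz
      have h1 : L.symm (z, A i z) ∈ H i.succ ⊓ H j.succ :=
        ⟨(hA i _).2 (by simp), (hA j _).2 (by simpa using hAz)⟩
      rw [hH.2 _ _ (fun h => hij (Fin.succ_injective _ h)), Submodule.mem_bot,
        LinearEquiv.map_eq_zero_iff] at h1
      exact congrArg Prod.fst h1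
    refine transport L.toContinuousLinearEquiv.toHomeomorph _
      {q : (ℝ × ℝ) × (ℝ × ℝ) | q.1 ≠ 0 ∧ ∀ i, q.2 ≠ A i q.1} ?_ k hk
      (total (fun i => A i) (fun i => (A i).continuous_of_finiteDimensional) hne k hk) x
    intro v
    change v ∉ _ ↔ ((L v).1 ≠ 0 ∧ ∀ i, (L v).2 ≠ A i (L v).1)
    simp only [Set.mem_iUnion, SetLike.mem_coe, not_exists, Fin.forall_fin_succ, h0, hA, ne_eq]

end TwoArr

/-- The complement of a 2-arrangement in `ℝ⁴` is aspherical: all higher homotopy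
groups `π_k`, `k ≥ 2`, are trivial at every basepoint. -/
theorem complement_aspherical {n : ℕ}
    (H : Fin n → Submodule ℝ (EuclideanSpace ℝ (Fin 4)))
    (hH : IsTwoArrangement H)
    (x : ((⋃ i, (H i : Set (EuclideanSpace ℝ (Fin 4))))ᶜ : Set (EuclideanSpace ℝ (Fin 4))))
    (k : ℕ) (hk : 2 ≤ k) :
    Subsingleton (HomotopyGroup (Fin k)
      ((⋃ i, (H i : Set (EuclideanSpace ℝ (Fin 4))))ᶜ : Set (EuclideanSpace ℝ (Fin 4))) x) := by
  exact TwoArr.final H hH x k hk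
end

section
/- Let H_1, …, H_n be a 2-arrangement of n planes in ℝ⁴ and X = ℝ⁴ ∖ (H_1 ∪ … ∪ H_n) its complement. Then for any basepoint x ∈ X, the abelianization of the fundamental group π₁(X, x) is isomorphic to the free abelian group ℤⁿ of rank n. -/
section aux
open Set Topology unitInterval


/-- Additive homotopy-invariant functional on paths. -/
structure PF (X : Type*) [TopologicalSpace X] (B : Type*) [AddCommGroup B] where
  val : ∀ {u v : X}, Path u v → B
  val_trans : ∀ {u v w : X} (p : Path u v) (q : Path v w), val (p.trans q) = val p + val q
  val_homot : ∀ {u v : X} (p q : Path u v), p.Homotopic q → val p = val q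

namespace PF

variable {X : Type*} [TopologicalSpace X] {B : Type*} [AddCommGroup B] (F : PF X B)

theorem val_refl (u : X) : F.val (Path.refl u) = 0 := by
  have h := F.val_trans (Path.refl u) (Path.refl u)
  rw [Path.refl_trans_refl] at h
  simpa using h

theorem val_symm {u v : X} (p : Path u v) : F.val p.symm = - F.val p := by
  have h := F.val_trans p p.symm
  have h2 : (Path.refl u).Homotopic (p.trans p.symm) := ⟨Path.Homotopy.reflTransSymm p⟩
  rw [← F.val_homot _ _ h2, val_refl] at h
  exact eq_neg_of_add_eq_zero_right h.symm

theorem val_congr {u v u' v' : X} (p : Path u v) (q : Path u' v') (h : ∀ s, p s = q s) :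
    F.val p = F.val q := by
  have h0 : u = u' := by simpa using h 0
  have h1 : v = v' := by simpa using h 1
  subst h0 h1
  congr 1
  ext s
  exact h s

theorem val_map {Y : Type*} [TopologicalSpace Y] [SimplyConnectedSpace Y] {g : Y → X}
    (hg : Continuous g) {a b : Y} (p q : Path a b) : F.val (p.map hg) = F.val (q.map hg) := by
  apply F.val_homot
  exact (SimplyConnectedSpace.paths_homotopic p q).map ⟨g, hg⟩

instance : ContractibleSpace I :=
  (convex_Icc (0:ℝ) 1).contractibleSpace ⟨0, by simp⟩

/-- local potentials are global -/
theorem local_global (φ : X → B) (V : Set X)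
    (h : ∀ u ∈ V, ∃ N ∈ 𝓝 u, ∀ v w (p : Path v w), (∀ s, p s ∈ N ∩ V) → F.val p = φ w - φ v)
    {u v : X} (p : Path u v) (hp : ∀ s, p s ∈ V) : F.val p = φ v - φ u := by
  let G : I → I → B := fun s t => F.val ((PathConnectedSpace.somePath s t).map p.continuous)
  have hG : ∀ r s t, G r s + G s t = G r t := by
    intro r s t
    simp only [G]
    rw [← F.val_trans, ← Path.map_trans]
    exact F.val_map _ _ _
  have hlc : IsLocallyConstant (fun s => G 0 s - φ (p s)) := by
    rw [IsLocallyConstant.iff_eventually_eq]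
    intro s
    obtain ⟨N, hN, hN2⟩ := h (p s) (hp s)
    have h1 : p ⁻¹' N ∈ 𝓝 s := p.continuous.continuousAt hN
    -- connected nbhd
    obtain ⟨ε, hε, hball⟩ := Metric.mem_nhds_iff.1 h1
    filter_upwards [Metric.ball_mem_nhds s hε] with t ht
    -- path in ball
    have key : ∃ q : Path s t, ∀ r, p (q r) ∈ N := by
      let f : I → I := fun r => ⟨(1 - r.1) * s.1 + r.1 * t.1, by
        have := convex_Icc (0:ℝ) 1 s.2 t.2 (sub_nonneg.2 r.2.2) r.2.1 (by ring)
        simpa using this⟩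
      refine ⟨⟨⟨f, by fun_prop⟩, by ext; simp [f], by ext; simp [f]⟩, fun r => hball ?_⟩
      change dist (f r) s < ε
      have h2 : dist t s < ε := ht
      rw [Subtype.dist_eq, Real.dist_eq] at h2 ⊢
      have : ((f r : ℝ) - s) = r.1 * (t.1 - s.1) := by simp [f]; ring
      rw [this, abs_mul, abs_of_nonneg r.2.1]
      calc _ ≤ 1 * |t.1 - s.1| := by gcongr; exact r.2.2
        _ < ε := by simpa using h2
    obtain ⟨q, hq⟩ := key
    have e1 := hN2 _ _ (q.map p.continuous) (fun r => ⟨hq r, hp _⟩)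
    have e2 : G s t = φ (p t) - φ (p s) := by
      rw [← e1]; exact F.val_map _ _ _
    rw [← hG 0 s t, e2]; abel
  have h3 := hlc.apply_eq_of_preconnectedSpace 0 1
  have h4 : G 0 0 = 0 := by simpa using hG 0 0 0
  have h5 : G 0 1 = F.val p := by
    have : F.val p = F.val ((Path.id).map p.continuous) :=
      F.val_congr _ _ (fun s => rfl)
    rw [this]; exact F.val_map _ _ _
  simp only [h4, h5, p.source, p.target] at h3
  rw [zero_sub] at h3
  have : F.val p = (F.val p - φ v) + φ v := by abel
  rw [this, ← h3]; abel

/-- all loops in V trivial -/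
def Good (V : Set X) : Prop := ∀ u (p : Path u u), (∀ s, p s ∈ V) → F.val p = 0

theorem Good.mono {F : PF X B} {V W : Set X} (h : F.Good V) (hW : W ⊆ V) : F.Good W :=
  fun u p hp => h u p (fun s => hW (hp s))

theorem Good.pot {F : PF X B} {V : Set X} (h : F.Good V) (hV : ∀ u ∈ V, ∀ v ∈ V, JoinedIn V u v) :
    ∃ φ : X → B, ∀ u v (p : Path u v), (∀ s, p s ∈ V) → F.val p = φ v - φ u := by
  classical
  by_cases hne : V.Nonempty
  · obtain ⟨b, hb⟩ := hne
    refine ⟨fun u => if hu : u ∈ V then F.val (hV b hb u hu).somePath else 0, ?_⟩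
    intro u v p hp
    have hu : u ∈ V := by simpa using hp 0
    have hv : v ∈ V := by simpa using hp 1
    simp only [hu, hv, dif_pos]
    have := h b (((hV b hb u hu).somePath.trans p).trans (hV b hb v hv).somePath.symm) (by
      intro s
      have : s ∈ (univ : Set I) := trivial
      have hr := Set.mem_range_self (f := (((hV b hb u hu).somePath.trans p).trans (hV b hb v hv).somePath.symm)) s
      rw [Path.trans_range, Path.trans_range, Path.symm_range] at hr
      rcases hr with (⟨r, hr⟩ | ⟨r, hr⟩) | ⟨r, hr⟩
      · rw [← hr]; exact (hV b hb u hu).somePath_mem r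
      · rw [← hr]; exact hp r
      · rw [← hr]; exact (hV b hb v hv).somePath_mem r)
    rw [F.val_trans, F.val_trans, F.val_symm, add_neg_eq_zero] at this
    rw [← this]; abel
  · refine ⟨0, fun u v p hp => (hne ⟨_, hp 0⟩).elim⟩

/-- gluing lemma -/
theorem glue {ι : Type*} (V : ι → Set X) (i₀ : ι) (hopen : ∀ i, IsOpen (V i))
    (hc : ∀ i, ∀ u ∈ V i, ∀ v ∈ V i, JoinedIn (V i) u v)
    (hc2 : ∀ i j, ∀ u ∈ V i ∩ V j, ∀ v ∈ V i ∩ V j, JoinedIn (V i ∩ V j) u v)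
    (hne : ∀ i j, (V i₀ ∩ V i ∩ V j).Nonempty)
    (hg : ∀ i, F.Good (V i)) : F.Good (⋃ i, V i) := by
  classical
  choose φ hφ using fun i => (hg i).pot (hc i)
  choose z hz using fun i => hne i i
  let ψ : ι → X → B := fun i u => φ i u - φ i (z i) + φ i₀ (z i)
  have hψ : ∀ i u v (p : Path u v), (∀ s, p s ∈ V i) → F.val p = ψ i v - ψ i u := by
    intro i u v p hp
    rw [hφ i u v p hp]; simp only [ψ]; abel
  have hagree : ∀ i j, ∀ u ∈ V i ∩ V j, ∀ v ∈ V i ∩ V j, ψ i u = ψ j u → ψ i v = ψ j v := by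
    intro i j u hu v hv h
    obtain ⟨p, hp⟩ := hc2 i j u hu v hv
    have h1 := hψ i _ _ p (fun s => (hp s).1)
    have h2 := hψ j _ _ p (fun s => (hp s).2)
    rw [h1, h] at h2
    exact sub_left_injective h2
  have h0 : ∀ i, ∀ u ∈ V i₀ ∩ V i, ψ i u = ψ i₀ u := by
    intro i u hu
    have hzi : z i ∈ V i ∩ V i₀ := ⟨(hz i).2, (hz i).1.1⟩
    refine hagree i i₀ (z i) hzi u hu.symm ?_
    simp [ψ]
  have hall : ∀ i j, ∀ u ∈ V i ∩ V j, ψ i u = ψ j u := by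
    intro i j u hu
    obtain ⟨y, hy⟩ := hne i j
    refine hagree i j y ⟨hy.1.2, hy.2⟩ u hu ?_
    rw [h0 i y hy.1, h0 j y ⟨hy.1.1, hy.2⟩]
  intro u p hp
  let Ψ : X → B := fun u => if h : ∃ i, u ∈ V i then ψ h.choose u else 0
  have hΨ : ∀ i, ∀ u ∈ V i, Ψ u = ψ i u := by
    intro i u hu
    have h : ∃ i, u ∈ V i := ⟨i, hu⟩
    simp only [Ψ, dif_pos h]
    exact hall _ _ _ ⟨h.choose_spec, hu⟩
  rw [F.local_global Ψ (⋃ i, V i) ?_ p hp, sub_self]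
  intro w hw
  obtain ⟨i, hi⟩ := mem_iUnion.1 hw
  refine ⟨V i, (hopen i).mem_nhds hi, fun a b q hq => ?_⟩
  rw [hψ i a b q (fun s => (hq s).1), hΨ i, hΨ i]
  · simpa using (hq 0).1
  · simpa using (hq 1).1

end PF


/-- thin sets -/
def Thin {E : Type*} [NormedAddCommGroup E] [NormedSpace ℝ E] (D : Set E) : Prop :=
  ∀ Q : Set E, IsOpen Q → Convex ℝ Q →
    (Q.Nonempty → (Q ∩ Dᶜ).Nonempty) ∧ ∀ u ∈ Q ∩ Dᶜ, ∀ v ∈ Q ∩ Dᶜ, JoinedIn (Q ∩ Dᶜ) u v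

section thin
variable {E : Type*} [NormedAddCommGroup E] [NormedSpace ℝ E] {D : Set E}

theorem Thin.joined (hD : Thin D) {Q : Set E} (hQ : IsOpen Q) (hQc : Convex ℝ Q) (u v : (Dᶜ : Set E))
    (hu : u.1 ∈ Q) (hv : v.1 ∈ Q) : JoinedIn ((↑) ⁻¹' Q : Set (Dᶜ : Set E)) u v := by
  obtain ⟨p, hp⟩ := (hD Q hQ hQc).2 u.1 ⟨hu, u.2⟩ v.1 ⟨hv, v.2⟩
  exact ⟨⟨⟨fun s => ⟨p s, (hp s).2⟩, by fun_prop⟩, by ext; simp, by ext; simp⟩, fun s => (hp s).1⟩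

variable {B : Type*} [AddCommGroup B] (F : PF (Dᶜ : Set E) B)

/-- good subset of the ambient space -/
def PF.GoodE (V : Set E) : Prop := F.Good ((↑) ⁻¹' V : Set (Dᶜ : Set E))

theorem PF.GoodE.mono {F : PF (Dᶜ : Set E) B} {V W : Set E} (h : F.GoodE V) (hW : W ⊆ V) : F.GoodE W :=
  PF.Good.mono h (preimage_mono hW)

theorem Thin.glue (hD : Thin D) {ι : Type*} (V : ι → Set E) (i₀ : ι) (ho : ∀ i, IsOpen (V i))
    (hc : ∀ i, Convex ℝ (V i)) (hne : ∀ i j, (V i₀ ∩ V i ∩ V j).Nonempty)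
    (hg : ∀ i, F.GoodE (V i)) : F.GoodE (⋃ i, V i) := by
  unfold PF.GoodE
  rw [preimage_iUnion]
  refine F.glue _ i₀ (fun i => (ho i).preimage continuous_subtype_val) ?_ ?_ ?_ hg
  · intro i u hu v hv
    exact hD.joined (ho i) (hc i) u v hu hv
  · intro i j u hu v hv
    exact hD.joined ((ho i).inter (ho j)) ((hc i).inter (hc j)) u v hu hv
  · intro i j
    obtain ⟨y, hy, hy2⟩ := (hD _ (((ho i₀).inter (ho i)).inter (ho j))
      (((hc i₀).inter (hc i)).inter (hc j))).1 (hne i j)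
    exact ⟨⟨y, hy2⟩, hy⟩

theorem Thin.glue2 (hD : Thin D) {V W U : Set E} (hV : IsOpen V) (hVc : Convex ℝ V)
    (hW : IsOpen W) (hWc : Convex ℝ W) (hne : V.Nonempty → W.Nonempty → (V ∩ W).Nonempty)
    (h1 : F.GoodE V) (h2 : F.GoodE W) (hU : U ⊆ V ∪ W) : F.GoodE U := by
  by_cases hv : V.Nonempty
  · by_cases hw : W.Nonempty
    · have hn := hne hv hw
      have := hD.glue F (fun b : Bool => if b then V else W) true (by intro i; cases i <;> simpa)
        (by intro i; cases i <;> simpa) (by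
          intro i j
          obtain ⟨y, hy⟩ := hn
          refine ⟨y, ?_⟩
          cases i <;> cases j <;> simp [hy.1, hy.2]) (by intro i; cases i <;> simpa)
      refine this.mono (hU.trans ?_)
      rintro y (hy | hy)
      · exact mem_iUnion.2 ⟨true, by simpa⟩
      · exact mem_iUnion.2 ⟨false, by simpa⟩
    · rw [not_nonempty_iff_eq_empty] at hw
      subst hw
      exact h1.mono (by simpa using hU)
  · rw [not_nonempty_iff_eq_empty] at hv
    subst hv
    exact h2.mono (by simpa using hU)

theorem slab_open (ℓ : E →L[ℝ] ℝ) {V : Set E} (hV : IsOpen V) (a b : ℝ) :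
    IsOpen (V ∩ {x | a < ℓ x ∧ ℓ x < b}) := by
  refine hV.inter ?_
  exact (isOpen_lt continuous_const ℓ.continuous).inter (isOpen_lt ℓ.continuous continuous_const)

theorem slab_convex (ℓ : E →L[ℝ] ℝ) {V : Set E} (hV : Convex ℝ V) (a b : ℝ) :
    Convex ℝ (V ∩ {x | a < ℓ x ∧ ℓ x < b}) := by
  refine hV.inter ?_
  exact (convex_halfSpace_gt ℓ.isLinear a).inter (convex_halfSpace_lt ℓ.isLinear b)

theorem Thin.chain (hD : Thin D) (ℓ : E →L[ℝ] ℝ) {V : Set E} (hV : IsOpen V) (hVc : Convex ℝ V)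
    {d : ℝ} (hd : 0 < d) (h : ∀ b, F.GoodE (V ∩ {x | b < ℓ x ∧ ℓ x < b + d})) : F.GoodE V := by
  have step : ∀ k : ℕ, ∀ b, F.GoodE (V ∩ {x | b < ℓ x ∧ ℓ x < b + d + k * (d / 2)}) := by
    intro k
    induction k with
    | zero => intro b; simpa using h b
    | succ k ih =>
      intro b
      set c := b + k * (d/2) + d / 2 with hcdef
      have hk : 0 ≤ (k:ℝ) * (d/2) := by positivity
      refine hD.glue2 F (slab_open ℓ hV b (b + d + k * (d/2))) (slab_convex ℓ hVc b _)
        (slab_open ℓ hV c (c + d)) (slab_convex ℓ hVc _ _) ?_ (ih b) (h c) ?_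
      · rintro ⟨x, hx, hx1, hx2⟩ ⟨y, hy, hy1, hy2⟩
        by_cases hxc : c < ℓ x
        · exact ⟨x, ⟨hx, hx1, hx2⟩, hx, hxc, by linarith⟩
        by_cases hyc : ℓ y < b + d + k * (d/2)
        · exact ⟨y, ⟨hy, by linarith, hyc⟩, hy, hy1, hy2⟩
        push Not at hxc hyc
        -- intermediate value
        have : (c + d/4) ∈ Icc (ℓ x) (ℓ y) := ⟨by linarith, by linarith⟩
        obtain ⟨w, hw, hw2⟩ := (hVc.isPreconnected).intermediate_value hx hy ℓ.continuous.continuousOn this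
        refine ⟨w, ⟨hw, ?_, ?_⟩, hw, ?_, ?_⟩ <;> simp only [hw2] <;> linarith
      · rintro x ⟨hx, hx1, hx2⟩
        push_cast at hx2
        by_cases hxc : c < ℓ x
        · exact Or.inr ⟨hx, hxc, by linarith⟩
        · push Not at hxc
          exact Or.inl ⟨hx, hx1, by linarith⟩
  intro u p hp
  have hcomp : IsCompact (range (fun s => ℓ (p s).1)) := isCompact_range (by fun_prop)
  obtain ⟨R, hR⟩ := hcomp.isBounded.exists_norm_le
  obtain ⟨k, hk⟩ := exists_nat_gt ((2 * R + 1) / (d/2))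
  rw [div_lt_iff₀ (by positivity)] at hk
  refine step k (-R-1) u p (fun s => ⟨hp s, ?_⟩)
  have := hR _ (mem_range_self s)
  rw [Real.norm_eq_abs, abs_le] at this
  constructor <;> linarith [this.1, this.2]

end thin

abbrev E4 := EuclideanSpace ℝ (Fin 4)

theorem Thin.bounded {D : Set E4} (hD : Thin D) {B : Type*} [AddCommGroup B] (F : PF (Dᶜ : Set E4) B)
    {V K : Set E4} (hV : IsOpen V) (hVc : Convex ℝ V) (hK : IsCompact K) (hVK : V ⊆ K)
    (hloc : ∀ x ∈ K, ∃ U, IsOpen U ∧ x ∈ U ∧ F.GoodE U) : F.GoodE V := by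
  obtain ⟨r, hr, hleb⟩ := lebesgue_number_lemma_of_metric (c := fun U : {U : Set E4 // IsOpen U ∧ F.GoodE U} => U.1)
    hK (fun U => U.2.1) (fun x hx => by
      obtain ⟨U, h1, h2, h3⟩ := hloc x hx
      exact mem_iUnion.2 ⟨⟨U, h1, h3⟩, h2⟩)
  have main : ∀ t : Finset (Fin 4), ∀ a : Fin 4 → ℝ,
      F.GoodE (V ∩ {x | ∀ i ∉ t, a i < x i ∧ x i < a i + r / 2}) := by
    intro t
    induction t using Finset.induction_on with
    | empty =>
      intro a
      by_cases hne : (V ∩ {x : E4 | ∀ i ∉ (∅ : Finset (Fin 4)), a i < x i ∧ x i < a i + r / 2}).Nonempty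
      · obtain ⟨x, hx, hx2⟩ := hne
        obtain ⟨U, hU⟩ := hleb x (hVK hx)
        refine U.2.2.mono (fun y hy => hU ?_)
        rw [Metric.mem_ball, EuclideanSpace.dist_eq, Real.sqrt_lt' hr]
        have hb : ∀ i, dist (y i) (x i) ^ 2 < (r/2)^2 := by
          intro i
          have h1 := hx2 i (by simp)
          have h2 := hy.2 i (by simp)
          rw [Real.dist_eq, sq_abs]
          apply sq_lt_sq'  <;> linarith [h1.1, h1.2, h2.1, h2.2]
        rw [Fin.sum_univ_four]
        nlinarith [hb 0, hb 1, hb 2, hb 3]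
      · rw [not_nonempty_iff_eq_empty] at hne
        rw [hne]
        intro u p hp
        exact (hp 0).elim
    | insert j t hj ih =>
      intro a
      have e : {x : E4 | ∀ i ∉ insert j t, a i < x i ∧ x i < a i + r / 2} = ⋂ i : {i // i ∉ insert j t},
          ((univ : Set E4) ∩ {x | a i < (EuclideanSpace.proj i.1 : E4 →L[ℝ] ℝ) x ∧ (EuclideanSpace.proj i.1 : E4 →L[ℝ] ℝ) x < a i + r/2}) := by
        ext x; simp
      refine hD.chain F (EuclideanSpace.proj j : E4 →L[ℝ] ℝ) (d := r/2) ?_ ?_ (by positivity) ?_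
      · rw [e]
        exact hV.inter (isOpen_iInter_of_finite fun i => slab_open _ isOpen_univ _ _)
      · rw [e]
        exact hVc.inter (convex_iInter fun i => slab_convex _ convex_univ _ _)
      · intro b
        refine (ih (Function.update a j b)).mono ?_
        rintro x ⟨⟨hx, hx1⟩, hx2⟩
        refine ⟨hx, fun i hi => ?_⟩
        by_cases hij : i = j
        · subst hij; simpa using hx2
        · simpa [hij] using hx1 i (by simp [hij, hi])
  refine (main Finset.univ 0).mono ?_
  intro x hx
  simp [hx]

theorem Thin.half {D : Set E4} (hD : Thin D) {B : Type*} [AddCommGroup B] (F : PF (Dᶜ : Set E4) B)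
    (ℓ : E4 →L[ℝ] ℝ)
    (hloc : ∀ x : E4, x ≠ 0 → ∃ U, IsOpen U ∧ x ∈ U ∧ F.GoodE U) : F.GoodE {x | 0 < ℓ x} := by
  intro u p hp
  obtain ⟨R, hR⟩ := (isCompact_range (f := fun s => (p s).1) (by fun_prop)).isBounded.exists_norm_le
  obtain ⟨s₀, -, hs⟩ := isCompact_univ.exists_isMinOn (univ_nonempty)
    (f := fun s : I => ℓ (p s).1) (by fun_prop)
  have h0 : 0 < ℓ (p s₀).1 := hp s₀
  set ε := ℓ (p s₀).1
  refine hD.bounded F (V := {x | ε / 2 < ℓ x} ∩ Metric.ball 0 (R+1))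
    (K := {x | ε / 2 ≤ ℓ x} ∩ Metric.closedBall 0 (R+1)) ?_ ?_ ?_ ?_ ?_ u p ?_
  · exact (isOpen_lt continuous_const ℓ.continuous).inter Metric.isOpen_ball
  · exact (convex_halfSpace_gt ℓ.isLinear _).inter (convex_ball _ _)
  · exact (isCompact_closedBall _ _).inter_left (isClosed_le continuous_const ℓ.continuous)
  · exact inter_subset_inter (fun x (hx : ε / 2 < ℓ x) => show ε / 2 ≤ ℓ x from hx.le) Metric.ball_subset_closedBall
  · rintro x ⟨hx, -⟩
    apply hloc
    rintro rfl
    simp at hx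
    linarith
  · intro s
    refine ⟨?_, ?_⟩
    · have : ε ≤ ℓ (p s).1 := hs (mem_univ s)
      simp only [mem_ofPred_eq]; linarith
    · have := hR _ (mem_range_self s)
      simp; linarith

theorem Thin.final {D : Set E4} (hD : Thin D) {B : Type*} [AddCommGroup B] (F : PF (Dᶜ : Set E4) B)
    (hloc : ∀ x : E4, x ≠ 0 → ∃ U, IsOpen U ∧ x ∈ U ∧ F.GoodE U) : F.GoodE {0}ᶜ := by
  let ℓ : Option (Fin 4) → E4 →L[ℝ] ℝ := fun o => o.elim (- ∑ i, (EuclideanSpace.proj i : E4 →L[ℝ] ℝ))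
    (fun i => EuclideanSpace.proj i)
  refine (hD.glue F (fun o => {x | 0 < ℓ o x}) (some 0)
    (fun o => isOpen_lt continuous_const (ℓ o).continuous)
    (fun o => convex_halfSpace_gt (ℓ o).isLinear _) ?_ (fun o => hD.half F (ℓ o) hloc)).mono ?_
  · intro i j
    -- choose coordinate k to be very negative
    have : ∃ k : Fin 4, k ≠ 0 ∧ some k ≠ i ∧ some k ≠ j := by
      revert i j; decide
    obtain ⟨k, hk0, hki, hkj⟩ := this
    let y : E4 := WithLp.toLp 2 (fun m => if m = k then -10 else 1)
    have hs : ∀ m, m ≠ k → 0 < ℓ (some m) y := by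
      intro m hm; simp [ℓ, y, hm]
    have hn : 0 < ℓ none y := by
      simp only [ℓ, y, Option.elim]
      simp [Fin.sum_univ_four]
      fin_cases k <;> simp <;> norm_num
    have ha : ∀ o, some k ≠ o → 0 < ℓ o y := by
      intro o ho
      cases o with
      | none => exact hn
      | some m => exact hs m (fun h => ho (by rw [h]))
    exact ⟨y, ⟨ha _ (by simpa using hk0), ha _ hki⟩, ha _ hkj⟩
  · intro x hx
    by_contra hcon
    simp only [mem_iUnion, mem_ofPred_eq, not_exists, not_lt] at hcon
    apply hx
    have h1 : ∀ m, x m ≤ 0 := fun m => by simpa [ℓ] using hcon (some m)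
    have h2 : 0 ≤ x 0 + x 1 + x 2 + x 3 := by
      have := hcon none
      simp [ℓ, Fin.sum_univ_four] at this
      linarith
    have := h1 0
    have := h1 1
    have := h1 2
    have := h1 3
    ext m
    fin_cases m <;> simp <;> linarith


theorem open_not_covered {ι : Type*} [Finite ι] (S : ι → Submodule ℝ E4) (hS : ∀ i, S i ≠ ⊤)
    {Q : Set E4} (hQ : IsOpen Q) (hne : Q.Nonempty) : ∃ z ∈ Q, ∀ i, z ∉ S i := by
  by_contra hcon
  push Not at hcon
  have hsub : Q ⊆ ⋃ i, (S i : Set E4) := fun z hz => by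
    obtain ⟨i, hi⟩ := hcon z hz
    exact mem_iUnion.2 ⟨i, hi⟩
  have h0 : MeasureTheory.volume (⋃ i, (S i : Set E4)) = 0 := by
    have := Finite.to_countable (α := ι)
    exact MeasureTheory.measure_iUnion_null (fun i => MeasureTheory.Measure.addHaar_submodule _ _ (hS i))
  have := hQ.measure_pos MeasureTheory.volume hne
  exact this.ne' (MeasureTheory.measure_mono_null hsub h0)

theorem seg_avoid {S : Submodule ℝ E4} {x z : E4} (hx : x ∉ S) (hz : z ∉ S ⊔ Submodule.span ℝ {x})
    (s : ℝ) : (1 - s) • x + s • z ∉ S := by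
  intro h
  by_cases hs : s = 0
  · subst hs; simp at h; exact hx h
  · apply hz
    have hz' : z = s⁻¹ • ((1 - s) • x + s • z) + (-(s⁻¹ * (1 - s))) • x := by
      rw [smul_add, smul_smul, smul_smul, inv_mul_cancel₀ hs]
      module
    rw [hz']
    exact Submodule.add_mem_sup (S.smul_mem _ h) (Submodule.smul_mem _ _ (Submodule.mem_span_singleton_self x))

theorem seg_joined {Q D : Set E4} (hQ : Convex ℝ Q) {x z : E4} (hx : x ∈ Q) (hz : z ∈ Q)
    (h : ∀ s : ℝ, (1 - s) • x + s • z ∉ D) : JoinedIn (Q ∩ Dᶜ) x z := by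
  refine ⟨⟨⟨fun s : I => (1 - s.1) • x + s.1 • z, by fun_prop⟩, by simp, by simp⟩, fun s => ⟨?_, h s⟩⟩
  exact hQ hx hz (sub_nonneg.2 s.2.2) s.2.1 (by ring)

theorem thin_arr {n : ℕ} (H : Fin n → Submodule ℝ E4) (hH : ∀ i, Module.finrank ℝ (H i) = 2) :
    Thin (⋃ i, (H i : Set E4)) := by
  have h4 : Module.finrank ℝ E4 = 4 := by simp
  have htop : Module.finrank ℝ (⊤ : Submodule ℝ E4) = 4 := by simp
  intro Q hQ hQc
  refine ⟨fun hne => ?_, ?_⟩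
  · obtain ⟨z, hz, hz2⟩ := open_not_covered H (fun i h => by
      have := hH i; rw [h, htop] at this; omega) hQ hne
    exact ⟨z, hz, by simpa using hz2⟩
  · rintro u ⟨hu, hu2⟩ v ⟨hv, hv2⟩
    simp only [mem_compl_iff, mem_iUnion, SetLike.mem_coe, not_exists] at hu2 hv2
    have hp : ∀ i (x : E4), H i ⊔ Submodule.span ℝ {x} ≠ ⊤ := by
      intro i x h
      have h1 := Submodule.finrank_add_le_finrank_add_finrank (H i) (Submodule.span ℝ {x})
      have h2 : Module.finrank ℝ (Submodule.span ℝ {x}) ≤ 1 := by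
        simpa using finrank_span_le_card (R := ℝ) ({x} : Set E4)
      rw [h, htop, hH i] at h1
      omega
    obtain ⟨z, hz, hz2⟩ := open_not_covered (ι := Fin n ⊕ Fin n)
      (Sum.elim (fun i => H i ⊔ Submodule.span ℝ {u}) (fun i => H i ⊔ Submodule.span ℝ {v}))
      (by rintro (i | i) <;> exact hp i _) hQ ⟨u, hu⟩
    refine (seg_joined hQc hu hz ?_).trans (seg_joined hQc hv hz ?_).symm
    · intro s hs
      obtain ⟨i, hi⟩ := mem_iUnion.1 hs
      exact seg_avoid (hu2 i) (hz2 (Sum.inl i)) s hi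
    · intro s hs
      obtain ⟨i, hi⟩ := mem_iUnion.1 hs
      exact seg_avoid (hv2 i) (hz2 (Sum.inr i)) s hi

theorem exists_L (S : Submodule ℝ E4) (hS : Module.finrank ℝ S = 2) :
    ∃ (L : E4 →L[ℝ] ℂ) (c : ℂ →L[ℝ] E4), (∀ x, L x = 0 ↔ x ∈ S) ∧ ∀ z, L (c z) = z := by
  have h1 : Module.finrank ℝ (E4 ⧸ S) = Module.finrank ℝ ℂ := by
    have := S.finrank_quotient_add_finrank
    have h4 : Module.finrank ℝ E4 = 4 := by simp
    rw [Complex.finrank_real_complex]; omega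
  let e : (E4 ⧸ S) ≃ₗ[ℝ] ℂ := LinearEquiv.ofFinrankEq _ _ h1
  let L : E4 →ₗ[ℝ] ℂ := e.toLinearMap ∘ₗ S.mkQ
  have hL : Function.Surjective L := e.surjective.comp S.mkQ_surjective
  obtain ⟨c, hc⟩ := L.exists_rightInverse_of_surjective (LinearMap.range_eq_top.2 hL)
  refine ⟨LinearMap.toContinuousLinearMap L, LinearMap.toContinuousLinearMap c, fun x => ?_, fun z => ?_⟩
  · simp [L]
  · simpa using LinearMap.congr_fun hc z

theorem exists_delta {n : ℕ} (H : Fin n → Submodule ℝ E4) (hH : ∀ i j, i ≠ j → H i ⊓ H j = ⊥)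
    (L : Fin n → E4 →L[ℝ] ℂ) (hL : ∀ i x, L i x = 0 ↔ x ∈ H i) (i : Fin n) (c : ℂ →L[ℝ] E4) :
    ∃ δ : ℝ, 0 < δ ∧ ∀ j, j ≠ i → ∀ h ∈ H i, h ≠ 0 → ∀ z : ℂ, ‖z‖ < δ * ‖h‖ →
      ‖L j (c z)‖ < ‖L j h‖ := by
  have key : ∀ j, ∀ᶠ δ in 𝓝[>] (0:ℝ), j ≠ i → ∀ h ∈ H i, h ≠ 0 → ∀ z : ℂ, ‖z‖ < δ * ‖h‖ →
      ‖L j (c z)‖ < ‖L j h‖ := by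
    intro j
    by_cases hj : j = i
    · simp [hj]
    let f : H i →ₗ[ℝ] ℂ := (L j).toLinearMap ∘ₗ (H i).subtype
    have hf : LinearMap.ker f = ⊥ := by
      rw [LinearMap.ker_eq_bot']
      intro m hm
      have : (m : E4) ∈ H i ⊓ H j := ⟨m.2, (hL j m).1 hm⟩
      rw [hH i j (Ne.symm hj)] at this
      simpa using this
    obtain ⟨K, hK, hKf⟩ := f.exists_antilipschitzWith hf
    have hb : ∀ h ∈ H i, ‖h‖ ≤ K * ‖L j h‖ := by
      intro h hh
      have := hKf.le_mul_dist ⟨h, hh⟩ 0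
      simpa [f, dist_zero_right] using this
    set M := ‖(L j).comp c‖
    have hM : ∀ z, ‖L j (c z)‖ ≤ M * ‖z‖ := fun z => ((L j).comp c).le_opNorm z
    have hKpos : (0:ℝ) < K := by exact_mod_cast hK
    have hM0 : 0 ≤ M := norm_nonneg _
    have hpos : 0 < 1 / (K * (M + 1)) := by positivity
    filter_upwards [Ioo_mem_nhdsGT hpos] with δ hδ _ h hh hne z hz
    have hn : 0 < ‖h‖ := norm_pos_iff.2 hne
    have h1 := hb h hh
    have h2 := hM z
    have h3 : δ * (K * (M+1)) < 1 := by
      have := hδ.2; rwa [lt_div_iff₀ (by positivity)] at this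
    have h5 : 0 < ‖L j h‖ := by
      by_contra hcon
      push Not at hcon
      nlinarith
    calc ‖L j (c z)‖ ≤ M * ‖z‖ := h2
      _ ≤ (M + 1) * (δ * ‖h‖) := by
          have := norm_nonneg z
          nlinarith
      _ ≤ (M + 1) * (δ * (K * ‖L j h‖)) := by
          have := hδ.1
          gcongr
      _ = (δ * (K * (M+1))) * ‖L j h‖ := by ring
      _ < ‖L j h‖ := by nlinarith
  have := (Filter.eventually_all.2 key).and (self_mem_nhdsWithin)
  obtain ⟨δ, h1, h2⟩ := this.exists
  exact ⟨δ, h2, h1⟩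

abbrev Cx := {z : ℂ // z ≠ 0}

/-- a lift of a path through exp -/
theorem exists_log_lift {u v : Cx} (p : Path u v) : ∃ T : C(I, ℂ), ∀ s, Complex.exp (T s) = (p s).1 := by
  obtain ⟨T, h, -⟩ := Complex.isCoveringMap_exp.exists_path_lifts p.toContinuousMap (Complex.log u.1)
    (by ext; simp [Complex.exp_log u.2])
  refine ⟨T, fun s => ?_⟩
  have := congrArg Subtype.val (congrFun h s)
  simpa using this

theorem log_start {u v : Cx} (p : Path u v) : p.toContinuousMap 0 = ⟨_, (Complex.log u.1).exp_ne_zero⟩ := by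
  ext; simp [Complex.exp_log u.2]

noncomputable def windVal {u v : Cx} (p : Path u v) : ℂ :=
  Complex.isCoveringMap_exp.liftPath p.toContinuousMap (Complex.log u.1) (log_start p) 1 - Complex.log u.1

theorem windVal_eq {u v : Cx} (p : Path u v) (T : C(I, ℂ)) (hT : ∀ s, Complex.exp (T s) = (p s).1) :
    windVal p = T 1 - T 0 := by
  have h0 : Complex.exp (T 0) = u.1 := by simpa using hT 0
  let T' : C(I, ℂ) := ⟨fun s => T s - T 0 + Complex.log u.1, by fun_prop⟩
  have : T' = Complex.isCoveringMap_exp.liftPath p.toContinuousMap (Complex.log u.1) (log_start p) := by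
    rw [IsCoveringMap.eq_liftPath_iff']
    refine ⟨?_, by simp [T']⟩
    ext s
    simp only [T', ContinuousMap.coe_mk, Function.comp, Path.coe_toContinuousMap, Complex.exp_add, Complex.exp_sub, hT, p.source,
      Complex.exp_log u.2]
    exact div_mul_cancel₀ _ u.2
  rw [windVal, ← this]
  simp [T']

/-- winding functional -/
noncomputable def windPF : PF Cx ℂ where
  val p := windVal p
  val_homot p q h := by
    unfold windVal
    rw [IsCoveringMap.liftPath_apply_one_eq_of_homotopicRel]
    exact h
  val_trans {u v w} p q := by
    obtain ⟨T, hT⟩ := exists_log_lift p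
    obtain ⟨S, hS⟩ := exists_log_lift q
    let a : Path (T 0) (T 1) := ⟨T, rfl, rfl⟩
    let S' : C(I, ℂ) := ⟨fun s => S s - S 0 + T 1, by fun_prop⟩
    have hT1 : Complex.exp (T 1) = v.1 := by simpa using hT 1
    have hS0 : Complex.exp (S 0) = v.1 := by simpa using hS 0
    have hS' : ∀ s, Complex.exp (S' s) = (q s).1 := by
      intro s
      simp only [S', ContinuousMap.coe_mk, Complex.exp_add, Complex.exp_sub, hT1, hS0, hS]
      exact div_mul_cancel₀ _ v.2
    let b : Path (T 1) (S' 1) := ⟨S', by simp [S'], rfl⟩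
    rw [windVal_eq p T hT, windVal_eq q S hS, windVal_eq (p.trans q) (a.trans b).toContinuousMap]
    · simp [S']; ring
    · intro s
      simp only [Path.coe_toContinuousMap, Path.trans_apply]
      split_ifs
      · exact hT _
      · exact hS' _

/-- pullback -/
def PF.comap {X Y : Type*} [TopologicalSpace X] [TopologicalSpace Y] {B : Type*} [AddCommGroup B]
    (F : PF X B) (g : C(Y, X)) : PF Y B where
  val p := F.val (p.map g.continuous)
  val_trans p q := by rw [Path.map_trans, F.val_trans]
  val_homot p q h := F.val_homot _ _ (h.map g)


/-- auxiliary linear data attached to an arrangement -/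
structure ArrData {n : ℕ} (H : Fin n → Submodule ℝ E4) where
  fr : ∀ i, Module.finrank ℝ (H i) = 2
  L : Fin n → E4 →L[ℝ] ℂ
  c : Fin n → ℂ →L[ℝ] E4
  δ : Fin n → ℝ
  hL : ∀ i x, L i x = 0 ↔ x ∈ H i
  hc : ∀ i z, L i (c i z) = z
  δpos : ∀ i, 0 < δ i
  hδ : ∀ i j, j ≠ i → ∀ h ∈ H i, h ≠ 0 → ∀ z : ℂ, ‖z‖ < δ i * ‖h‖ → ‖L j (c i z)‖ < ‖L j h‖

namespace ArrData
variable {n : ℕ} {H : Fin n → Submodule ℝ E4} (A : ArrData H)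

/-- complement -/
abbrev X {n : ℕ} (H : Fin n → Submodule ℝ E4) := ((⋃ i, (H i : Set E4))ᶜ : Set E4)

/-- parameter domain -/
def R (H : Fin n → Submodule ℝ E4) (i : Fin n) : Set (E4 × ℂ) := {q | (q.1 ∈ H i ∧ q.1 ≠ 0) ∧ q.2.re < 0}

noncomputable def zz (i : Fin n) (q : E4 × ℂ) : ℂ := ((A.δ i * ‖q.1‖ : ℝ) : ℂ) * Complex.exp q.2

theorem zz_cont (i : Fin n) : Continuous (A.zz i) := by unfold zz; fun_prop

theorem zz_norm (i : Fin n) {q : E4 × ℂ} (hq : q ∈ R H i) : ‖A.zz i q‖ < A.δ i * ‖q.1‖ := by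
  have h1 : 0 < A.δ i * ‖q.1‖ := mul_pos (A.δpos i) (norm_pos_iff.2 hq.1.2)
  rw [zz, norm_mul, Complex.norm_real, Real.norm_of_nonneg h1.le, Complex.norm_exp]
  have h2 : Real.exp q.2.re < 1 := Real.exp_lt_one_iff.2 hq.2
  nlinarith

theorem zz_ne (i : Fin n) {q : E4 × ℂ} (hq : q ∈ R H i) : A.zz i q ≠ 0 := by
  have h1 : 0 < A.δ i * ‖q.1‖ := mul_pos (A.δpos i) (norm_pos_iff.2 hq.1.2)
  exact mul_ne_zero (by exact_mod_cast h1.ne') (Complex.exp_ne_zero _)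

theorem Lself (i : Fin n) {q : E4 × ℂ} (hq : q ∈ R H i) : A.L i (q.1 + A.c i (A.zz i q)) = A.zz i q := by
  rw [map_add, (A.hL i _).2 hq.1.1, A.hc, zero_add]

theorem Lother {i j : Fin n} (hij : j ≠ i) {q : E4 × ℂ} (hq : q ∈ R H i) :
    ‖A.L j (A.c i (A.zz i q))‖ < ‖A.L j q.1‖ :=
  A.hδ i j hij q.1 hq.1.1 hq.1.2 _ (A.zz_norm i hq)

theorem phi_mem (i : Fin n) {q : E4 × ℂ} (hq : q ∈ R H i) :
    q.1 + A.c i (A.zz i q) ∈ (⋃ i, (H i : Set E4))ᶜ := by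
  simp only [mem_compl_iff, mem_iUnion, SetLike.mem_coe, not_exists]
  intro j hj
  rw [← A.hL] at hj
  by_cases hij : j = i
  · subst hij
    rw [A.Lself j hq] at hj
    exact A.zz_ne j hq hj
  · have h1 := A.Lother hij hq
    rw [map_add, add_comm, add_eq_zero_iff_eq_neg] at hj
    rw [hj, norm_neg] at h1
    exact lt_irrefl _ h1

/-- tubular parametrisation -/
noncomputable def phi (i : Fin n) (q : R H i) : X H := ⟨q.1.1 + A.c i (A.zz i q.1), A.phi_mem i q.2⟩

theorem phi_cont (i : Fin n) : Continuous (A.phi i) := by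
  unfold phi
  have := A.zz_cont i
  fun_prop

theorem tw (s : ℝ) : (2 * Real.pi * Complex.I * s : ℂ).re = 0 := by simp

theorem shift_mem {i : Fin n} {q : E4 × ℂ} (hq : q ∈ R H i) (s : ℝ) :
    (q.1, q.2 + 2 * Real.pi * Complex.I * s) ∈ R H i := by
  refine ⟨hq.1, ?_⟩
  show (q.2 + 2 * Real.pi * Complex.I * s).re < 0
  rw [Complex.add_re, tw, add_zero]
  exact hq.2

theorem zz_shift (i : Fin n) (q : E4 × ℂ) (k : ℤ) : A.zz i (q.1, q.2 + 2 * Real.pi * Complex.I * k) = A.zz i q := by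
  simp only [zz]
  rw [Complex.exp_eq_exp_iff_exists_int.2 ⟨k, by ring⟩]

/-- vertical path -/
noncomputable def vline {i : Fin n} (q : R H i) : Path q ⟨(q.1.1, q.1.2 + 2 * Real.pi * Complex.I * (1:ℝ)), shift_mem q.2 1⟩ where
  toFun s := ⟨(q.1.1, q.1.2 + 2 * Real.pi * Complex.I * (s.1 : ℝ)), shift_mem q.2 s⟩
  continuous_toFun := by fun_prop
  source' := by ext <;> simp
  target' := by ext <;> simp

variable {B : Type*} [AddCommGroup B] (F : PF (X H) B)

/-- value on the meridian -/
noncomputable def K {i : Fin n} (q : R H i) : B := F.val ((vline q).map (A.phi_cont i))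

theorem K_const {i : Fin n} {q q' : R H i} (p : Path q q') : A.K F q = A.K F q' := by
  let g : I × I → X H := fun a => A.phi i ⟨((p a.1).1.1, (p a.1).1.2 + 2 * Real.pi * Complex.I * (a.2.1 : ℝ)), shift_mem (p a.1).2 a.2⟩
  have hg : Continuous g := by
    have := A.phi_cont i
    fun_prop
  have h := F.val_map hg
    ((Path.id.prod (Path.refl (0:I))).trans ((Path.refl (1:I)).prod Path.id))
    (((Path.refl (0:I)).prod Path.id).trans (Path.id.prod (Path.refl (1:I))))
  rw [Path.map_trans, Path.map_trans, F.val_trans, F.val_trans] at h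
  have e1 : F.val ((Path.id.prod (Path.refl (0:I))).map hg) = F.val (p.map (A.phi_cont i)) := by
    apply F.val_congr
    intro s
    ext1
    show (p s).1.1 + A.c i (A.zz i ((p s).1.1, (p s).1.2 + 2 * Real.pi * Complex.I * (((0:I) : ℝ) : ℂ))) = (p s).1.1 + A.c i (A.zz i (p s).1)
    simp
  have e2 : F.val ((Path.id.prod (Path.refl (1:I))).map hg) = F.val (p.map (A.phi_cont i)) := by
    apply F.val_congr
    intro s
    ext1
    have := A.zz_shift i (p s).1 1
    show (p s).1.1 + A.c i (A.zz i ((p s).1.1, (p s).1.2 + 2 * Real.pi * Complex.I * (((1:I) : ℝ) : ℂ))) = (p s).1.1 + A.c i (A.zz i (p s).1)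
    rw [← this]
    simp
  have e3 : F.val (((Path.refl (1:I)).prod Path.id).map hg) = A.K F q' := by
    apply F.val_congr
    intro s
    ext1
    show (p 1).1.1 + A.c i (A.zz i ((p 1).1.1, (p 1).1.2 + 2 * Real.pi * Complex.I * ((s : ℝ) : ℂ))) = (q').1.1 + A.c i (A.zz i ((q').1.1, (q').1.2 + 2 * Real.pi * Complex.I * ((s : ℝ) : ℂ)))
    simp only [p.source, p.target]
  have e4 : F.val (((Path.refl (0:I)).prod Path.id).map hg) = A.K F q := by
    apply F.val_congr
    intro s
    ext1
    show (p 0).1.1 + A.c i (A.zz i ((p 0).1.1, (p 0).1.2 + 2 * Real.pi * Complex.I * ((s : ℝ) : ℂ))) = (q).1.1 + A.c i (A.zz i ((q).1.1, (q).1.2 + 2 * Real.pi * Complex.I * ((s : ℝ) : ℂ)))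
    simp only [p.source, p.target]
  rw [e1, e2, e3, e4, add_comm] at h
  exact (add_right_cancel h).symm

theorem R_conn (A : ArrData H) (i : Fin n) : IsPathConnected (R H i) := by
  have e : R H i = ((↑) '' ({0}ᶜ : Set (H i))) ×ˢ {t : ℂ | t.re < 0} := by
    ext q
    simp [R]
    tauto
  rw [e]
  refine IsPathConnected.prod ?_ ?_
  · refine IsPathConnected.image ?_ continuous_subtype_val
    apply isPathConnected_compl_singleton_of_one_lt_rank
    rw [← Module.finrank_eq_rank, A.fr i]
    norm_num
  · refine (convex_halfSpace_re_lt 0).isPathConnected ⟨-1, by simp⟩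

theorem K_eq {i : Fin n} (q q' : R H i) : A.K F q = A.K F q' := by
  have := isPathConnected_iff_pathConnectedSpace.1 (A.R_conn i)
  exact A.K_const F (PathConnectedSpace.somePath q q')

theorem conv_good {V : Set E4} (hV : Convex ℝ V) (hd : V ⊆ (⋃ i, (H i : Set E4))ᶜ) : F.GoodE V := by
  intro u p hp
  have hu : u.1 ∈ V := by simpa using hp 0
  have : ContractibleSpace V := hV.contractibleSpace ⟨_, hu⟩
  have hg : Continuous (inclusion hd) := continuous_inclusion hd
  let p' : Path (⟨u.1, hu⟩ : V) ⟨u.1, hu⟩ := ⟨⟨fun s => ⟨(p s).1, hp s⟩, by fun_prop⟩, by ext1; simp, by ext1; simp⟩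
  have h := F.val_map hg p' (Path.refl _)
  rw [F.val_congr (p'.map hg) p (fun s => rfl), F.val_congr ((Path.refl _).map hg) (Path.refl u) (fun s => rfl), F.val_refl] at h
  exact h

theorem local_good (i : Fin n) (hK : ∀ q : R H i, A.K F q = 0) {x : E4} (hx : x ∈ H i) (hx0 : x ≠ 0) :
    ∃ U, IsOpen U ∧ x ∈ U ∧ F.GoodE U := by
  let h : E4 → E4 := fun y => y - A.c i (A.L i y)
  have hh : Continuous h := by fun_prop
  have hmem : ∀ y, h y ∈ H i := by
    intro y
    rw [← A.hL]; simp [h, A.hc]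
  have hLx : A.L i x = 0 := (A.hL i x).2 hx
  have hxx : h x = x := by simp [h, hLx]
  have hδ := A.δpos i
  refine ⟨{y | ‖h y - x‖ < ‖x‖ ∧ ‖A.L i y‖ < A.δ i * ‖h y‖}, ?_, ?_, ?_⟩
  · exact (isOpen_lt (f := fun y => ‖h y - x‖) (g := fun _ => ‖x‖) (by fun_prop) (by fun_prop)).inter
      (isOpen_lt (f := fun y => ‖A.L i y‖) (g := fun y => A.δ i * ‖h y‖) (by fun_prop) (by fun_prop))
  · have : 0 < ‖x‖ := norm_pos_iff.2 hx0
    simp only [mem_ofPred_eq, hxx, hLx, sub_self, norm_zero]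
    exact ⟨this, by positivity⟩
  intro u p hp
  let C : Set (E4 × ℂ) := ((H i : Set E4) ∩ Metric.ball x ‖x‖) ×ˢ {t : ℂ | t.re < 0}
  have hC : Convex ℝ C := ((H i).convex.inter (convex_ball _ _)).prod (convex_halfSpace_re_lt 0)
  have hCR : C ⊆ R H i := by
    rintro ⟨a, t⟩ ⟨⟨ha, ha2⟩, ht⟩
    refine ⟨⟨ha, ?_⟩, ht⟩
    rintro rfl
    simp at ha2
  have hne : ∀ s, h (p s).1 ≠ 0 := by
    intro s hs
    have := (hp s).1
    rw [hs] at this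
    simp at this
  have hr : ∀ s, 0 < A.δ i * ‖h (p s).1‖ := fun s => mul_pos hδ (norm_pos_iff.2 (hne s))
  let γ : I → ℂ := fun s => A.L i (p s).1 / ((A.δ i * ‖h (p s).1‖ : ℝ) : ℂ)
  have hγc : Continuous γ := by
    refine Continuous.div (by fun_prop) (by fun_prop) (fun s => ?_)
    exact_mod_cast (hr s).ne'
  have hγ0 : ∀ s, γ s ≠ 0 := by
    intro s
    refine div_ne_zero ?_ (by exact_mod_cast (hr s).ne')
    intro h0
    exact (p s).2 (mem_iUnion.2 ⟨i, (A.hL i _).1 h0⟩)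
  let γ' : Path (⟨γ 0, hγ0 0⟩ : Cx) ⟨γ 1, hγ0 1⟩ := ⟨⟨fun s => ⟨γ s, hγ0 s⟩, by fun_prop⟩, rfl, rfl⟩
  obtain ⟨T, hT⟩ := exists_log_lift γ'
  have hT : ∀ s, Complex.exp (T s) = γ s := hT
  have hTre : ∀ s, (T s).re < 0 := by
    intro s
    have h1 : ‖Complex.exp (T s)‖ < 1 := by
      rw [hT, norm_div, Complex.norm_real, Real.norm_of_nonneg (hr s).le, div_lt_one (hr s)]
      exact (hp s).2
    rw [Complex.norm_exp] at h1
    exact Real.exp_lt_one_iff.1 h1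
  have h01 : γ 1 = γ 0 := by simp [γ]
  obtain ⟨k, hk⟩ : ∃ k : ℤ, T 1 = T 0 + 2 * Real.pi * Complex.I * k := by
    rw [← hT, ← hT, Complex.exp_eq_exp_iff_exists_int] at h01
    obtain ⟨k, hk⟩ := h01
    exact ⟨k, by rw [hk]; ring⟩
  have hqC : ∀ s, (h (p s).1, T s) ∈ C := fun s => ⟨⟨hmem _, by simpa [dist_eq_norm] using (hp s).1⟩, hTre s⟩
  have hu : (h u.1, T 0) ∈ C := by simpa using hqC 0
  have hec : ∀ k : ℤ, (h u.1, T 0 + 2 * Real.pi * Complex.I * k) ∈ C := by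
    intro k
    refine ⟨hu.1, ?_⟩
    show (T 0 + 2 * Real.pi * Complex.I * k).re < 0
    simpa using hTre 0
  let e : ℤ → C := fun k => ⟨_, hec k⟩
  have : ContractibleSpace C := hC.contractibleSpace ⟨_, hu⟩
  have hg : Continuous (fun a : C => A.phi i (inclusion hCR a)) := (A.phi_cont i).comp (continuous_inclusion hCR)
  let G : ℤ → ℤ → B := fun a b => F.val ((PathConnectedSpace.somePath (e a) (e b)).map hg)
  have hG : ∀ r s t, G r s + G s t = G r t := by
    intro r s t
    simp only [G]
    rw [← F.val_trans, ← Path.map_trans]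
    exact F.val_map _ _ _
  have hG1 : ∀ k, G k (k+1) = 0 := by
    intro k
    let v : Path (e k) (e (k+1)) := ⟨⟨fun s => ⟨(h u.1, T 0 + 2 * Real.pi * Complex.I * k + 2 * Real.pi * Complex.I * (s.1:ℝ)), by
      refine ⟨hu.1, ?_⟩
      show (T 0 + 2 * Real.pi * Complex.I * k + 2 * Real.pi * Complex.I * (s.1:ℝ)).re < 0
      simpa using hTre 0⟩, by fun_prop⟩, by ext <;> simp [e], by ext1; simp [e]; ring⟩
    rw [← hK ⟨(e k).1, hCR (e k).2⟩]
    have : G k (k+1) = F.val (v.map hg) := F.val_map _ _ _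
    rw [this]
    exact F.val_congr _ _ (fun s => rfl)
  have hG0 : ∀ k, G 0 k = 0 := by
    intro k
    induction k using Int.induction_on with
    | zero => simpa using hG 0 0 0
    | succ k ih => rw [← hG 0 k, ih, hG1, add_zero]
    | pred k ih =>
      have := hG 0 (-k-1) (-k)
      have h2 := hG1 (-k-1)
      rw [sub_add_cancel] at h2
      rwa [h2, add_zero, ih] at this
  let P : Path (e 0) (e k) := ⟨⟨fun s => ⟨_, hqC s⟩, by fun_prop⟩, by ext1; simp [e], by ext1; simp [e, hk]⟩
  have hfin : F.val (P.map hg) = 0 := by rw [← hG0 k]; exact F.val_map _ _ _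
  rw [← hfin]
  apply F.val_congr
  intro s
  ext1
  have hz : A.zz i (h (p s).1, T s) = A.L i (p s).1 := by
    simp only [zz, hT, γ]
    rw [mul_div_cancel₀]
    exact_mod_cast (hr s).ne'
  show (p s).1 = h (p s).1 + A.c i (A.zz i (h (p s).1, T s))
  rw [hz]
  simp [h]

theorem main_good (hK : ∀ i, ∀ q : R H i, A.K F q = 0) : F.Good univ := by
  have hclosed : IsClosed (⋃ i, (H i : Set E4)) := isClosed_iUnion_of_finite fun i => (H i).closed_of_finiteDimensional
  rcases Nat.eq_zero_or_pos n with h0 | hn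
  · subst h0
    exact conv_good F (V := univ) convex_univ (by simp)
  · have := (thin_arr H A.fr).final F (fun x hx => by
      by_cases hxD : x ∈ ⋃ i, (H i : Set E4)
      · obtain ⟨i, hi⟩ := mem_iUnion.1 hxD
        exact A.local_good F i (hK i) hi hx
      · obtain ⟨ε, hε, hb⟩ := Metric.isOpen_iff.1 hclosed.isOpen_compl x hxD
        exact ⟨_, Metric.isOpen_ball, Metric.mem_ball_self hε, conv_good F (convex_ball _ _) hb⟩)
    refine PF.Good.mono this ?_
    rintro y - hy
    apply y.2
    have hy : y.1 = 0 := hy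
    rw [hy]
    exact mem_iUnion.2 ⟨⟨0, hn⟩, (H _).zero_mem⟩

/-- linear form as map to the punctured plane -/
noncomputable def LX (i : Fin n) : C(X H, Cx) where
  toFun y := ⟨A.L i y.1, fun h0 => y.2 (mem_iUnion.2 ⟨i, (A.hL i _).1 h0⟩)⟩
  continuous_toFun := by fun_prop

theorem wind_self {i : Fin n} (q : R H i) : A.K (windPF.comap (A.LX i)) q = 2 * Real.pi * Complex.I := by
  have h1 : 0 < A.δ i * ‖q.1.1‖ := mul_pos (A.δpos i) (norm_pos_iff.2 q.2.1.2)
  have h2 : ((A.δ i * ‖q.1.1‖ : ℝ) : ℂ) ≠ 0 := by exact_mod_cast h1.ne'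
  show windVal _ = _
  rw [windVal_eq _ ⟨fun s : I => Complex.log ((A.δ i * ‖q.1.1‖ : ℝ) : ℂ) + (q.1.2 + 2 * Real.pi * Complex.I * (s.1 : ℝ)), by fun_prop⟩]
  · simp
  · intro s
    refine Eq.trans ?_ (A.Lself i (shift_mem q.2 s)).symm
    show _ = A.zz i (q.1.1, q.1.2 + 2 * Real.pi * Complex.I * (s.1 : ℝ))
    simp only [ContinuousMap.coe_mk]
    rw [Complex.exp_add, Complex.exp_log h2]
    rfl

theorem wind_other {i j : Fin n} (hij : j ≠ i) (q : R H i) : A.K (windPF.comap (A.LX j)) q = 0 := by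
  have hz := A.zz_cont i
  let f : I → ℂ := fun s => A.L j (A.c i (A.zz i (q.1.1, q.1.2 + 2 * Real.pi * Complex.I * (s.1 : ℝ)))) / A.L j q.1.1
  have hb : ∀ s, ‖f s‖ < 1 := by
    intro s
    have := A.Lother hij (shift_mem q.2 s)
    rw [norm_div, div_lt_one]
    · exact this
    · exact (norm_nonneg _).trans_lt this
  have hne : A.L j q.1.1 ≠ 0 := by
    rw [← norm_pos_iff]
    exact (norm_nonneg _).trans_lt (A.Lother hij q.2)
  have hsl : ∀ s, 1 + f s ∈ Complex.slitPlane := fun s => Complex.mem_slitPlane_of_norm_lt_one (hb s)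
  have hfc : Continuous f := by fun_prop
  show windVal _ = _
  rw [windVal_eq _ ⟨fun s : I => Complex.log (A.L j q.1.1) + Complex.log (1 + f s), by
    refine continuous_const.add (Continuous.clog (by fun_prop) hsl)⟩]
  · have : f 1 = f 0 := by
      have := A.zz_shift i q.1 1
      simp only [Int.cast_one, mul_one] at this
      simp [f, this]
    simp [this]
  · intro s
    show _ = A.L j (q.1.1 + A.c i (A.zz i (q.1.1, q.1.2 + 2 * Real.pi * Complex.I * (s.1 : ℝ))))
    simp only [ContinuousMap.coe_mk]
    rw [Complex.exp_add, Complex.exp_log hne, Complex.exp_log (Complex.slitPlane_ne_zero (hsl s)), mul_add, mul_div_cancel₀ _ hne, map_add, mul_one]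

end ArrData


section fund
variable {X : Type*} [TopologicalSpace X] {B : Type*} [AddCommGroup B]

/-- push forward of the values -/
def PF.mapHom {C : Type*} [AddCommGroup C] (F : PF X B) (f : B →+ C) : PF X C where
  val p := f (F.val p)
  val_trans p q := by rw [F.val_trans, map_add]
  val_homot p q h := by rw [F.val_homot p q h]

/-- class of a loop in the additive abelianization -/
noncomputable def cls {x : X} (p : Path x x) : Additive (Abelianization (FundamentalGroup X x)) :=
  Additive.ofMul (Abelianization.of (FundamentalGroup.fromPath (Path.Homotopic.Quotient.mk p)))

theorem cls_trans {x : X} (p q : Path x x) : cls (p.trans q) = cls p + cls q := by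
  rw [add_comm]
  unfold cls
  rw [← ofMul_mul, ← map_mul]
  rfl

theorem cls_homot {x : X} {p q : Path x x} (h : p.Homotopic q) : cls p = cls q := by
  unfold cls
  rw [Path.Homotopic.Quotient.eq.2 h]

theorem cls_surj {x : X} (a : Additive (Abelianization (FundamentalGroup X x))) : ∃ p : Path x x, cls p = a := by
  obtain ⟨g, hg⟩ := QuotientGroup.mk_surjective (s := commutator (FundamentalGroup X x)) a.toMul
  obtain ⟨p, hp⟩ := Path.Homotopic.Quotient.mk_surjective (x₀ := x) (x₁ := x) g
  refine ⟨p, ?_⟩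
  unfold cls
  rw [hp]
  exact hg

/-- universal functional -/
noncomputable def univPF {x : X} (c : ∀ u, Path x u) : PF X (Additive (Abelianization (FundamentalGroup X x))) where
  val {u v} p := cls (((c u).trans p).trans (c v).symm)
  val_trans {u v w} p q := by
    rw [← cls_trans]
    apply cls_homot
    rw [← Path.Homotopic.Quotient.eq]
    simp only [Path.Homotopic.Quotient.mk_trans, Path.Homotopic.Quotient.mk_symm, Path.Homotopic.Quotient.trans_assoc]
    congr 2
    rw [← Path.Homotopic.Quotient.trans_assoc (Path.Homotopic.Quotient.mk (c v)).symm, Path.Homotopic.Quotient.symm_trans,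
      Path.Homotopic.Quotient.refl_trans]
  val_homot {u v} p q h := by
    apply cls_homot
    exact ((Path.Homotopic.refl _).hcomp h).hcomp (Path.Homotopic.refl _)

theorem univPF_loop {x : X} (c : ∀ u, Path x u) (p : Path x x) : (univPF c).val p = cls p := by
  show cls _ = _
  rw [cls_trans, cls_trans, add_right_comm, ← cls_trans]
  have : cls ((c x).trans (c x).symm) = cls (Path.refl x) := cls_homot ⟨(Path.Homotopy.reflTransSymm (c x)).symm⟩
  rw [this, ← cls_trans]
  exact cls_homot ⟨Path.Homotopy.reflTrans p⟩

/-- homomorphism attached to a functional -/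
noncomputable def PF.hom (G : PF X B) (x : X) : Additive (Abelianization (FundamentalGroup X x)) →+ B :=
  MonoidHom.toAdditiveLeft (Abelianization.lift
    { toFun := fun g => Multiplicative.ofAdd (Quotient.lift (fun p : Path x x => G.val p) (fun p q h => G.val_homot p q h) g)
      map_one' := by
        show Multiplicative.ofAdd (G.val (Path.refl x)) = 1
        rw [G.val_refl]; rfl
      map_mul' := by
        intro g h
        obtain ⟨p, rfl⟩ := Path.Homotopic.Quotient.mk_surjective (x₀ := x) (x₁ := x) g
        obtain ⟨q, rfl⟩ := Path.Homotopic.Quotient.mk_surjective (x₀ := x) (x₁ := x) h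
        show Multiplicative.ofAdd (G.val (q.trans p)) = Multiplicative.ofAdd (G.val p) * Multiplicative.ofAdd (G.val q)
        rw [G.val_trans, ← ofAdd_add, add_comm] })

theorem PF.hom_cls (G : PF X B) {x : X} (p : Path x x) : G.hom x (cls p) = G.val p := rfl

theorem PF.hom_univ (G : PF X B) {x : X} (c : ∀ u, Path x u) {u v : X} (h : u = v) (p : Path u v) :
    G.hom x ((univPF c).val p) = G.val p := by
  subst h
  show G.hom x (cls _) = _
  rw [PF.hom_cls, G.val_trans, G.val_trans, G.val_symm]
  abel

end fund

namespace ArrData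
variable {n : ℕ} {H : Fin n → Submodule ℝ E4} (A : ArrData H)

theorem phi_shift {i : Fin n} (q : R H i) :
    A.phi i q = A.phi i ⟨(q.1.1, q.1.2 + 2 * Real.pi * Complex.I * (1:ℝ)), shift_mem q.2 1⟩ := by
  have := A.zz_shift i q.1 1
  simp only [Int.cast_one, mul_one] at this
  ext1
  simp [phi, this]

theorem final (A : ArrData H) (x : X H) :
    Nonempty (Abelianization (FundamentalGroup (X H) x) ≃* Multiplicative (Fin n → ℤ)) := by
  have hj : ∀ u : X H, ∃ _p : Path x u, True := fun u => by
    obtain ⟨p, -⟩ := (thin_arr H A.fr).joined isOpen_univ convex_univ x u (mem_univ _) (mem_univ _)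
    exact ⟨p, trivial⟩
  choose c _ using hj
  let F0 := univPF c
  have hq : ∀ i, ∃ q, q ∈ R H i := fun i => (A.R_conn i).nonempty
  choose q hq using hq
  let m := fun i => A.K F0 ⟨q i, hq i⟩
  have hw : ∀ i j, (windPF.comap (A.LX i)).hom x (m j) = if i = j then 2 * Real.pi * Complex.I else 0 := by
    intro i j
    have : (windPF.comap (A.LX i)).hom x (m j) = A.K (windPF.comap (A.LX i)) ⟨q j, hq j⟩ :=
      PF.hom_univ _ c (A.phi_shift _) _
    rw [this]
    split_ifs with h
    · subst h
      exact A.wind_self _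
    · exact A.wind_other h _
  let S := Submodule.span ℤ (range m)
  have hS : S = ⊤ := by
    rw [eq_top_iff]
    rintro a -
    obtain ⟨p, rfl⟩ := cls_surj a
    have hg := A.main_good (F0.mapHom S.mkQ.toAddMonoidHom) (fun i q' => by
      show S.mkQ (A.K F0 q') = 0
      rw [A.K_eq F0 q' ⟨q i, hq i⟩, Submodule.mkQ_apply, Submodule.Quotient.mk_eq_zero]
      exact Submodule.subset_span ⟨i, rfl⟩)
    have h2 : S.mkQ (F0.val p) = 0 := hg x p (fun _ => mem_univ _)
    rw [Submodule.mkQ_apply, Submodule.Quotient.mk_eq_zero] at h2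
    rw [← univPF_loop c]
    exact h2
  let f : (Fin n → ℤ) →ₗ[ℤ] Additive (Abelianization (FundamentalGroup (X H) x)) := Fintype.linearCombination ℤ m
  have hsurj : Function.Surjective f := by
    rw [← LinearMap.range_eq_top, Fintype.range_linearCombination]
    exact hS
  have hinj : Function.Injective f := by
    rw [injective_iff_map_eq_zero]
    intro a ha
    ext i
    have h1 : (windPF.comap (A.LX i)).hom x (f a) = a i * (2 * Real.pi * Complex.I) := by
      simp only [f, Fintype.linearCombination_apply, map_sum, map_zsmul, hw]
      simp
    rw [ha, map_zero] at h1
    have h2 := (mul_eq_zero.1 h1.symm).resolve_right Complex.two_pi_I_ne_zero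
    exact_mod_cast h2
  exact ⟨(AddEquiv.toMultiplicativeLeft (AddEquiv.ofBijective f.toAddMonoidHom ⟨hinj, hsurj⟩)).symm⟩

end ArrData

theorem arr_final {n : ℕ} (H : Fin n → Submodule ℝ E4) (hf : ∀ i, Module.finrank ℝ (H i) = 2)
    (hd : ∀ i j, i ≠ j → H i ⊓ H j = ⊥) (x : ArrData.X H) :
    Nonempty (Abelianization (FundamentalGroup (ArrData.X H) x) ≃* Multiplicative (Fin n → ℤ)) := by
  choose L c hL hc using fun i => exists_L (H i) (hf i)
  choose δ hδ hδ2 using fun i => exists_delta H hd L hL i (c i)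
  exact ArrData.final ⟨hf, L, c, δ, hL, hc, hδ, hδ2⟩ x

end aux

/-- The abelianization of the fundamental group of the complement of a 2-arrangement
of `n` planes in `ℝ⁴` is free abelian of rank `n`. -/
theorem abelianization_pi1_complement {n : ℕ}
    (H : Fin n → Submodule ℝ (EuclideanSpace ℝ (Fin 4)))
    (hH : IsTwoArrangement H)
    (x : ((⋃ i, (H i : Set (EuclideanSpace ℝ (Fin 4))))ᶜ : Set (EuclideanSpace ℝ (Fin 4)))) :
    Nonempty (Abelianization (FundamentalGroup
        ((⋃ i, (H i : Set (EuclideanSpace ℝ (Fin 4))))ᶜ : Set (EuclideanSpace ℝ (Fin 4))) x)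
      ≃* Multiplicative (Fin n → ℤ)) := by
  exact arr_final H hH.1 hH.2 x
end

section
/- Let n ≥ 1 and let X = {(z, w) ∈ ℂ² : ∏_{k=1}^{n} (z − k·w) ≠ 0} be the complement of the arrangement of n distinct complex lines z = k·w (k = 1, …, n) through the origin of ℂ², with the subspace topology and basepoint x₀ = (1, 0). Then the fundamental group π₁(X, x₀) is isomorphic to the direct product F_{n−1} × ℤ, where F_{n−1} is the free group on n − 1 generators. -/
open Finset in
/-- The complement of the arrangement of `n` complex lines `z = k·w`, `k = 1,…,n`,
through the origin of `ℂ²`. -/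
def complexArrangementComplement (n : ℕ) : Set (ℂ × ℂ) :=
  {p : ℂ × ℂ | ∏ k ∈ Finset.range n, (p.1 - ((k : ℂ) + 1) * p.2) ≠ 0}

section Helpers
open Set unitInterval Topology

theorem vk_gen {Y : Type*} [TopologicalSpace Y] (W : Bool → Set Y) (hW : ∀ i, IsOpen (W i))
    (hc : ∀ y, ∃ i, y ∈ W i)
    (Q : ∀ x y : Y, Path.Homotopic.Quotient x y → Prop)
    (hQ : ∀ x y z p q, Q x y p → Q y z q → Q x z (p.trans q))
    (hQW : ∀ i x y (p : Path x y), range p ⊆ W i → Q x y (.mk p))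
    (x y : Y) (p : Path.Homotopic.Quotient x y) : Q x y p := by
  induction p using Path.Homotopic.Quotient.ind with | mk p => ?_
  obtain ⟨t, t0, tm, ⟨n, hn⟩, hs⟩ := exists_monotone_Icc_subset_open_cover_unitInterval
    (c := fun i => p ⁻¹' (W i)) (fun i => (hW i).preimage p.continuous)
    (fun s _ => by simpa using hc (p s))
  have key : ∀ k, Q _ _ (.mk (p.subpath 0 (t k))) := by
    intro k
    induction k with
    | zero =>
      obtain ⟨i, hi⟩ := hc (p 0)
      apply hQW i
      rw [t0]
      simpa using hi
    | succ k ih =>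
      obtain ⟨i, hi⟩ := hs k
      have h2 : Q _ _ (.mk (p.subpath (t k) (t (k+1)))) := by
        apply hQW i
        rw [Path.range_subpath_of_le _ _ _ (tm (Nat.le_succ k))]
        rintro _ ⟨s, hs, rfl⟩
        exact hi hs
      have := hQ _ _ _ _ _ ih h2
      rw [← Path.Homotopic.Quotient.mk_trans] at this
      rwa [Path.Homotopic.Quotient.eq.2 ⟨Path.Homotopy.subpathTransSubpath _ _ _ _⟩] at this
  have h1 := key n
  rw [hn n le_rfl, Path.subpath_zero_one] at h1
  have aux : ∀ a b (ha : a = x) (hb : b = y), Q a b (.mk (p.cast ha hb)) → Q x y (.mk p) := by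
    rintro _ _ rfl rfl h; exact h
  exact aux _ _ _ _ h1

open Path.Homotopic in
theorem vk_surj {Y : Type*} [TopologicalSpace Y] (W : Bool → Set Y) (hW : ∀ i, IsOpen (W i))
    (hc : ∀ y, ∃ i, y ∈ W i) (y₀ : Y) (hy₀ : ∀ i, y₀ ∈ W i)
    (hcon : ∀ i, ∀ x ∈ W i, ∃ p : Path x y₀, range p ⊆ W i)
    (R : Subgroup (FundamentalGroup Y y₀))
    (hR : ∀ i i' (y : Y) (p : Path y₀ y) (q : Path y y₀), range p ⊆ W i → range q ⊆ W i' →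
      (FundamentalGroup.fromPath (.mk (p.trans q))) ∈ R) (γ : FundamentalGroup Y y₀) : γ ∈ R := by
  have main := vk_gen W hW hc (fun x y p => ∀ τ : Path.Homotopic.Quotient y₀ x,
    (∀ i (q : Path x y₀), range q ⊆ W i → FundamentalGroup.fromPath (τ.trans (.mk q)) ∈ R) → 
     (∀ i (q : Path y y₀), range q ⊆ W i →
        FundamentalGroup.fromPath ((τ.trans p).trans (.mk q)) ∈ R)) ?_ ?_
      y₀ y₀ γ.toPath (.refl y₀) ?_ true (.refl y₀) ?_
  · rw [← Path.Homotopic.Quotient.mk_refl] at main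
    simpa using main
  · intro x y z p q hp hq τ hτ
    have := hq _ (hp τ hτ)
    simpa only [Path.Homotopic.Quotient.trans_assoc] using this
  · intro i x y p hp τ hτ i' q hq
    obtain ⟨q', hq'⟩ := hcon i y (hp ⟨1, p.target⟩)
    have h1 := hτ i (p.trans q') (by rw [Path.trans_range]; exact union_subset hp hq')
    have h2 := hR i i' y q'.symm q (by simpa using hq') hq
    have := R.mul_mem h2 h1
    convert! this using 1
    simp only [FundamentalGroup.mul_def, Path.Homotopic.Quotient.mk_trans, 
      Path.Homotopic.Quotient.mk_symm]
    have aux : ∀ (a : Path.Homotopic.Quotient x y) (b c : Path.Homotopic.Quotient y y₀),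
        (τ.trans a).trans b = (τ.trans (a.trans c)).trans (c.symm.trans b) := by
      intro a b c; rw [Path.Homotopic.Quotient.trans_assoc, Path.Homotopic.Quotient.trans_assoc,
        Path.Homotopic.Quotient.trans_assoc, ← Path.Homotopic.Quotient.trans_assoc c]
      simp
    exact aux _ _ _
  · intro i q hq
    have := hR i i y₀ (.refl y₀) q (by simpa using hy₀ i) hq
    simpa using this
  · simpa using hy₀ true

theorem vk_mono {E Y F : Type*} [TopologicalSpace E] [TopologicalSpace Y] [TopologicalSpace F]
    {p : E → Y} (cov : IsCoveringMap p) (t : Bundle.Trivialization F p) {x y : Y} (γ : Path x y)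
    (hγ : range γ ⊆ t.baseSet) (g : F) (e : p ⁻¹' {x})
    (he : e.1 = t.toOpenPartialHomeomorph.symm (x, g)) :
    (cov.monodromy (.mk γ) e).1 = t.toOpenPartialHomeomorph.symm (y, g) := by
  have hy : y ∈ t.baseSet := hγ ⟨1, γ.target⟩
  have hcont : Continuous fun s => t.toOpenPartialHomeomorph.symm (γ s, g) := by
    refine t.toOpenPartialHomeomorph.symm.continuousOn.comp_continuous (by fun_prop) ?_
    intro s
    simp only [OpenPartialHomeomorph.symm_source]
    rw [t.mem_target]
    exact hγ ⟨s, rfl⟩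
  let Γ : Path e.1 (t.toOpenPartialHomeomorph.symm (y, g)) :=
    { toFun := fun s => t.toOpenPartialHomeomorph.symm (γ s, g)
      continuous_toFun := hcont
      source' := by simp [he]
      target' := by simp }
  have h := cov.monodromy_eq_of_map_eq (γ := .mk γ) (ex := e)
    (ey := ⟨t.toOpenPartialHomeomorph.symm (y, g), t.proj_symm_apply' hy⟩) (.mk Γ) ?_
  · rw [h]
  · refine congr_arg Path.Homotopic.Quotient.mk ?_
    ext s
    exact t.proj_symm_apply' (hγ ⟨s, rfl⟩)

noncomputable def vkCore {Y G : Type*} [TopologicalSpace Y] [Group G] [TopologicalSpace G]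
    [DiscreteTopology G] (W : Bool → Set Y) (hW : ∀ i, IsOpen (W i))
    (hc : ∀ y, ∃ i, y ∈ W i) (c : Y → G) (hcc : ContinuousOn c (W true ∩ W false)) :
    FiberBundleCore Bool Y G where
  baseSet := W
  isOpen_baseSet := hW
  indexAt y := (hc y).choose
  mem_baseSet_at y := (hc y).choose_spec
  coordChange i j y g := (bif j then 1 else c y) * (bif i then 1 else c y)⁻¹ * g
  coordChange_self i x _ v := by simp
  continuousOn_coordChange i j := by
    have h1 : ContinuousOn (fun p : Y × G => c p.1) ((W true ∩ W false) ×ˢ univ) :=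
      hcc.comp continuousOn_fst (fun p hp => hp.1)
    have h2 : Continuous (fun p : Y × G => p.2) := continuous_snd
    cases i <;> cases j
    · simpa using h2.continuousOn
    · rw [inter_comm]
      refine (h1.inv.mul h2.continuousOn).congr ?_
      intro p _; simp
    · refine (h1.mul h2.continuousOn).congr ?_
      intro p _; simp
    · simpa using h2.continuousOn
  coordChange_comp i j k x _ v := by
    simp [mul_assoc]

theorem vk_inj {Y J : Type*} [TopologicalSpace Y] (W : Bool → Set Y) (hW : ∀ i, IsOpen (W i))
    (hc : ∀ y, ∃ i, y ∈ W i) (y₀ : Y) (hy₀ : ∀ i, y₀ ∈ W i)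
    (c : Y → FreeGroup J) (hcc : ∀ y, y ∈ W true → y ∈ W false → ∀ᶠ z in 𝓝 y, c z = c y)
    (hc0 : c y₀ = 1) (s : J → Y)
    (A : ∀ j, Path y₀ (s j)) (B : ∀ j, Path (s j) y₀) (hA : ∀ j, range (A j) ⊆ W true)
    (hB : ∀ j, range (B j) ⊆ W false) (hs : ∀ j, c (s j) = .of j) :
    Function.Injective (FreeGroup.lift (fun j : J =>
      FundamentalGroup.fromPath (Path.Homotopic.Quotient.mk ((A j).trans (B j))))) := by
  let _ : TopologicalSpace (FreeGroup J) := ⊥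
  have : DiscreteTopology (FreeGroup J) := ⟨rfl⟩
  have hcc' : ContinuousOn c (W true ∩ W false) := by
    intro y hy
    apply ContinuousAt.continuousWithinAt
    exact continuousAt_const.congr ((hcc y hy.1 hy.2).mono fun z hz => hz.symm)
  let Z := vkCore W hW hc c hcc'
  have cov : IsCoveringMap Z.proj := FiberBundle.isCoveringMap (F := FreeGroup J) (E := Z.Fiber)
  have hch : ∀ y g, (Z.localTriv true).toOpenPartialHomeomorph.symm (y, g) =
      (Z.localTriv false).toOpenPartialHomeomorph.symm (y, c y * g) := by
    intro y g
    rw [Z.localTriv_symm_apply, Z.localTriv_symm_apply]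
    simp [Z, vkCore]
  let φ : FreeGroup J → Z.proj ⁻¹' {y₀} := fun g =>
    ⟨(Z.localTriv true).toOpenPartialHomeomorph.symm (y₀, g),
      (Z.localTriv true).proj_symm_apply' (hy₀ true)⟩
  have hφ : Function.Injective φ := by
    intro g g' h
    have h1 := congrArg Subtype.val h
    have hm : ∀ g, (y₀, g) ∈ (Z.localTriv true).toOpenPartialHomeomorph.symm.source :=
      fun g => (Z.localTriv true).mem_target.2 (hy₀ true)
    have h2 := (Z.localTriv true).toOpenPartialHomeomorph.symm.injOn (hm g) (hm g') h1
    exact congrArg Prod.snd h2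
  have key : ∀ w g, cov.monodromyPerm y₀ (FreeGroup.lift (fun j : J =>
      FundamentalGroup.fromPath (Path.Homotopic.Quotient.mk ((A j).trans (B j)))) w) (φ g)
      = φ (w * g) := by
    intro w
    induction w using FreeGroup.induction_on with
    | C1 => intro g; rw [map_one, map_one, one_mul, Equiv.Perm.one_apply]
    | of j =>
      intro g
      rw [FreeGroup.lift_apply_of, cov.coe_monodromyPerm]
      apply Subtype.ext
      erw [cov.monodromy_trans_apply (.mk (A j)) (.mk (B j))]
      rw [vk_mono cov (Z.localTriv false) (B j) (hB j) (c (s j) * g)]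
      · have := hch y₀ (c (s j) * g)
        rw [hc0, one_mul] at this
        rw [← this, hs]
      · rw [vk_mono cov (Z.localTriv true) (A j) (hA j) g, hch]
        rfl
    | inv_of j ih =>
      intro g
      rw [map_inv, map_inv, Equiv.Perm.inv_eq_iff_eq, ih]
      simp
    | mul x y hx hy =>
      intro g
      rw [map_mul, map_mul, Equiv.Perm.mul_apply, hy, hx, mul_assoc]
  rw [injective_iff_map_eq_one]
  intro w hw
  have := key w 1
  rw [hw, map_one, Equiv.Perm.one_apply] at this
  simpa using (hφ this).symm


theorem vk_main {Y J : Type*} [TopologicalSpace Y] (W : Bool → Set Y) (hW : ∀ i, IsOpen (W i))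
    (hc : ∀ y, ∃ i, y ∈ W i) (y₀ : Y)
    (hcon : ∀ i, ∀ x ∈ W i, ∀ y ∈ W i, ∃ p : Path x y, range p ⊆ W i)
    (hsc : ∀ i x y (p q : Path x y), range p ⊆ W i → range q ⊆ W i → p.Homotopic q)
    (S : Option J → Set Y) (hSo : ∀ j, IsOpen (S j))
    (hSd : ∀ j j' y, y ∈ S j → y ∈ S j' → j = j')
    (hSW : ∀ j i, S j ⊆ W i) (hWS : ∀ y, y ∈ W true → y ∈ W false → ∃ j, y ∈ S j)
    (hSn : ∀ j, (S j).Nonempty)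
    (hSc : ∀ j, ∀ x ∈ S j, ∀ y ∈ S j, ∃ p : Path x y, range p ⊆ S j)
    (h0 : y₀ ∈ S none) : Nonempty (FundamentalGroup Y y₀ ≃* FreeGroup J) := by
  classical
  have hy₀ : ∀ i, y₀ ∈ W i := fun i => hSW _ i h0
  let ev : Option J → FreeGroup J := fun j => j.elim 1 FreeGroup.of
  let c : Y → FreeGroup J := fun y => if h : ∃ j, y ∈ S j then ev h.choose else 1
  have hcS : ∀ j, ∀ y ∈ S j, c y = ev j := by
    intro j y hy
    have h : ∃ j, y ∈ S j := ⟨j, hy⟩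
    simp only [c, dif_pos h]
    rw [hSd _ _ _ h.choose_spec hy]
  choose s hs using hSn
  choose A hA using fun j => hcon true y₀ (hy₀ _) (s j) (hSW j _ (hs j))
  choose B hB using fun j => hcon false (s j) (hSW j _ (hs j)) y₀ (hy₀ _)
  let L : Option J → FundamentalGroup Y y₀ := fun j =>
    FundamentalGroup.fromPath (Path.Homotopic.Quotient.mk ((A j).trans (B j)))
  have hL : ∀ j, ∀ y ∈ S j, ∀ (p : Path y₀ y) (q : Path y y₀), range p ⊆ W true →
      range q ⊆ W false → FundamentalGroup.fromPath (Path.Homotopic.Quotient.mk (p.trans q)) = L j := by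
    intro j y hy p q hp hq
    obtain ⟨r, hr⟩ := hSc j _ (hs j) y hy
    have e1 := Path.Homotopic.Quotient.eq.2 (hsc true _ _ p ((A j).trans r) hp
      (by rw [Path.trans_range]; exact union_subset (hA j) (hr.trans (hSW j _))))
    have e2 := Path.Homotopic.Quotient.eq.2 (hsc false _ _ q (r.symm.trans (B j)) hq
      (by rw [Path.trans_range, Path.symm_range];
          exact union_subset (hr.trans (hSW j _)) (hB j)))
    simp only [L]
    rw [Path.Homotopic.Quotient.mk_trans, e1, e2]
    simp only [Path.Homotopic.Quotient.mk_trans, Path.Homotopic.Quotient.mk_symm]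
    rw [Path.Homotopic.Quotient.trans_assoc, ← Path.Homotopic.Quotient.trans_assoc (.mk r)]
    simp
  have hL0 : L none = 1 := by
    rw [← hL none y₀ h0 (.refl y₀) (.refl y₀) (by simpa using hy₀ true) (by simpa using hy₀ false)]
    rw [Path.Homotopic.Quotient.mk_trans]
    simp
    rfl
  let Ψ : FreeGroup J →* FundamentalGroup Y y₀ := FreeGroup.lift (fun j : J => L (some j))
  have hinj : Function.Injective Ψ := by
    apply vk_inj W hW hc y₀ hy₀ c ?_ ?_ (fun j => s (some j)) (fun j => A (some j))
      (fun j => B (some j)) (fun j => hA _) (fun j => hB _) ?_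
    · intro y h1 h2
      obtain ⟨j, hj⟩ := hWS y h1 h2
      filter_upwards [(hSo j).mem_nhds hj] with z hz
      rw [hcS j z hz, hcS j y hj]
    · exact hcS none y₀ h0
    · intro j
      exact hcS (some j) _ (hs _)
  have hLR : ∀ j, L j ∈ Ψ.range := by
    rintro (_ | j)
    · rw [hL0]; exact one_mem _
    · exact ⟨.of j, by simp [Ψ]⟩
  have hsurj : Function.Surjective Ψ := by
    intro γ
    refine vk_surj W hW hc y₀ hy₀ (fun i x hx => hcon i x hx y₀ (hy₀ i)) Ψ.range ?_ γ
    have key : ∀ (y : Y) (p : Path y₀ y) (q : Path y y₀), range p ⊆ W true → range q ⊆ W false →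
      (FundamentalGroup.fromPath (.mk (p.trans q))) ∈ Ψ.range := by
      intro y p q hp hq
      obtain ⟨j, hj⟩ := hWS y (hp ⟨1, p.target⟩) (hq ⟨0, q.source⟩)
      rw [hL j y hj p q hp hq]
      exact hLR j
    have key2 : ∀ i (y : Y) (p : Path y₀ y) (q : Path y y₀), range p ⊆ W i → range q ⊆ W i →
      (FundamentalGroup.fromPath (.mk (p.trans q))) ∈ Ψ.range := by
      intro i y p q hp hq
      rw [Path.Homotopic.Quotient.eq.2 (hsc i _ _ (p.trans q) (.refl y₀)
        (by rw [Path.trans_range]; exact union_subset hp hq) (by simpa using hy₀ i))]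
      exact one_mem _
    intro i i' y p q hp hq
    rcases i with _ | _ <;> rcases i' with _ | _
    · exact key2 _ y p q hp hq
    · have := Ψ.range.inv_mem (key y q.symm p.symm (by simpa using hq) (by simpa using hp))
      convert! this using 1
      change _ = Path.Homotopic.Quotient.symm (Path.Homotopic.Quotient.mk _)
      rw [← Path.Homotopic.Quotient.mk_symm, Path.trans_symm]
      simp
    · exact key y p q hp hq
    · exact key2 _ y p q hp hq
  exact ⟨(MulEquiv.ofBijective Ψ ⟨hinj, hsurj⟩).symm⟩


/-- The complex plane minus the real points `a k`. -/
def puncPlane {J : Type*} (a : J → ℝ) : Set ℂ := {z | ∀ k, z ≠ (a k : ℂ)}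

/-- The complex plane minus vertical rays from the points `a k`. -/
def slitPl {J : Type*} (a : J → ℝ) (sg : ℝ) : Set ℂ := {z | ∀ k, z.re ≠ a k ∨ 0 < sg * z.im}

theorem slitPl_sub {J : Type*} (a : J → ℝ) (sg : ℝ) : slitPl a sg ⊆ puncPlane a := by
  rintro z hz k rfl
  simpa using hz k

theorem slitPl_contr {J : Type*} (a : J → ℝ) (sg : ℝ) (hsg : sg * sg = 1) :
    ContractibleSpace (slitPl a sg) := by
  rw [contractible_iff_id_nullhomotopic]
  have hsg0 : 0 < sg * sg := by rw [hsg]; norm_num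
  let b : slitPl a sg := ⟨⟨0, sg⟩, fun k => Or.inr hsg0⟩
  have hkey : ∀ z : ℂ, 0 < sg * (z.im + sg * (|z.im| + 1)) := by
    intro z
    have h1 : sg * (z.im + sg * (|z.im| + 1)) = sg * z.im + (|z.im| + 1) := by
      linear_combination (|z.im| + 1) * hsg
    have h2 : |sg * z.im| = |z.im| := by
      have : |sg| = 1 := by
        have := abs_mul_abs_self sg
        rw [hsg] at this
        nlinarith [abs_nonneg sg]
      rw [abs_mul, this, one_mul]
    have := neg_abs_le (sg * z.im)
    linarith
  let m : C(slitPl a sg, slitPl a sg) :=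
    ⟨fun z => ⟨⟨z.1.re, z.1.im + sg * (|z.1.im| + 1)⟩, fun k => Or.inr (hkey z.1)⟩, by
      refine Continuous.subtype_mk ?_ _
      refine Complex.equivRealProdCLM.symm.continuous.comp (f := fun z : slitPl a sg => 
        (z.1.re, z.1.im + sg * (|z.1.im| + 1))) ?_
      fun_prop⟩
  refine ⟨b, ContinuousMap.Homotopic.trans (g := m) ⟨?_⟩ ⟨?_⟩⟩
  · refine 
      { toFun := fun p => ⟨⟨p.2.1.re, p.2.1.im + p.1.1 * (sg * (|p.2.1.im| + 1))⟩, ?_⟩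
        continuous_toFun := ?_
        map_zero_left := ?_
        map_one_left := ?_ }
    · intro k
      refine (p.2.2 k).imp_right fun h => ?_
      have h1 := p.1.2.1
      have h2 := abs_nonneg p.2.1.im
      have : sg * (p.2.1.im + p.1.1 * (sg * (|p.2.1.im| + 1))) = 
        sg * p.2.1.im + p.1.1 * (|p.2.1.im| + 1) := by
        linear_combination p.1.1 * (|p.2.1.im| + 1) * hsg
      simp only
      rw [this]
      positivity
    · refine Continuous.subtype_mk ?_ _
      refine Complex.equivRealProdCLM.symm.continuous.comp (f := fun p : I × slitPl a sg => 
        (p.2.1.re, p.2.1.im + p.1.1 * (sg * (|p.2.1.im| + 1)))) ?_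
      fun_prop
    · intro z
      apply Subtype.ext
      apply Complex.ext <;> simp
    · intro z
      apply Subtype.ext
      apply Complex.ext <;> simp [m]
  · refine 
      { toFun := fun p => ⟨⟨(1 - p.1.1) * p.2.1.re, (1 - p.1.1) * (p.2.1.im + (sg * (|p.2.1.im| + 1))) + p.1.1 * sg⟩, ?_⟩
        continuous_toFun := ?_
        map_zero_left := ?_
        map_one_left := ?_ }
    · intro k
      refine Or.inr ?_
      have h0 := p.1.2.1
      have h1 : 0 ≤ 1 - p.1.1 := sub_nonneg.2 p.1.2.2
      have h2 := hkey p.2.1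
      have : sg * ((1 - p.1.1) * (p.2.1.im + (sg * (|p.2.1.im| + 1))) + p.1.1 * sg) = 
        (1 - p.1.1) * (sg * (p.2.1.im + sg * (|p.2.1.im| + 1))) + p.1.1 := by
        linear_combination p.1.1 * hsg
      simp only
      rw [this]
      rcases h0.eq_or_lt with h | h
      · rw [← h]; linarith
      · positivity
    · refine Continuous.subtype_mk ?_ _
      refine Complex.equivRealProdCLM.symm.continuous.comp (f := fun p : I × slitPl a sg => 
        ((1 - p.1.1) * p.2.1.re, (1 - p.1.1) * (p.2.1.im + (sg * (|p.2.1.im| + 1))) + p.1.1 * sg)) ?_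
      fun_prop
    · intro z
      apply Subtype.ext
      apply Complex.ext <;> simp [m]
    · intro z
      apply Subtype.ext
      apply Complex.ext <;> simp [b]

/-- The index intervals. -/
def strip {J : Type*} (a : J → ℝ) : Option J → Set ℝ
  | none => {x | ∀ k, x < a k}
  | some j => {x | a j < x ∧ ∀ k, a k ≤ a j ∨ x < a k}

theorem strip_ord {J : Type*} (a : J → ℝ) (j : Option J) : OrdConnected (strip a j) := by
  constructor
  intro x hx y hy z hz
  cases j with
  | none => exact fun k => hz.2.trans_lt (hy k)
  | some j => exact ⟨hx.1.trans_le hz.1, fun k => (hy.2 k).imp_right fun h => hz.2.trans_lt h⟩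

theorem strip_notMem {J : Type*} (a : J → ℝ) (j : Option J) (x : ℝ) (hx : x ∈ strip a j) (k : J) : 
    x ≠ a k := by
  rintro rfl
  cases j with
  | none => exact lt_irrefl _ (hx k)
  | some j => rcases hx with ⟨h1, h2⟩; rcases h2 k with h | h <;> linarith

theorem strip_open {J : Type*} [Finite J] (a : J → ℝ) (j : Option J) : IsOpen (strip a j) := by
  cases j with
  | none =>
    simp only [strip, ofPred_forall]
    exact isOpen_iInter_of_finite fun k => isOpen_Iio
  | some j =>
    simp only [strip, ofPred_forall, ofPred_and, ofPred_or]
    refine isOpen_Ioi.inter (isOpen_iInter_of_finite fun k => isOpen_const.union isOpen_Iio)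

theorem strip_nonempty {J : Type*} [Finite J] (a : J → ℝ) (j : Option J) : (strip a j).Nonempty := by
  cases j with
  | none =>
    have : ∀ᶠ x in Filter.atBot, ∀ k, x < a k := 
      Filter.eventually_all.2 fun k => Filter.eventually_lt_atBot _
    exact this.exists
  | some j =>
    have : ∀ᶠ x in 𝓝[>] (a j), a j < x ∧ ∀ k, a k ≤ a j ∨ x < a k := by
      refine Filter.Eventually.and self_mem_nhdsWithin (Filter.eventually_all.2 fun k => ?_)
      rcases le_or_gt (a k) (a j) with h | h
      · exact Filter.Eventually.of_forall fun x => Or.inl h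
      · filter_upwards [nhdsWithin_le_nhds (Iio_mem_nhds h)] with x hx using Or.inr hx
    exact this.exists

theorem strip_disj {J : Type*} (a : J → ℝ) (ha : Function.Injective a) (j j' : Option J) (x : ℝ)
    (h : x ∈ strip a j) (h' : x ∈ strip a j') : j = j' := by
  rcases j with _ | j <;> rcases j' with _ | j'
  · rfl
  · exact absurd (h j') (not_lt.2 h'.1.le)
  · exact absurd (h' j) (not_lt.2 h.1.le)
  · congr 1
    apply ha
    rcases h.2 j' with h1 | h1 <;> rcases h'.2 j with h2 | h2
    · exact le_antisymm h2 h1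
    · exact absurd h2 (not_lt.2 h.1.le)
    · exact absurd h1 (not_lt.2 h'.1.le)
    · exact absurd h1 (not_lt.2 h'.1.le)

theorem strip_cover {J : Type*} [Finite J] (a : J → ℝ) (x : ℝ) (hx : ∀ k, x ≠ a k) :
    ∃ j, x ∈ strip a j := by
  by_cases h : ∃ k, a k < x
  · obtain ⟨j, hj, hm⟩ := (toFinite {k | a k < x}).exists_maximalFor a _ h
    refine ⟨some j, hj, fun k => ?_⟩
    rcases lt_or_gt_of_ne (hx k) with h1 | h1
    · exact Or.inr h1
    · left
      by_contra hlt
      exact hlt (hm h1 (le_of_not_ge hlt))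
  · push Not at h
    exact ⟨none, fun k => lt_of_le_of_ne (h k) (hx k)⟩

theorem pi1_punc {J : Type*} [Finite J] (a : J → ℝ) (ha : Function.Injective a) 
    (y : puncPlane a) : Nonempty (FundamentalGroup (puncPlane a) y ≃* FreeGroup J) := by
  let sg : Bool → ℝ := fun i => bif i then 1 else -1
  have hsg : ∀ i, sg i * sg i = 1 := by rintro (_ | _) <;> simp [sg]
  have hsimp : ∀ i, SimplyConnectedSpace (slitPl a (sg i)) := fun i => 
    have := slitPl_contr a (sg i) (hsg i)
    inferInstance
  let W : Bool → Set (puncPlane a) := fun i => Subtype.val ⁻¹' (slitPl a (sg i))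
  let f : ∀ i, C(slitPl a (sg i), puncPlane a) := fun i => 
    ⟨Set.inclusion (slitPl_sub a (sg i)), continuous_inclusion _⟩
  obtain ⟨x0, hx0⟩ := strip_nonempty a none
  let y₀ : puncPlane a := ⟨(x0 : ℂ), fun k => by 
    have := hx0 k
    exact_mod_cast this.ne⟩
  have hc : ∀ y : puncPlane a, ∃ i, y ∈ W i := by
    rintro ⟨y, hy⟩
    rcases lt_or_ge 0 y.im with h | h
    · exact ⟨true, fun k => Or.inr (by simpa [sg] using h)⟩
    · refine ⟨false, fun k => ?_⟩
      rcases h.lt_or_eq with h | h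
      · exact Or.inr (by simpa [sg] using h)
      · left
        intro h'
        exact hy k (Complex.ext (by simpa using h') (by simpa using h))
  have hcon : ∀ i, ∀ x ∈ W i, ∀ y ∈ W i, ∃ p : Path x y, range p ⊆ W i := by
    intro i x hx y hy
    have := hsimp i
    let p := PathConnectedSpace.somePath (⟨x.1, hx⟩ : slitPl a (sg i)) ⟨y.1, hy⟩
    refine ⟨p.map (f i).continuous, ?_⟩
    rintro _ ⟨t, rfl⟩
    exact (p t).2
  have hSW : ∀ j i, Subtype.val ⁻¹' (Complex.re ⁻¹' (strip a j)) ⊆ W i := by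
    intro j i y hy k
    exact Or.inl (strip_notMem a j _ hy k)
  have main : Nonempty (FundamentalGroup (puncPlane a) y₀ ≃* FreeGroup J) := by
    refine vk_main W ?_ hc y₀ hcon ?_ (fun j => Subtype.val ⁻¹' (Complex.re ⁻¹' (strip a j))) 
      ?_ ?_ hSW ?_ ?_ ?_ ?_
    · intro i
      refine IsOpen.preimage continuous_subtype_val ?_
      simp only [slitPl, ofPred_forall, ofPred_or]
      refine isOpen_iInter_of_finite fun k => IsOpen.union ?_ ?_
      · exact isOpen_ne_fun Complex.continuous_re continuous_const
      · exact isOpen_lt continuous_const (continuous_const.mul Complex.continuous_im)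
    · intro i x y p q hp hq
      have := hsimp i
      have hx : x.1 ∈ slitPl a (sg i) := hp ⟨0, p.source⟩
      have hy : y.1 ∈ slitPl a (sg i) := hp ⟨1, p.target⟩
      have lift : ∀ p : Path x y, range p ⊆ W i → 
          ∃ p' : Path (⟨x.1, hx⟩ : slitPl a (sg i)) ⟨y.1, hy⟩, p'.map (f i).continuous = p := by
        intro p hp
        refine ⟨⟨⟨fun t => ⟨(p t).1, hp ⟨t, rfl⟩⟩, by fun_prop⟩, by simp, by simp⟩, ?_⟩
        ext t
        rfl
      obtain ⟨p', rfl⟩ := lift p hp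
      obtain ⟨q', rfl⟩ := lift q hq
      exact (SimplyConnectedSpace.paths_homotopic p' q').map (f i)
    · intro j
      exact ((strip_open a j).preimage Complex.continuous_re).preimage continuous_subtype_val
    · intro j j' y h h'
      exact strip_disj a ha j j' _ h h'
    · intro y h1 h2
      apply strip_cover
      intro k
      rcases h1 k with h1 | h1
      · exact h1
      rcases h2 k with h2 | h2
      · exact h2
      simp [sg] at h1 h2
      linarith
    · intro j
      obtain ⟨x, hx⟩ := strip_nonempty a j
      exact ⟨⟨x, fun k h => strip_notMem a j x hx k (by exact_mod_cast h)⟩, hx⟩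
    · intro j x hx y hy
      have hconv : Convex ℝ (Complex.re ⁻¹' (strip a j)) := 
        (strip_ord a j).convex.linear_preimage Complex.reLm
      obtain ⟨p, hp⟩ := (hconv.isPathConnected ⟨x.1, hx⟩).joinedIn _ hx _ hy
      refine ⟨⟨⟨fun t => ⟨p t, fun k h => strip_notMem a j _ (hp t) k (by simp [h])⟩, 
        by fun_prop⟩, by simp, by simp⟩, ?_⟩
      rintro _ ⟨t, rfl⟩
      exact hp t
    · exact hx0
  obtain ⟨i, hi⟩ := hc y
  obtain ⟨p, -⟩ := hcon i y hi y₀ (hSW none i hx0)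
  exact main.map fun e => (FundamentalGroup.fundamentalGroupMulEquivOfPath p).trans e

theorem pi1_homeo {X Y : Type*} [TopologicalSpace X] [TopologicalSpace Y] (h : X ≃ₜ Y) (x : X) :
    Nonempty (FundamentalGroup X x ≃* FundamentalGroup Y (h x)) := by
  refine ⟨MulEquiv.ofBijective (FundamentalGroup.map (h : C(X, Y)) x) ⟨?_, ?_⟩⟩
  · intro p q hpq
    induction p using Path.Homotopic.Quotient.ind with | mk p
    induction q using Path.Homotopic.Quotient.ind with | mk q
    have h1 : (p.map h.continuous).Homotopic (q.map h.continuous) :=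
      Path.Homotopic.Quotient.exact hpq
    have h2 := h1.map (h.symm : C(Y, X))
    obtain ⟨F⟩ := h2
    have hx : x = h.symm (h x) := (h.symm_apply_apply x).symm
    have h3 : p = ((p.map h.continuous).map h.symm.continuous).cast hx hx := by
      ext t; simp
    have h4 : q = ((q.map h.continuous).map h.symm.continuous).cast hx hx := by
      ext t; simp
    rw [h3, h4]
    exact Path.Homotopic.Quotient.eq.2 ⟨F.pathCast hx hx⟩
  · intro q
    induction q using Path.Homotopic.Quotient.ind with | mk q
    have hx : x = h.symm (h x) := (h.symm_apply_apply x).symm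
    refine ⟨Path.Homotopic.Quotient.mk ((q.map h.symm.continuous).cast hx hx), ?_⟩
    refine congrArg Path.Homotopic.Quotient.mk (?_ : ((q.map h.symm.continuous).cast hx hx).map h.continuous = q)
    ext t
    simp

theorem pi1_prod {X Y : Type*} [TopologicalSpace X] [TopologicalSpace Y] (x : X) (y : Y) :
    Nonempty (FundamentalGroup (X × Y) (x, y) ≃* FundamentalGroup X x × FundamentalGroup Y y) := by
  refine ⟨MulEquiv.symm
    { toFun := fun p => (Path.Homotopic.prod p.1 p.2 : Path.Homotopic.Quotient (x, y) (x, y))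
      invFun := fun p => (Path.Homotopic.projLeft (c₁ := (x, y)) (c₂ := (x, y)) p,
        Path.Homotopic.projRight (c₁ := (x, y)) (c₂ := (x, y)) p)
      left_inv := fun p => Prod.ext (Path.Homotopic.projLeft_prod _ _) (Path.Homotopic.projRight_prod _ _)
      right_inv := fun p => Path.Homotopic.prod_projLeft_projRight _
      map_mul' := fun p q => (Path.Homotopic.comp_prod_eq_prod_comp _ _ _ _).symm }⟩

theorem arr_mem (m : ℕ) (p : ℂ × ℂ) : p ∈ complexArrangementComplement (m + 1) ↔
    p.1 - p.2 ≠ 0 ∧ ∀ k : Fin m, p.1 - ((k : ℂ) + 2) * p.2 ≠ 0 := by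
  simp only [complexArrangementComplement, Set.mem_ofPred_eq, Finset.prod_ne_zero_iff,
    Finset.mem_range]
  constructor
  · intro h
    refine ⟨by simpa using h 0 (by omega), fun k => ?_⟩
    have := h (k + 1) (by omega)
    push_cast at this
    convert this using 3
    ring
  · rintro ⟨h0, h⟩ (_ | k) hk
    · simpa using h0
    · have := h ⟨k, by omega⟩
      push_cast
      convert this using 3
      ring

noncomputable def arrHomeo (m : ℕ) : complexArrangementComplement (m + 1) ≃ₜ
    puncPlane (fun _ : Unit => (0 : ℝ)) × puncPlane (fun k : Fin m => 1 / ((k : ℝ) + 1)) where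
  toFun p := (⟨p.1.1 - p.1.2, fun _ => by simpa using ((arr_mem m p.1).1 p.2).1⟩,
    ⟨p.1.2 / (p.1.1 - p.1.2), fun k => by
      have h0 := ((arr_mem m p.1).1 p.2).1
      have h1 := ((arr_mem m p.1).1 p.2).2 k
      intro h
      have hk : (k : ℂ) + 1 ≠ 0 := Nat.cast_add_one_ne_zero _
      push_cast at h
      rw [div_eq_div_iff h0 hk] at h
      apply h1
      linear_combination -h⟩)
  invFun q := ⟨(q.1.1 + q.1.1 * q.2.1, q.1.1 * q.2.1), (arr_mem m _).2 ⟨by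
      simpa using q.1.2 (), fun k => by
      have h0 : q.1.1 ≠ 0 := by simpa using q.1.2 ()
      have h1 := q.2.2 k
      have hk : (k : ℂ) + 1 ≠ 0 := Nat.cast_add_one_ne_zero _
      intro h
      apply h1
      push_cast
      rw [eq_div_iff hk]
      apply mul_left_cancel₀ h0
      linear_combination -h⟩⟩
  left_inv p := by
    have h0 := ((arr_mem m p.1).1 p.2).1
    apply Subtype.ext
    apply Prod.ext
    · simp only [mul_div_cancel₀ _ h0]; ring
    · simp only [mul_div_cancel₀ _ h0]
  right_inv q := by
    have h0 : q.1.1 ≠ 0 := by simpa using q.1.2 ()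
    apply Prod.ext
    · apply Subtype.ext; simp
    · apply Subtype.ext; simp [mul_div_cancel_left₀ _ h0]
  continuous_toFun := by
    refine Continuous.prodMk (Continuous.subtype_mk (by fun_prop) _) (Continuous.subtype_mk ?_ _)
    exact Continuous.div (by fun_prop) (by fun_prop) fun p => ((arr_mem m p.1).1 p.2).1
  continuous_invFun := by
    refine Continuous.subtype_mk ?_ _
    fun_prop

theorem pi1_arr (m : ℕ) (x : complexArrangementComplement (m + 1)) :
    Nonempty (FundamentalGroup (complexArrangementComplement (m + 1)) x ≃*
      FreeGroup (Fin m) × Multiplicative ℤ) := by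
  obtain ⟨e1⟩ := pi1_homeo (arrHomeo m) x
  obtain ⟨e2⟩ := pi1_prod (arrHomeo m x).1 (arrHomeo m x).2
  obtain ⟨e3⟩ := pi1_punc (fun _ : Unit => (0 : ℝ)) (Function.injective_of_subsingleton _)
    (arrHomeo m x).1
  obtain ⟨e4⟩ := pi1_punc (fun k : Fin m => 1 / ((k : ℝ) + 1)) (by
    intro i j h
    have h' : 1 / ((i : ℝ) + 1) = 1 / ((j : ℝ) + 1) := h
    rw [one_div, one_div, inv_inj, add_left_inj] at h'
    exact Fin.ext (by exact_mod_cast h')) (arrHomeo m x).2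
  exact ⟨e1.trans (e2.trans ((MulEquiv.prodCongr (e3.trans FreeGroup.mulEquivIntOfUnique) e4).trans
    MulEquiv.prodComm))⟩

end Helpers

/-- The fundamental group of the complement of the complex arrangement of `n` lines
in `ℂ²`, based at `(1,0)`, is `F_{n-1} × ℤ`. -/
theorem pi1_complex_arrangement (n : ℕ) (hn : 1 ≤ n) :
    Nonempty (FundamentalGroup (complexArrangementComplement n)
        ⟨(1, 0), by simp [complexArrangementComplement]⟩
      ≃* FreeGroup (Fin (n - 1)) × Multiplicative ℤ) := by
  obtain ⟨m, rfl⟩ : ∃ m, n = m + 1 := ⟨n - 1, by omega⟩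
  exact pi1_arr m _
end

section
/- Let N be a group, φ an automorphism of N, g ∈ N, and ε ∈ {1, −1}. Let φ′ be the automorphism of N given by φ′(x) = g · φ^ε(x) · g⁻¹ (the composite of φ^ε with conjugation by g). Then the semidirect products N ⋊_φ ℤ and N ⋊_{φ′} ℤ are isomorphic as groups, where in N ⋊_φ ℤ the integer m acts on N by the automorphism φ^m. -/
theorem sd_aux {H : Type*} [Group H] (a b t x : H) (e : a * b * a⁻¹ = t * x * t⁻¹) :
    x = t⁻¹ * a * b * (t⁻¹ * a)⁻¹ := by
  have : x = t⁻¹ * (t * x * t⁻¹) * t := by group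
  rw [this, ← e]; group

open SemidirectProduct in
theorem sd_conj {N : Type*} [Group N] (φ : MulAut N) (n : N) :
    (inl (φ n) : SemidirectProduct N (Multiplicative ℤ) (zpowersHom (MulAut N) φ)) =
      inr (Multiplicative.ofAdd 1) * inl n * (inr (Multiplicative.ofAdd 1))⁻¹ := by
  have h := inl_aut (φ := zpowersHom (MulAut N) φ) (Multiplicative.ofAdd 1) n
  rw [map_inv] at h
  rw [← h]
  simp [zpowersHom_apply]

open SemidirectProduct in
theorem sd_lift {N H : Type*} [Group N] [Group H] (φ : MulAut N) (f : N →* H) (u : H)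
    (h : ∀ n, f (φ n) = u * f n * u⁻¹) :
    ∃ F : SemidirectProduct N (Multiplicative ℤ) (zpowersHom (MulAut N) φ) →* H,
      (∀ n, F (inl n) = f n) ∧ F (inr (Multiplicative.ofAdd 1)) = u := by
  have key : ∀ (m : ℤ) (n : N), f ((φ ^ m) n) = u ^ m * f n * (u ^ m)⁻¹ := by
    intro m
    induction m using Int.induction_on with
    | zero => simp
    | succ i ih =>
      intro n
      rw [zpow_add_one, zpow_add_one, MulAut.mul_apply, ih, h]
      group
    | pred i ih =>
      intro n
      have h2 := h (φ⁻¹ n)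
      rw [MulAut.apply_inv_self] at h2
      rw [zpow_sub_one, zpow_sub_one, MulAut.mul_apply, ih, h2]
      group
  refine ⟨lift f (zpowersHom H u) ?_, ?_, ?_⟩
  · intro m
    ext n
    have k := key m.toAdd n
    rw [← MulAut.conj_apply] at k
    simpa [zpowersHom_apply] using k
  · intro n; simp
  · simp [zpowersHom_apply]

open SemidirectProduct in
theorem sd_ext {N H : Type*} [Group N] [Group H] (φ : MulAut N)
    (F G : SemidirectProduct N (Multiplicative ℤ) (zpowersHom (MulAut N) φ) →* H)
    (h1 : ∀ n, F (inl n) = G (inl n))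
    (h2 : F (inr (Multiplicative.ofAdd 1)) = G (inr (Multiplicative.ofAdd 1))) : F = G := by
  apply hom_ext
  · ext n; exact h1 n
  · apply MonoidHom.ext_mint; exact h2

open SemidirectProduct in
/-- If `φ' = (conjugation by g) ∘ φ^ε` with `ε = ±1`, then the semidirect products
`N ⋊_φ ℤ` and `N ⋊_{φ'} ℤ` are isomorphic. -/
theorem semidirect_iso_of_conj_inv {N : Type*} [Group N]
    (φ φ' : MulAut N) (g : N) (ε : ℤ) (hε : ε = 1 ∨ ε = -1)
    (hφ' : ∀ x, φ' x = g * (φ ^ ε) x * g⁻¹) :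
    Nonempty (SemidirectProduct N (Multiplicative ℤ) (zpowersHom (MulAut N) φ) ≃*
      SemidirectProduct N (Multiplicative ℤ) (zpowersHom (MulAut N) φ')) := by
  have c := sd_conj φ
  have c' := sd_conj φ'
  rcases hε with rfl | rfl
  · simp only [zpow_one] at hφ'
    obtain ⟨F, F1, F2⟩ := sd_lift φ (inl (φ := zpowersHom (MulAut N) φ'))
      (inl g⁻¹ * inr (Multiplicative.ofAdd 1)) (by
        intro n
        have e : φ n = g⁻¹ * φ' n * g := by rw [hφ']; group
        rw [e, map_mul, map_mul, c', map_inv]; group)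
    obtain ⟨G, G1, G2⟩ := sd_lift φ' (inl (φ := zpowersHom (MulAut N) φ))
      (inl g * inr (Multiplicative.ofAdd 1)) (by
        intro n
        rw [hφ', map_mul, map_mul, c, map_inv]; group)
    refine ⟨MonoidHom.toMulEquiv F G ?_ ?_⟩ <;> apply sd_ext <;> simp [F1, F2, G1, G2]
  · have hi : ∀ x, φ' (φ x) = g * x * g⁻¹ := by
      intro x; rw [hφ', zpow_neg_one, MulAut.inv_apply_self]
    obtain ⟨F, F1, F2⟩ := sd_lift φ (inl (φ := zpowersHom (MulAut N) φ'))
      ((inr (Multiplicative.ofAdd 1))⁻¹ * inl g) (by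
        intro n
        have e := c' (φ n)
        rw [hi, map_mul, map_mul, map_inv] at e
        exact sd_aux _ _ _ _ e)
    obtain ⟨G, G1, G2⟩ := sd_lift φ' (inl (φ := zpowersHom (MulAut N) φ))
      (inl g * (inr (Multiplicative.ofAdd 1))⁻¹) (by
        intro n
        have e := c (φ⁻¹ n)
        rw [MulAut.apply_inv_self] at e
        rw [hφ', zpow_neg_one, map_mul, map_mul, e, map_inv]; group)
    refine ⟨MonoidHom.toMulEquiv F G ?_ ?_⟩ <;> apply sd_ext <;>
      simp only [MonoidHom.comp_apply, MonoidHom.id_apply, map_mul, map_inv, F1, F2, G1, G2,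
        implies_true] <;> group
end

section
/- For every integer n ≥ 1, the number of pairs (I, j), where I is a multiset of integers each of which is at least 2, j is an integer with j ≥ 1, the sum of the elements of I plus j equals n, and such that whenever I has exactly one element s one has s ≤ j, is equal to p(n−1) − ⌊(n−1)/2⌋, where p(·) is the partition function and ⌊·⌋ the integer part. -/
theorem split_ones (m : Multiset ℕ) (h : ∀ i ∈ m, 0 < i) :
    m = m.filter (2 ≤ ·) + Multiset.replicate (m.count 1) 1 := by
  conv_lhs => rw [← Multiset.filter_add_not (2 ≤ ·) m]
  congr 1
  rw [← Multiset.filter_eq']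
  apply Multiset.filter_congr
  intro x hx
  have := h x hx
  omega

theorem all_eq (n : ℕ) (hn : 1 ≤ n) :
    {q : Multiset ℕ × ℕ | (∀ s ∈ q.1, 2 ≤ s) ∧ 1 ≤ q.2 ∧ q.1.sum + q.2 = n} =
    Set.range (fun p : Nat.Partition (n - 1) =>
      (p.parts.filter (2 ≤ ·), p.parts.count 1 + 1)) := by
  ext ⟨I, j⟩
  simp only [Set.mem_setOf_eq, Set.mem_range, Prod.mk.injEq]
  constructor
  · rintro ⟨h1, h2, h3⟩
    refine ⟨⟨I + Multiset.replicate (j - 1) 1, ?_, ?_⟩, ?_, ?_⟩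
    · intro i hi
      rw [Multiset.mem_add] at hi
      rcases hi with hi | hi
      · have := h1 i hi
        omega
      · rw [Multiset.eq_of_mem_replicate hi]; exact one_pos
    · simp; omega
    · rw [Multiset.filter_add, Multiset.filter_eq_self.2 h1, Multiset.filter_eq_nil.2, add_zero]
      intro a ha
      rw [Multiset.eq_of_mem_replicate ha]; omega
    · have : Multiset.count 1 I = 0 := by
        rw [Multiset.count_eq_zero]
        intro h
        have := h1 1 h
        omega
      simp [this]; omega
  · rintro ⟨p, rfl, rfl⟩
    refine ⟨fun s hs => (Multiset.mem_filter.1 hs).2, by omega, ?_⟩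
    have h := congrArg Multiset.sum (split_ones p.parts (fun i hi => p.parts_pos hi))
    rw [p.parts_sum] at h
    simp at h
    omega

/-- The number of pairs `(I, j)`, with `I` a multiset of integers `≥ 2`, `j ≥ 1`,
`sum I + j = n`, and `s ≤ j` whenever `I = {s}`, equals `p(n-1) - ⌊(n-1)/2⌋`. -/
theorem count_normal_forms (n : ℕ) (hn : 1 ≤ n) :
    {q : Multiset ℕ × ℕ | (∀ s ∈ q.1, 2 ≤ s) ∧ 1 ≤ q.2 ∧ q.1.sum + q.2 = n ∧
        (∀ s : ℕ, q.1 = {s} → s ≤ q.2)}.ncard =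
      Fintype.card (Nat.Partition (n - 1)) - (n - 1) / 2 := by
  have hA := all_eq n hn
  set A := {q : Multiset ℕ × ℕ | (∀ s ∈ q.1, 2 ≤ s) ∧ 1 ≤ q.2 ∧ q.1.sum + q.2 = n} with hAd
  let B : Set (Multiset ℕ × ℕ) :=
    (fun s : ℕ => (({s} : Multiset ℕ), n - s)) '' (Finset.Icc (n / 2 + 1) (n - 1) : Finset ℕ)
  have hS : {q : Multiset ℕ × ℕ | (∀ s ∈ q.1, 2 ≤ s) ∧ 1 ≤ q.2 ∧ q.1.sum + q.2 = n ∧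
        (∀ s : ℕ, q.1 = {s} → s ≤ q.2)} = A \ B := by
    ext ⟨I, j⟩
    simp only [hAd, B, Set.mem_diff, Set.mem_setOf_eq, Set.mem_image, Prod.mk.injEq,
      Finset.coe_Icc, Set.mem_Icc]
    constructor
    · rintro ⟨h1, h2, h3, h4⟩
      refine ⟨⟨h1, h2, h3⟩, ?_⟩
      rintro ⟨s, hs, rfl, rfl⟩
      have := h4 s rfl
      omega
    · rintro ⟨⟨h1, h2, h3⟩, h4⟩
      refine ⟨h1, h2, h3, ?_⟩
      rintro s rfl
      by_contra hc
      simp at h3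
      exact h4 ⟨s, by omega, rfl, by omega⟩
  have hBA : B ⊆ A := by
    rintro _ ⟨s, hs, rfl⟩
    simp only [Finset.coe_Icc, Set.mem_Icc] at hs
    simp only [hAd, Set.mem_setOf_eq, Multiset.mem_singleton, Multiset.sum_singleton]
    refine ⟨?_, by omega, by omega⟩
    rintro t rfl
    omega
  have hB : B.ncard = (n - 1) / 2 := by
    rw [Set.ncard_image_of_injective, Set.ncard_coe_finset, Nat.card_Icc]
    · omega
    · intro a b h
      simpa using (Prod.mk.inj h).1
  have hAc : A.ncard = Fintype.card (Nat.Partition (n - 1)) := by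
    rw [hA, ← Set.image_univ, Set.ncard_image_of_injective, Set.ncard_univ, Nat.card_eq_fintype_card]
    intro p q h
    obtain ⟨h1, h2⟩ := Prod.mk.inj h
    apply Nat.Partition.ext
    rw [split_ones p.parts (fun i hi => p.parts_pos hi),
      split_ones q.parts (fun i hi => q.parts_pos hi), h1, Nat.add_right_cancel h2]
  have hBf : B.Finite := Set.Finite.image _ (Finset.finite_toSet _)
  rw [hS, Set.ncard_diff hBA hBf, hB, hAc]
end

section
/- Fix an integer n. Consider data D = (r; s_1, …, s_r; j) where r ≥ 1, the s_p are integers with 2 ≤ s_1 ≤ s_2 ≤ … ≤ s_r, j ≥ 1 is an integer, n = j + s_1 + … + s_r, and if r = 1 then s_1 ≤ j. To such D associate two finite multisets of integers: Σ₁(D) = {n+1−s_1, …, n+1−s_r} if j = 1, and Σ₁(D) = {n+1−s_1, …, n+1−s_r} ∪ {n+1−j} if j > 1; and Σ(D) = Σ₁(D) together with the multiset { r + 1 + Σ_{p∉P}(s_p − 1) : P a nonempty subset of {1, …, r} } (one entry for each nonempty subset P). Then the pair of multisets (Σ(D), Σ₁(D)) determines D: if D and D′ are two such data for the same n with Σ(D)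 = Σ(D′) and Σ₁(D) = Σ₁(D′), then r = r′, s_p = s′_p for all p, and j = j′. -/
/-- The multiset `Σ₁` of codimensions of components through `1`:
`{n+1-s_1, …, n+1-s_r}`, together with `n+1-j` when `j > 1`. -/
def SigmaOne (n r j : ℕ) (s : ℕ → ℕ) : Multiset ℕ :=
  (((List.range r).map fun p => n + 1 - s p) : Multiset ℕ) +
    (if 1 < j then {n + 1 - j} else 0)

/-- The full multiset `Σ` of codimensions: `Σ₁` together with one entry
`r + 1 + Σ_{p∉P}(s_p - 1)` for each nonempty subset `P ⊆ {1,…,r}`. -/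
def SigmaAll (n r j : ℕ) (s : ℕ → ℕ) : Multiset ℕ :=
  SigmaOne n r j s +
    ((Finset.univ.powerset.erase (∅ : Finset (Fin r))).val.map
      (fun (P : Finset (Fin r)) => r + 1 + ∑ p ∈ Pᶜ, (s (p : ℕ) - 1)))

theorem aux_sum (r : ℕ) (a : Fin r → ℕ) :
    2 * ((((Finset.univ.powerset.erase (∅ : Finset (Fin r))).val.map
      (fun (P : Finset (Fin r)) => r + 1 + ∑ p ∈ Pᶜ, a p)).sum) + (r + 1 + ∑ p, a p))
      = 2 ^ r * (2 * (r + 1) + ∑ p, a p) := by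
  have e1 : (((Finset.univ.powerset.erase (∅ : Finset (Fin r))).val.map
      (fun (P : Finset (Fin r)) => r + 1 + ∑ p ∈ Pᶜ, a p)).sum) + (r + 1 + ∑ p, a p)
      = ∑ P : Finset (Fin r), (r + 1 + ∑ p ∈ Pᶜ, a p) := by
    have := Finset.sum_erase_add (Finset.univ : Finset (Finset (Fin r)))
      (fun P : Finset (Fin r) => r + 1 + ∑ p ∈ Pᶜ, a p) (Finset.mem_univ ∅)
    rw [← this, Finset.powerset_univ, Finset.compl_empty]
    rfl
  have e2 : ∑ P : Finset (Fin r), (r + 1 + ∑ p ∈ Pᶜ, a p)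
      = ∑ P : Finset (Fin r), (r + 1 + ∑ p ∈ P, a p) :=
    Fintype.sum_equiv (Equiv.mk compl compl compl_compl compl_compl) _ _ (fun P => rfl)
  rw [e1, two_mul]
  nth_rewrite 2 [e2]
  rw [← Finset.sum_add_distrib]
  have e3 : ∀ P : Finset (Fin r), (r + 1 + ∑ p ∈ Pᶜ, a p) + (r + 1 + ∑ p ∈ P, a p)
      = 2 * (r + 1) + ∑ p, a p := by
    intro P
    rw [← Finset.sum_add_sum_compl P a]; ring
  simp only [e3]
  simp

theorem sigma_determines_normal_form (n : ℕ) (r r' j j' : ℕ) (s s' : ℕ → ℕ)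
    (hr : 1 ≤ r) (hr' : 1 ≤ r')
    (hmono : ∀ p q, p ≤ q → q < r → s p ≤ s q)
    (hmono' : ∀ p q, p ≤ q → q < r' → s' p ≤ s' q)
    (h2 : ∀ p < r, 2 ≤ s p) (h2' : ∀ p < r', 2 ≤ s' p)
    (hj : 1 ≤ j) (hj' : 1 ≤ j')
    (hsum : n = j + ∑ p ∈ Finset.range r, s p)
    (hsum' : n = j' + ∑ p ∈ Finset.range r', s' p)
    (hone : r = 1 → s 0 ≤ j) (hone' : r' = 1 → s' 0 ≤ j')
    (hS : SigmaAll n r j s = SigmaAll n r' j' s')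
    (hS1 : SigmaOne n r j s = SigmaOne n r' j' s') :
    r = r' ∧ j = j' ∧ ∀ p < r, s p = s' p := by
  unfold SigmaAll at hS
  rw [hS1, add_right_inj] at hS
  have hrr : r = r' := by
    have h := congrArg Multiset.card hS
    simp only [Multiset.card_map, Finset.card_val, Finset.powerset_univ,
      Finset.card_erase_of_mem (Finset.mem_univ _), Finset.card_univ, Fintype.card_finset,
      Fintype.card_fin] at h
    have p1 := Nat.one_le_two_pow (n := r)
    have p2 := Nat.one_le_two_pow (n := r')
    exact Nat.pow_right_injective (le_refl 2) (show 2 ^ r = 2 ^ r' by omega)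
  subst hrr
  have hjj : j = j' := by
    rcases Nat.lt_or_ge 1 r with h1 | h1
    · have a1 := aux_sum r (fun p => s p - 1)
      have a2 := aux_sum r (fun p => s' p - 1)
      rw [hS] at a1
      have key : ∀ (t : ℕ → ℕ), (∀ p < r, 2 ≤ t p) →
          ∑ p : Fin r, (t p - 1) + r = ∑ p ∈ Finset.range r, t p := by
        intro t ht
        rw [Fin.sum_univ_eq_sum_range (fun p => t p - 1) r]
        have : ∑ p ∈ Finset.range r, t p = ∑ p ∈ Finset.range r, ((t p - 1) + 1) :=
          Finset.sum_congr rfl (fun p hp => by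
            have := ht p (Finset.mem_range.1 hp); omega)
        rw [this, Finset.sum_add_distrib]; simp
      have k1 := key s h2
      have k2 := key s' h2'
      have hp : 4 ≤ 2 ^ r := by
        calc 4 = 2 ^ 2 := rfl
          _ ≤ 2 ^ r := Nat.pow_le_pow_right (by norm_num) h1
      generalize (Multiset.map (fun (P : Finset (Fin r)) => r + 1 + ∑ p ∈ Pᶜ, (s' (p : ℕ) - 1)) _).sum = X at a1 a2
      generalize ∑ p : Fin r, (s p - 1) = A at *
      generalize ∑ p : Fin r, (s' p - 1) = B at *
      generalize 2 ^ r = N at *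
      have : A = B := by
        zify at *
        have h0 : ((N : ℤ) - 2) * (A - B) = 0 := by linarith
        rcases mul_eq_zero.1 h0 with h | h <;> linarith
      omega
    · have : r = 1 := by omega
      subst this
      have b1 := hone rfl
      have b2 := hone' rfl
      have c1 := h2 0 (by norm_num)
      have c2 := h2' 0 (by norm_num)
      simp at hsum hsum'
      have d1 : 1 < j := by omega
      have d2 : 1 < j' := by omega
      have m : n + 1 - s 0 ∈ SigmaOne n 1 j' s' := by
        rw [← hS1]; simp [SigmaOne]
      simp [SigmaOne, d2] at m
      omega
  subst hjj
  refine ⟨rfl, rfl, ?_⟩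
  unfold SigmaOne at hS1
  rw [add_left_inj] at hS1
  have hperm := Multiset.coe_eq_coe.1 hS1
  have hp2 := hperm.map (fun x => n + 1 - x)
  have bnd : ∀ (t : ℕ → ℕ), n = j + ∑ p ∈ Finset.range r, t p →
      (List.map (fun x => n + 1 - x) ((List.range r).map fun p => n + 1 - t p))
        = (List.range r).map t := by
    intro t ht
    rw [List.map_map]
    apply List.map_congr_left
    intro p hp
    have : t p ≤ ∑ p ∈ Finset.range r, t p :=
      Finset.single_le_sum (f := t) (fun _ _ => Nat.zero_le _)
        (Finset.mem_range.2 (List.mem_range.1 hp))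
    simp only [Function.comp]
    omega
  rw [bnd s hsum, bnd s' hsum'] at hp2
  have srt : ∀ t : ℕ → ℕ, (∀ p q, p ≤ q → q < r → t p ≤ t q) →
      ((List.range r).map t).Pairwise (· ≤ ·) := by
    intro t ht
    rw [List.pairwise_map]
    refine (List.pairwise_lt_range (n := r)).imp_of_mem ?_
    intro a b _ hb hab
    exact ht a b hab.le (List.mem_range.1 hb)
  have heq := hp2.eq_of_pairwise (fun a b _ _ h h' => le_antisymm h h') (srt s hmono) (srt s' hmono')
  intro p hp
  exact List.map_inj_left.1 heq p (List.mem_range.2 hp)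
end

section
/- Let n ≥ 2 and r ≥ 1, and let I_1, …, I_r, J be pairwise disjoint subsets of {1, …, n} whose union is {1, …, n}, with |I_p| ≥ 2 for each p, J nonempty and n ∈ J. Put k_p = max I_p. Let S be the set of all t = (t_1, …, t_n) ∈ (ℂ*)ⁿ such that: t_n = 1; t_{k_p}² = 1 for all p; and (t_{k_p} + 1)(t_i − 1)(t_j − 1) = 0 for all p, all i ∈ I_p ∖ {k_p}, and all j ∈ {1,…,n} ∖ I_p. Then S is exactly the union of the following subsets of (ℂ*)ⁿ: (i) for each p ∈ {1,…,r}, the subtorus { t : t_i = 1 for all i ∈ ({1,…,n} ∖ I_p) ∪ {k_p} }; (ii) if |J| > 1, the subtorus { t : t_i = 1 for all i ∈ ({1,…,n} ∖ J) ∪ {n} }; (iii) for each nonempty subset P ⊆ {1,…,r}, the translated subtorus { t : t_n = 1, t_i = 1 for all i ∈ ⋃_{p∉P} I_p, and t_{k_p} = −1 for all p ∈ P }. -/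
theorem sq_or {x : ℂ} (h : x ^ 2 = 1) : x = 1 ∨ x = -1 := by
  have h' : (x - 1) * (x + 1) = 0 := by linear_combination h
  rcases mul_eq_zero.mp h' with h | h
  · exact Or.inl (sub_eq_zero.mp h)
  · exact Or.inr (eq_neg_of_add_eq_zero_left h)

/-- Description of the bottom characteristic variety of a depth-2 completely
decomposable arrangement with normal-form blocks `I_1, …, I_r` and `J`:
the solution set of the defining equations is exactly the union of the subtori
`T(Ǐ_p)`, the subtorus `T(J̌)` (when `|J| > 1`), and the translated subtori
indexed by nonempty `P ⊆ {1,…,r}`. -/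
theorem bottom_characteristic_variety (n r : ℕ) (hn : 2 ≤ n) (hr : 1 ≤ r)
    (I : Fin r → Finset (Fin n)) (J : Finset (Fin n))
    (hdisjI : ∀ p q, p ≠ q → Disjoint (I p) (I q))
    (hdisjJ : ∀ p, Disjoint (I p) J)
    (hcover : (Finset.univ.biUnion I) ∪ J = Finset.univ)
    (hcard : ∀ p, 2 ≤ (I p).card)
    (hJne : J.Nonempty)
    (en : Fin n) (hen : (en : ℕ) = n - 1) (henJ : en ∈ J)
    (k : Fin r → Fin n)
    (hk : ∀ p, k p ∈ I p ∧ ∀ i ∈ I p, i ≤ k p) :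
    ∀ t : Fin n → ℂ, (∀ i, t i ≠ 0) →
      ((t en = 1 ∧ (∀ p, (t (k p)) ^ 2 = 1) ∧
          ∀ p, ∀ i ∈ I p, i ≠ k p → ∀ j, j ∉ I p →
            (t (k p) + 1) * (t i - 1) * (t j - 1) = 0) ↔
        ((∃ p, ∀ i, (i ∉ I p ∨ i = k p) → t i = 1) ∨
          (1 < J.card ∧ ∀ i, (i ∉ J ∨ i = en) → t i = 1) ∨
          (∃ P : Finset (Fin r), P.Nonempty ∧ t en = 1 ∧
            (∀ p, p ∉ P → ∀ i ∈ I p, t i = 1) ∧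
            (∀ p ∈ P, t (k p) = -1)))) := by
  intro t _
  have hnotJ : ∀ p, ∀ i ∈ I p, i ∉ J := fun p i hi hj =>
    Finset.disjoint_left.mp (hdisjJ p) hi hj
  have hnotI : ∀ p q, p ≠ q → ∀ i ∈ I p, i ∉ I q := fun p q h i hi hj =>
    Finset.disjoint_left.mp (hdisjI p q h) hi hj
  have hcov : ∀ i, (∃ p, i ∈ I p) ∨ i ∈ J := by
    intro i
    have h := Finset.mem_univ i
    rw [← hcover] at h
    simpa using h
  constructor
  · rintro ⟨h1, h2, h3⟩
    by_cases hP : ∃ q, t (k q) = -1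
    · obtain ⟨q, hq⟩ := hP
      right; right
      classical
      refine ⟨Finset.univ.filter (fun p => t (k p) = -1), ⟨q, by simp [hq]⟩, h1, ?_, ?_⟩
      · intro p hp i hi
        have hp' : t (k p) ≠ -1 := by simpa using hp
        have hp1 : t (k p) = 1 := (sq_or (h2 p)).resolve_right hp'
        by_cases hik : i = k p
        · rw [hik, hp1]
        · have hqp : q ≠ p := by
            rintro rfl
            exact hp' hq
          have h := h3 p i hi hik (k q) (hnotI q p hqp _ (hk q).1)
          rw [hp1, hq] at h
          have h' : t i - 1 = 0 := by linear_combination (-1 / 4 : ℂ) * h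
          exact sub_eq_zero.mp h'
      · intro p hp
        simpa using hp
    · have hP' : ∀ p, t (k p) = 1 := fun p =>
        (sq_or (h2 p)).resolve_right (fun h => hP ⟨p, h⟩)
      by_cases hx : ∃ p, ∃ i ∈ I p, t i ≠ 1
      · obtain ⟨p, i, hi, hti⟩ := hx
        left
        refine ⟨p, ?_⟩
        rintro j (hj | rfl)
        · have hik : i ≠ k p := by
            rintro rfl
            exact hti (hP' p)
          have h := h3 p i hi hik j hj
          rw [hP' p] at h
          rcases mul_eq_zero.mp h with h | h
          · rcases mul_eq_zero.mp h with h | h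
            · norm_num at h
            · exact absurd (sub_eq_zero.mp h) hti
          · exact sub_eq_zero.mp h
        · exact hP' p
      · push Not at hx
        by_cases hJ : 1 < J.card
        · right; left
          refine ⟨hJ, ?_⟩
          rintro i (hi | rfl)
          · rcases hcov i with ⟨p, hp⟩ | h
            · exact hx p i hp
            · exact absurd h hi
          · exact h1
        · left
          refine ⟨⟨0, hr⟩, fun i _ => ?_⟩
          rcases hcov i with ⟨p, hp⟩ | h
          · exact hx p i hp
          · rw [Finset.card_le_one.mp (not_lt.mp hJ) i h en henJ, h1]
  · rintro (⟨p, hp⟩ | ⟨-, hJ⟩ | ⟨P, -, h1, h2, h3⟩)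
    · refine ⟨hp en (Or.inl fun h => hnotJ p en h henJ), fun q => ?_, fun q i hi _ j hj => ?_⟩
      · by_cases hqp : q = p
        · subst hqp
          rw [hp _ (Or.inr rfl)]; norm_num
        · rw [hp _ (Or.inl (hnotI q p hqp _ (hk q).1))]; norm_num
      · by_cases hqp : q = p
        · subst hqp
          rw [hp j (Or.inl hj)]; ring
        · rw [hp i (Or.inl (hnotI q p hqp _ hi))]; ring
    · refine ⟨hJ en (Or.inr rfl), fun q => ?_, fun q i hi _ j hj => ?_⟩
      · rw [hJ _ (Or.inl (hnotJ q _ (hk q).1))]; norm_num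
      · rw [hJ i (Or.inl (hnotJ q i hi))]; ring
    · refine ⟨h1, fun q => ?_, fun q i hi _ j hj => ?_⟩
      · by_cases hq : q ∈ P
        · rw [h3 q hq]; norm_num
        · rw [h2 q hq _ (hk q).1]; norm_num
      · by_cases hq : q ∈ P
        · rw [h3 q hq]; ring
        · rw [h2 q hq i hi]; ring
end
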